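/- Let a>-1, b>-1/2 and δ>a+b+3/2. Then sup_{n∈ℕ₀} d_{a,b}·∫_𝕌 |K_n^δ(U_{a,b};𝟏,y)|·U_{a,b}(y) dy < ∞; that is, the L¹(𝕌;U_{a,b}) norms of the Cesàro (C,δ) kernels with one argument at the corner 𝟏=(1,1) are bounded uniformly in n. -/

import Mathlib

open MeasureTheory Real Filter Set
open scoped RealInnerProductSpace ENNReal

noncomputable section

/-- Pochhammer symbol `(a)_n = a(a+1)⋯(a+n-1)`. -/
def poch (a : ℝ) (n : ℕ) : ℝ := ∏ i ∈ Finset.range n, (a + i)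

/-- Jacobi polynomial `P_n^{(a,b)}(t)` via its hypergeometric expansion. -/
def jacobiP (n : ℕ) (a b : ℝ) (t : ℝ) : ℝ :=
  (poch (a + 1) n / (n.factorial : ℝ)) *
    ∑ j ∈ Finset.range (n + 1),
      (poch (-(n : ℝ)) j * poch ((n : ℝ) + a + b + 1) j) /
        (poch (a + 1) j * (j.factorial : ℝ)) * ((1 - t) / 2) ^ j

/-- Squared norm `h_n^{(a,b)}` of the Jacobi polynomials. -/
def hJ (n : ℕ) (a b : ℝ) : ℝ :=
  (poch (a + 1) n * poch (b + 1) n * (a + b + (n : ℝ) + 1)) /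
    ((n.factorial : ℝ) * poch (a + b + 2) n * (a + b + 2 * (n : ℝ) + 1))

/-- Normalization constant `c_{a,b}` of the Jacobi weight. -/
def cJ (a b : ℝ) : ℝ := Real.Gamma (a + b + 2) / (Real.Gamma (a + 1) * Real.Gamma (b + 1))

/-- Generalized binomial coefficient `C(n+δ, n) = (δ+1)_n/n!`. -/
def binomC (δ : ℝ) (n : ℕ) : ℝ := poch (δ + 1) n / (n.factorial : ℝ)

/-- The parabolic domain `𝕌 = {(x₁,x₂) : x₁² ≤ x₂ ≤ 1}`. -/
def Udom : Set (ℝ × ℝ) := {x | x.1 ^ 2 ≤ x.2 ∧ x.2 ≤ 1}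

/-- The curved part `𝕌₀` of the boundary of `𝕌`. -/
def Udom0 : Set (ℝ × ℝ) := {x ∈ Udom | x.2 = x.1 ^ 2}

/-- The weight `U_{a,b}` on the parabolic domain. -/
def Uw (a b : ℝ) (x : ℝ × ℝ) : ℝ := (1 - x.2) ^ a * (x.2 - x.1 ^ 2) ^ (b - 1/2)

/-- Normalization constant `d_{a,b}` of `U_{a,b}`. -/
def dU (a b : ℝ) : ℝ := (∫ x in Udom, Uw a b x)⁻¹

/-- The weighted measure `U_{a,b}(x) dx` on `𝕌`. -/
def μU (a b : ℝ) : Measure (ℝ × ℝ) :=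
  (volume.restrict Udom).withDensity fun x => ENNReal.ofReal (Uw a b x)

/-- The orthogonal basis `P_{k,n}^{a,b}` on the parabolic domain (with the continuous
extension to `x₂ = 0`, where in Lean `x₁/√x₂ = 0` and `(√x₂)^k = 0` for `k ≥ 1`). -/
def PknU (a b : ℝ) (k n : ℕ) (x : ℝ × ℝ) : ℝ :=
  jacobiP (n - k) (b + (k : ℝ)) a (1 - 2 * x.2) * (Real.sqrt x.2) ^ k *
    jacobiP k (b - 1/2) (b - 1/2) (x.1 / Real.sqrt x.2)

/-- Squared norms `h_{k,n}^{a,b}`. -/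
def hknU (a b : ℝ) (k n : ℕ) : ℝ :=
  (cJ b a / cJ (b + (k : ℝ)) a) * hJ (n - k) (b + (k : ℝ)) a * hJ k (b - 1/2) (b - 1/2)

/-- Reproducing kernel `P_n(U_{a,b}; x, y)` on the parabolic domain. -/
def PnU (a b : ℝ) (n : ℕ) (x y : ℝ × ℝ) : ℝ :=
  ∑ k ∈ Finset.range (n + 1), PknU a b k n x * PknU a b k n y / hknU a b k n

/-- Partial-sum kernel `K_n(U_{a,b}; x, y)`. -/
def KnU (a b : ℝ) (n : ℕ) (x y : ℝ × ℝ) : ℝ :=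
  ∑ m ∈ Finset.range (n + 1), PnU a b m x y

/-- Cesàro `(C,δ)` kernel `K_n^δ(U_{a,b}; x, y)`. -/
def KnUCes (a b δ : ℝ) (n : ℕ) (x y : ℝ × ℝ) : ℝ :=
  (binomC δ n)⁻¹ * ∑ m ∈ Finset.range (n + 1), binomC (δ - 1) (n - m) * KnU a b m x y

/-- Cesàro `(C,δ)` means `S_n^δ(U_{a,b}; f, x)`. -/
def SnUCes (a b δ : ℝ) (n : ℕ) (f : ℝ × ℝ → ℝ) (x : ℝ × ℝ) : ℝ :=
  dU a b * ∫ y in Udom, f y * KnUCes a b δ n x y * Uw a b y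

/-- `Z_m^λ`, the normalized Gegenbauer polynomial (`2T_m` in the limiting case `λ = 0`). -/
def Zm (lam : ℝ) (m : ℕ) (t : ℝ) : ℝ :=
  if lam = 0 then (if m = 0 then 1 else 2 * (Polynomial.Chebyshev.T ℝ (m : ℤ)).eval t)
  else ((m : ℝ) + lam) / lam * (poch (2 * lam) m / poch (lam + 1/2) m) *
    jacobiP m (lam - 1/2) (lam - 1/2) t

/-- Euclidean space `ℝ^d`. -/
abbrev Euc (d : ℕ) := EuclideanSpace ℝ (Fin d)

/-- The surface measure on the unit sphere `𝕊^{d-1}`. -/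
def sphMeas (d : ℕ) : Measure (Metric.sphere (0 : Euc d) 1) :=
  (volume : Measure (Euc d)).toSphere

/-- The surface area `ω_d` of the unit sphere. -/
def ωd (d : ℕ) : ℝ := (sphMeas d Set.univ).toReal

/-- Integral over the unit sphere. -/
def sphInt (d : ℕ) (f : Euc d → ℝ) : ℝ := ∫ ξ, f (ξ : Euc d) ∂(sphMeas d)

/-- Integral over the surface of the paraboloid `𝕍₀^{d+1}`:
`∫_{𝕍₀} f dσ = ∫_0^1 t^{(d-1)/2} ∫_{𝕊^{d-1}} f(√t ξ, t) dσ_𝕊(ξ) dt`. -/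
def V0Int (d : ℕ) (f : Euc d → ℝ → ℝ) : ℝ :=
  ∫ t in (0:ℝ)..1, t ^ (((d : ℝ) - 1) / 2) * ∫ ξ, f (Real.sqrt t • (ξ : Euc d)) t ∂(sphMeas d)

/-- The weight `ϖ_{β,γ}(t) = t^β (1-t)^γ`. -/
def wt (β γ : ℝ) (t : ℝ) : ℝ := t ^ β * (1 - t) ^ γ

/-- Normalization constant `b_{β,γ}` on the surface of the paraboloid. -/
def bV0 (d : ℕ) (β γ : ℝ) : ℝ := (V0Int d fun _ t => wt β γ t)⁻¹

/-- The surface of the paraboloid `𝕍₀^{d+1} = {(x,t) : ‖x‖² = t ≤ 1}`. -/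
def V0set (d : ℕ) : Set (Euc d × ℝ) := {q | ‖q.1‖ ^ 2 = q.2 ∧ q.2 ≤ 1}

/-- The weighted measure `ϖ_{β,γ} dσ` on (the sphere-parametrization of) `𝕍₀^{d+1}`. -/
def μV0 (d : ℕ) (β γ : ℝ) : Measure (Metric.sphere (0 : Euc d) 1 × ℝ) :=
  ((sphMeas d).prod (volume.restrict (Set.Icc (0:ℝ) 1))).withDensity
    fun p => ENNReal.ofReal (p.2 ^ (((d : ℝ) - 1) / 2) * wt β γ p.2)

/-- Squared norms `h_{m,n}^{β,γ}` on the surface of the paraboloid. -/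
def hV0 (d : ℕ) (β γ : ℝ) (m n : ℕ) : ℝ :=
  (cJ (β + ((d : ℝ) - 1) / 2) γ / cJ ((m : ℝ) + β + ((d : ℝ) - 1) / 2) γ) *
    hJ (n - m) ((m : ℝ) + β + ((d : ℝ) - 1) / 2) γ

/-- The reproducing kernel `P_n(ϖ_{β,γ}; (√t ξ, t), (√s η, s))` on `𝕍₀^{d+1}`,
written as a function of `t`, `s` and `c = ⟨ξ,η⟩`. -/
def PnV0 (d : ℕ) (β γ : ℝ) (n : ℕ) (t s c : ℝ) : ℝ :=
  ∑ m ∈ Finset.range (n + 1),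
    jacobiP (n - m) ((m : ℝ) + β + ((d : ℝ) - 1) / 2) γ (1 - 2 * t) *
      jacobiP (n - m) ((m : ℝ) + β + ((d : ℝ) - 1) / 2) γ (1 - 2 * s) / hV0 d β γ m n *
      (Real.sqrt t) ^ m * (Real.sqrt s) ^ m * Zm (((d : ℝ) - 2) / 2) m c

/-- Partial-sum kernel `K_n(ϖ_{β,γ})` on `𝕍₀^{d+1}`. -/
def KnV0 (d : ℕ) (β γ : ℝ) (n : ℕ) (t s c : ℝ) : ℝ :=
  ∑ m ∈ Finset.range (n + 1), PnV0 d β γ m t s c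

/-- Cesàro `(C,δ)` kernel on `𝕍₀^{d+1}`. -/
def KnV0Ces (d : ℕ) (β γ δ : ℝ) (n : ℕ) (t s c : ℝ) : ℝ :=
  (binomC δ n)⁻¹ * ∑ m ∈ Finset.range (n + 1), binomC (δ - 1) (n - m) * KnV0 d β γ m t s c

/-- Cesàro `(C,δ)` means `S_n^δ(ϖ_{β,γ}; f, (√t ξ, t))` on `𝕍₀^{d+1}`. -/
def SnV0Ces (d : ℕ) (β γ δ : ℝ) (n : ℕ) (f : Euc d × ℝ → ℝ) (ξ : Euc d) (t : ℝ) : ℝ :=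
  bV0 d β γ * ∫ s in (0:ℝ)..1, s ^ (((d : ℝ) - 1) / 2) * wt β γ s *
    ∫ η, f (Real.sqrt s • (η : Euc d), s) * KnV0Ces d β γ δ n t s ⟪ξ, (η : Euc d)⟫ ∂(sphMeas d)

/-- Normalization constant `τ_β` in the definition of `T_{β,γ}`. -/
def τβ (d : ℕ) (β : ℝ) : ℝ :=
  (∫ z₁ in (-1:ℝ)..1, ∫ z₂ in (-1:ℝ)..1,
    (1 - z₁) ^ (((d : ℝ) - 2) / 2) * (1 + z₁) ^ (β - 1/2) * (1 - z₂ ^ 2) ^ β)⁻¹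

/-- The operator `T_{β,γ}` on the surface of the paraboloid, with
`(x,t) = (√t ξ, t)` and `(y,s) = (√s η, s)`. -/
def TV0 (d : ℕ) (β γ : ℝ) (g : ℝ × ℝ → ℝ × ℝ → ℝ) (ξ η : Euc d) (t s : ℝ) : ℝ :=
  if β = -(1/2) then g (Real.sqrt t, t) (⟪ξ, Real.sqrt s • η⟫, s)
  else τβ d β * ∫ z₁ in (-1:ℝ)..1, ∫ z₂ in (-1:ℝ)..1,
    g (Real.sqrt t, t) (Real.sqrt s * ((1 - z₁) / 2 * ⟪ξ, η⟫ + (1 + z₁) / 2 * z₂), s) *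
      ((1 - z₁) ^ (((d : ℝ) - 2) / 2) * (1 + z₁) ^ (β - 1/2) * (1 - z₂ ^ 2) ^ β)

/-- The pseudo convolution `f ∗_{𝕍₀} g` on the surface of the paraboloid. -/
def convV0 (d : ℕ) (β γ : ℝ) (f : Euc d × ℝ → ℝ) (g : ℝ × ℝ → ℝ × ℝ → ℝ)
    (η : Euc d) (s : ℝ) : ℝ :=
  bV0 d β γ * ∫ t in (0:ℝ)..1, t ^ (((d : ℝ) - 1) / 2) * wt β γ t *
    ∫ ξ, f (Real.sqrt t • (ξ : Euc d), t) * TV0 d β γ g (ξ : Euc d) η t s ∂(sphMeas d)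

/-- The solid paraboloid `𝕍^{d+1} = {(x,t) : ‖x‖² ≤ t ≤ 1}`. -/
def Vset (d : ℕ) : Set (Euc d × ℝ) := {q | ‖q.1‖ ^ 2 ≤ q.2 ∧ q.2 ≤ 1}

/-- The weight `W_{β,γ,μ}` on the solid paraboloid. -/
def WW (d : ℕ) (β γ μ : ℝ) (q : Euc d × ℝ) : ℝ :=
  q.2 ^ β * (1 - q.2) ^ γ * (q.2 - ‖q.1‖ ^ 2) ^ (μ - 1/2)

/-- Normalization constant `b_{β,γ,μ}`. -/
def bW (d : ℕ) (β γ μ : ℝ) : ℝ := (∫ q in Vset d, WW d β γ μ q)⁻¹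

/-- The weighted measure `W_{β,γ,μ}(x,t) dx dt` on `𝕍^{d+1}`. -/
def μW (d : ℕ) (β γ μ : ℝ) : Measure (Euc d × ℝ) :=
  (volume.restrict (Vset d)).withDensity fun q => ENNReal.ofReal (WW d β γ μ q)

/-- The weight `ϖ_μ(y) = (1-‖y‖²)^{μ-1/2}` on the unit ball. -/
def wB (d : ℕ) (μ : ℝ) (y : Euc d) : ℝ := (1 - ‖y‖ ^ 2) ^ (μ - 1/2)

/-- Normalization constant `b_μ` of `ϖ_μ` on the unit ball. -/
def bB (d : ℕ) (μ : ℝ) : ℝ := (∫ y in Metric.closedBall (0 : Euc d) 1, wB d μ y)⁻¹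

/-- Normalization constant `σ_μ = (∫_{-1}^1 (1-u²)^{μ-1} du)⁻¹`. -/
def σμ (μ : ℝ) : ℝ := (∫ u in (-1:ℝ)..1, (1 - u ^ 2) ^ (μ - 1))⁻¹

/-- `ξ₀(x,t,y,s;u) = (⟨x,y⟩ + u √(t-‖x‖²) √(s-‖y‖²))/√(st)`. -/
def xi0 (d : ℕ) (x : Euc d) (t : ℝ) (y : Euc d) (s : ℝ) (u : ℝ) : ℝ :=
  (⟪x, y⟫ + u * Real.sqrt (t - ‖x‖ ^ 2) * Real.sqrt (s - ‖y‖ ^ 2)) / Real.sqrt (s * t)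

/-- Squared norms `h_{m,n}^{β,γ,μ}` on the solid paraboloid. -/
def hW (d : ℕ) (β γ μ : ℝ) (m n : ℕ) : ℝ :=
  (cJ (β + μ + ((d : ℝ) - 1) / 2) γ / cJ ((m : ℝ) + β + μ + ((d : ℝ) - 1) / 2) γ) *
    hJ (n - m) ((m : ℝ) + β + μ + ((d : ℝ) - 1) / 2) γ

/-- The reproducing kernel `P_n(W_{β,γ,μ}; (x,t), (y,s))` on the solid paraboloid. -/
def PnW (d : ℕ) (β γ μ : ℝ) (n : ℕ) (x : Euc d) (t : ℝ) (y : Euc d) (s : ℝ) : ℝ :=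
  σμ μ * ∫ u in (-1:ℝ)..1,
    (∑ m ∈ Finset.range (n + 1),
      jacobiP (n - m) ((m : ℝ) + β + μ + ((d : ℝ) - 1) / 2) γ (1 - 2 * t) *
        jacobiP (n - m) ((m : ℝ) + β + μ + ((d : ℝ) - 1) / 2) γ (1 - 2 * s) / hW d β γ μ m n *
        (Real.sqrt t) ^ m * (Real.sqrt s) ^ m *
        Zm (μ + ((d : ℝ) - 1) / 2) m (xi0 d x t y s u)) * (1 - u ^ 2) ^ (μ - 1)

/-- Partial-sum kernel `K_n(W_{β,γ,μ})`. -/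
def KnW (d : ℕ) (β γ μ : ℝ) (n : ℕ) (x : Euc d) (t : ℝ) (y : Euc d) (s : ℝ) : ℝ :=
  ∑ m ∈ Finset.range (n + 1), PnW d β γ μ m x t y s

/-- Cesàro `(C,δ)` kernel on the solid paraboloid. -/
def KnWCes (d : ℕ) (β γ μ δ : ℝ) (n : ℕ) (x : Euc d) (t : ℝ) (y : Euc d) (s : ℝ) : ℝ :=
  (binomC δ n)⁻¹ * ∑ m ∈ Finset.range (n + 1), binomC (δ - 1) (n - m) * KnW d β γ μ m x t y s

/-- Cesàro `(C,δ)` means `S_n^δ(W_{β,γ,μ}; f, (x,t))`. -/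
def SnWCes (d : ℕ) (β γ μ δ : ℝ) (n : ℕ) (f : Euc d × ℝ → ℝ) (x : Euc d) (t : ℝ) : ℝ :=
  bW d β γ μ * ∫ q in Vset d, f q * KnWCes d β γ μ δ n x t q.1 q.2 * WW d β γ μ q

/-- `ξ(x,t,y,s;z,u)` in the connection kernel on the solid paraboloid. -/
def ξW (d : ℕ) (x : Euc d) (t : ℝ) (y : Euc d) (s : ℝ) (z₁ z₂ u : ℝ) : ℝ :=
  (1 - z₁) / 2 * xi0 d x t y s u + (1 + z₁) / 2 * z₂

/-- Normalization constant `κ_β`. -/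
def κβ (d : ℕ) (β μ : ℝ) : ℝ :=
  (∫ z₁ in (-1:ℝ)..1, ∫ z₂ in (-1:ℝ)..1, ∫ u in (-1:ℝ)..1,
    (1 - z₁) ^ (μ + ((d : ℝ) - 1) / 2) * (1 + z₁) ^ (β - 1) * (1 - z₂ ^ 2) ^ (β - 1/2) *
      (1 - u ^ 2) ^ (μ - 1))⁻¹

/-- The operator `T_{β,γ,μ}` on the solid paraboloid. -/
def TW (d : ℕ) (β γ μ : ℝ) (g : ℝ × ℝ → ℝ × ℝ → ℝ) (x : Euc d) (t : ℝ) (y : Euc d) (s : ℝ) : ℝ :=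
  if β = 0 then
    σμ μ * ∫ u in (-1:ℝ)..1,
      g (Real.sqrt t, t) (Real.sqrt s * xi0 d x t y s u, s) * (1 - u ^ 2) ^ (μ - 1)
  else
    κβ d β μ * ∫ z₁ in (-1:ℝ)..1, ∫ z₂ in (-1:ℝ)..1, ∫ u in (-1:ℝ)..1,
      g (Real.sqrt t, t) (Real.sqrt s * ξW d x t y s z₁ z₂ u, s) *
        ((1 - z₁) ^ (μ + ((d : ℝ) - 1) / 2) * (1 + z₁) ^ (β - 1) * (1 - z₂ ^ 2) ^ (β - 1/2) *
          (1 - u ^ 2) ^ (μ - 1))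

/-- Directional derivative `⟨x,∇⟩f(x) = ∑ xᵢ ∂ᵢ f(x)`. -/
def xGrad (d : ℕ) (f : Euc d → ℝ) (x : Euc d) : ℝ := fderiv ℝ f x x

/-- Laplacian `Δf(x) = ∑ ∂ᵢ² f(x)`. -/
def lapl (d : ℕ) (f : Euc d → ℝ) (x : Euc d) : ℝ :=
  ∑ i : Fin d, fderiv ℝ (fun y => fderiv ℝ f y (EuclideanSpace.single i 1)) x
    (EuclideanSpace.single i 1)


/-- `Q_{m,n}(x,t) = P_{n-m}^{(m+α,γ)}(1-2t) t^{m/2} Y(x/√t)`. -/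
def QV0gen (d : ℕ) (α γ : ℝ) (m n : ℕ) (Y : Euc d → ℝ) (x : Euc d) (t : ℝ) : ℝ :=
  jacobiP (n - m) ((m : ℝ) + α) γ (1 - 2 * t) * (Real.sqrt t) ^ m * Y ((Real.sqrt t)⁻¹ • x)

end


open MeasureTheory Real Filter Set
open scoped RealInnerProductSpace ENNReal

lemma poch_zero (a : ℝ) : poch a 0 = 1 := by simp [poch]
notation "pvv" => by positivity
notation "lnn" => by linarith
notation "nmm" => by norm_num
notation "fpp" => by fun_prop
notation "eoo" => ENNReal.ofReal

lemma poch_succ (a : ℝ) (n : ℕ) : poch a (n+1) = poch a n * (a + n) := by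
  simp [poch, Finset.prod_range_succ]
lemma poch_one (a : ℝ) : poch a 1 = a := by simp [poch]
lemma poch_add (a : ℝ) (m n : ℕ) : poch a (m+n) = poch a m * poch (a+m) n := by
  induction n with
  | zero => simp [poch_zero]
  | succ n ih => rw [← add_assoc, poch_succ, ih, poch_succ]; push_cast; ring
lemma poch_succ' (a : ℝ) (n : ℕ) : poch a (n+1) = a * poch (a+1) n := by
  rw [add_comm, poch_add, poch_one]; simp
lemma poch_pos {a : ℝ} (ha : 0 < a) (n : ℕ) : 0 < poch a n := by
  unfold poch; exact Finset.prod_pos fun i _ => by positivity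
lemma poch_nonneg {a : ℝ} (ha : 0 ≤ a) (n : ℕ) : 0 ≤ poch a n := by
  unfold poch; exact Finset.prod_nonneg fun i _ => by positivity
lemma poch_abs_le (a : ℝ) (n : ℕ) : |poch a n| ≤ poch |a| n := by
  unfold poch
  rw [Finset.abs_prod]
  exact Finset.prod_le_prod (fun i _ => abs_nonneg _) fun i _ => (abs_add_le _ _).trans (by simp)
lemma poch_one_eq (n : ℕ) : poch 1 n = n.factorial := by
  induction n with
  | zero => simp [poch_zero]
  | succ n ih => rw [poch_succ, ih, Nat.factorial_succ]; push_cast; ring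
lemma poch_neg_nat (n j : ℕ) :
    poch (-(n:ℝ)) j = (-1)^j * (j.factorial : ℝ) * (n.choose j : ℝ) := by
  have : poch (-(n:ℝ)) j = (-1)^j * (n.descFactorial j : ℝ) := by
    induction j with
    | zero => simp [poch_zero]
    | succ j ih =>
      rw [poch_succ, ih, Nat.descFactorial_succ]
      rcases le_or_gt j n with h | h
      · push_cast [Nat.cast_sub h]; ring
      · rw [Nat.descFactorial_of_lt h]; simp
  rw [this, Nat.descFactorial_eq_factorial_mul_choose]; push_cast; ring
lemma alt_succ (n : ℕ) (g : ℕ → ℝ) :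
    ∑ j ∈ Finset.range (n+2), (-1:ℝ)^j * ((n+1).choose j : ℝ) * g j =
    ∑ j ∈ Finset.range (n+1), (-1:ℝ)^j * (n.choose j : ℝ) * g j -
    ∑ j ∈ Finset.range (n+1), (-1:ℝ)^j * (n.choose j : ℝ) * g (j+1) := by
  rw [Finset.sum_range_succ']
  have h1 : ∑ j ∈ Finset.range (n+1), (-1:ℝ)^j * (n.choose j : ℝ) * g j =
    ∑ j ∈ Finset.range (n+1), (-1:ℝ)^(j+1) * (n.choose (j+1) : ℝ) * g (j+1) + g 0 := by
    have := Finset.sum_range_succ' (fun j => (-1:ℝ)^j * (n.choose j : ℝ) * g j) (n+1)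
    rw [Finset.sum_range_succ] at this
    simp at this
    linarith
  rw [h1]
  simp only [Nat.choose_succ_succ]
  push_cast
  have : ∀ x, (-1:ℝ)^(x+1) * ((n.choose x:ℝ) + n.choose (x+1)) * g (x+1)
     = (-1:ℝ)^(x+1) * (n.choose (x+1) : ℝ) * g (x+1) - (-1:ℝ)^x * (n.choose x : ℝ) * g (x+1) := by
    intro x; ring
  simp only [this, Finset.sum_sub_distrib]
  simp
  ring
/-- Chu–Vandermonde, alternating form. -/
lemma chuV (n : ℕ) : ∀ (A c : ℝ), 0 < c →
    ∑ j ∈ Finset.range (n+1), (-1:ℝ)^j * (n.choose j : ℝ) * (poch A j / poch c j)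
      = poch (c - A) n / poch c n := by
  induction n with
  | zero => intro A c hc; simp [poch_zero]
  | succ n ih =>
    intro A c hc
    rw [alt_succ n (fun j => poch A j / poch c j), ih A c hc]
    have h2 := ih (A+1) (c+1) lnn
    have : ∀ j, poch A (j+1) / poch c (j+1) = (A / c) * (poch (A+1) j / poch (c+1) j) := by
      intro j; rw [poch_succ', poch_succ', mul_div_mul_comm]
    simp only [this]
    have e : ∑ x ∈ Finset.range (n+1), (-1:ℝ)^x * (n.choose x:ℝ) * (A / c * (poch (A+1) x / poch (c+1) x))
      = A / c * ∑ x ∈ Finset.range (n+1), (-1:ℝ)^x * (n.choose x:ℝ) * (poch (A+1) x / poch (c+1) x) := by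
      rw [Finset.mul_sum]; exact Finset.sum_congr rfl fun _ _ => by ring
    rw [e, h2]
    have h3 : poch c (n+1) = c * poch (c+1) n := poch_succ' c n
    have h4 : poch c (n+1) = poch c n * (c+n) := poch_succ c n
    have p1 := poch_pos hc n
    have p2 := poch_pos (show 0 < c + 1 by linarith) n
    have p3 : 0 < c + n := by positivity
    have h5 : poch (c+1) n = poch c n * (c+n) / c := by rw [← h4, h3]; field_simp
    rw [show c + 1 - (A+1) = c - A by ring, poch_succ, h4, h5]
    field_simp
    ring
lemma poch_reflect (x : ℝ) (n : ℕ) : (-1:ℝ)^n * poch (x - n) n = poch (1 - x) n := by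
  induction n generalizing x with
  | zero => simp [poch_zero]
  | succ n ih =>
    have := ih (x)
    rw [poch_succ (1-x), ← this, poch_succ']
    push_cast
    rw [show x - (n+1) + 1 = x - n by ring]
    ring
lemma poch_double (x : ℝ) (j : ℕ) : poch x (2*j) = 4^j * poch (x/2) j * poch ((x+1)/2) j := by
  induction j with
  | zero => simp [poch_zero]
  | succ j ih =>
    rw [show 2*(j+1) = 2*j+1+1 by ring, poch_succ, poch_succ, ih, poch_succ, poch_succ]
    push_cast; ring
lemma poch_ratio_le {x y A : ℝ} (hx : 0 ≤ x) (hy : 0 < y) (hA : 1 ≤ A) (h : x ≤ A * y) (n : ℕ) :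
    poch x n ≤ A^n * poch y n := by
  induction n with
  | zero => simp [poch_zero]
  | succ n ih =>
    rw [poch_succ, poch_succ, pow_succ]
    have : x + n ≤ A * (y + n) := by nlinarith [(Nat.cast_nonneg n : (0:ℝ) ≤ n)]
    calc poch x n * (x+n) ≤ (A^n * poch y n) * (A * (y+n)) := by
          apply mul_le_mul ih this pvv
          have := poch_pos hy n; positivity
      _ = _ := by ring
/-- binomial coefficient of `(1-x)^{-ν}` -/
noncomputable def bn (ν : ℝ) (n : ℕ) : ℝ := poch ν n / n.factorial
lemma bn_nonneg {ν : ℝ} (h : 0 ≤ ν) (n : ℕ) : 0 ≤ bn ν n := by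
  unfold bn; have := poch_nonneg h n; positivity
lemma bn_eq_choose (ν : ℝ) (n : ℕ) : Ring.choose (ν + n - 1) n = bn ν n := by
  have h := Ring.descPochhammer_eq_factorial_smul_choose (ν + n - 1) n
  rw [Polynomial.descPochhammer_smeval_eq_ascPochhammer, Polynomial.ascPochhammer_smeval_eq_eval] at h
  rw [show ν + n - 1 - n + 1 = ν by ring, nsmul_eq_mul] at h
  have e : (ascPochhammer ℝ n).eval ν = poch ν n := by
    clear h
    induction n with
    | zero => simp [poch_zero]
    | succ n ih => rw [ascPochhammer_succ_right, poch_succ, ← ih]; simp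
  unfold bn
  rw [← e, h]
  field_simp
lemma hasSum_bn (ν : ℝ) {x : ℂ} (hx : ‖x‖ < 1) :
    HasSum (fun n => ((bn ν n : ℝ) : ℂ) * x^n) ((1 - x)^(-(ν:ℂ))) := by
  have h := (Complex.one_div_one_sub_cpow_hasFPowerSeriesOnBall_zero (ν:ℂ)).hasSum (y := x) (by
    rw [Metric.mem_eball, edist_zero_right, ← ofReal_norm, ENNReal.ofReal_lt_one]; exact hx)
  simp only [zero_add, FormalMultilinearSeries.ofScalars_apply_eq] at h
  rw [Complex.cpow_neg, ← one_div]
  refine h.congr_fun ?_ |> fun h => h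
  intro n
  rw [smul_eq_mul, ← bn_eq_choose, Complex.ofReal_choose]
  push_cast; rfl
lemma hasSum_bn_real (ν : ℝ) {x : ℝ} (hx : |x| < 1) :
    HasSum (fun n => bn ν n * x^n) ((1 - x)^(-ν)) := by
  have h := hasSum_bn ν (x := (x:ℂ)) (by simpa using hx)
  have h1 : (0:ℝ) ≤ 1 - x := by linarith [le_abs_self x]
  have e : ((1 - (x:ℂ))^(-(ν:ℂ))) = (((1-x)^(-ν) : ℝ) : ℂ) := by
    rw [Complex.ofReal_cpow h1]; push_cast; rfl
  rw [e] at h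
  have h2 : HasSum (fun n => ((bn ν n * x^n : ℝ) : ℂ)) (((1-x)^(-ν) : ℝ) : ℂ) := by
    convert h using 2; push_cast; rfl
  exact_mod_cast h2
lemma poch_abs_summable (ν : ℝ) {x : ℝ} (hx : |x| < 1) : Summable (fun n => |bn ν n| * |x|^n) := by
  have h := (hasSum_bn_real |ν| (x := |x|) (by simpa using hx)).summable
  refine Summable.of_nonneg_of_le (fun n => by positivity) (fun n => ?_) h
  gcongr
  unfold bn
  rw [abs_div, Nat.abs_cast]
  gcongr
  exact poch_abs_le _ _
/-- regrouping of double series along antidiagonals -/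
lemma hasSum_antidiag {E : Type*} [NormedAddCommGroup E] [CompleteSpace E]
    {f : ℕ → ℕ → E} {g : ℕ → E} {S : E}
    (hs : Summable (fun p : ℕ × ℕ => f p.1 p.2)) (hg : ∀ i, HasSum (f i) (g i)) (hS : HasSum g S) :
    HasSum (fun n => ∑ p ∈ Finset.HasAntidiagonal.antidiagonal n, f p.1 p.2) S := by
  obtain ⟨S', hS'⟩ := hs
  have h1 := hS'.prod_fiberwise hg
  have : S' = S := h1.unique hS
  subst this
  rw [← (Finset.HasAntidiagonal.sigmaAntidiagonalEquivProd (A := ℕ)).hasSum_iff] at hS'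
  have := hS'.sigma (fun n => hasSum_fintype _)
  convert this using 2
  rename_i n
  exact (Finset.sum_coe_sort (Finset.HasAntidiagonal.antidiagonal n) (fun p => f p.1 p.2)).symm
lemma summable_prod_le {E : Type*} [NormedAddCommGroup E] [CompleteSpace E] {f : ℕ → ℕ → E} {G : ℕ → ℝ}
    (hf : ∀ i, Summable (fun j => ‖f i j‖)) (hG : ∀ i, ∑' j, ‖f i j‖ ≤ G i) (hs : Summable G) :
    Summable (fun p : ℕ × ℕ => f p.1 p.2) := by
  apply Summable.of_norm
  rw [summable_prod_of_nonneg (fun _ => norm_nonneg _)]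
  refine ⟨hf, Summable.of_nonneg_of_le (fun i => tsum_nonneg fun _ => norm_nonneg _) hG hs⟩
lemma hs_congr {E : Type*} [NormedAddCommGroup E] {f g : ℕ → E} {x y : E} (h : HasSum f x)
    (h1 : ∀ n, g n = f n) (h2 : y = x) : HasSum g y := by
  rw [h2, show g = f from funext h1]; exact h
noncomputable def Wc (σ : ℝ) (n : ℕ) : ℝ := bn σ n + (if n = 0 then 0 else bn σ (n-1))
noncomputable def Jp (σ c : ℝ) (n : ℕ) (X : ℝ) : ℝ :=
  Wc σ n * ∑ j ∈ Finset.range (n+1),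
    poch (-(n:ℝ)) j * poch ((n:ℝ) + σ - 1) j / (poch c j * (j.factorial : ℝ)) * X^j
noncomputable def hq (σ c : ℝ) (j : ℕ) : ℝ := poch σ (2*j) / (poch c j * (j.factorial : ℝ))
lemma bn_zero (σ : ℝ) : bn σ 0 = 1 := by simp [bn, poch_zero]
lemma Wc_zero (σ : ℝ) : Wc σ 0 = 1 := by simp [Wc, bn_zero]
lemma Wc_nonneg {σ : ℝ} (h : 0 ≤ σ) (n : ℕ) : 0 ≤ Wc σ n := by
  unfold Wc; split_ifs
  · simpa using bn_nonneg h n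
  · have := bn_nonneg h n; have := bn_nonneg h (n-1); positivity
lemma Wc_succ (σ : ℝ) (n : ℕ) :
    Wc σ (n+1) = poch σ n * (σ + 2*n + 1) / ((n+1).factorial : ℝ) := by
  unfold Wc bn
  simp only [Nat.add_sub_cancel, Nat.succ_ne_zero, if_false]
  rw [poch_succ, Nat.factorial_succ]
  have : (n.factorial : ℝ) ≠ 0 := by positivity
  push_cast
  field_simp
  ring
lemma hasSum_Wc (σ : ℝ) {v : ℝ} (hv : |v| < 1) :
    HasSum (fun n => Wc σ n * v^n) ((1+v) * (1-v)^(-σ)) := by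
  have h := hasSum_bn_real σ hv
  have h2 : HasSum (fun n => (if n = 0 then 0 else bn σ (n-1)) * v^n) (v * (1-v)^(-σ)) := by
    rw [← hasSum_nat_add_iff' 1]
    simp only [Nat.succ_ne_zero, if_false, Nat.add_sub_cancel, Finset.range_one, Finset.sum_singleton,
      if_true, zero_mul, sub_zero]
    refine hs_congr (h.mul_left v) (fun n => ?_) rfl
    rw [pow_succ]; ring
  refine hs_congr (h.add h2) (fun n => ?_) ?_
  · unfold Wc; ring
  · ring
lemma W_coef (σ : ℝ) (i j : ℕ) :
    Wc σ (i+j) * (poch (-((i+j : ℕ):ℝ)) j * poch (((i+j:ℕ):ℝ) + σ - 1) j) =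
      (-1)^j * poch σ (2*j) * Wc (σ+2*j) i := by
  rcases Nat.eq_zero_or_pos (i+j) with h0 | h0
  · obtain ⟨rfl, rfl⟩ : i = 0 ∧ j = 0 := by omega
    simp [poch_zero, Wc_zero]
  obtain ⟨n, hn⟩ : ∃ n, i + j = n + 1 := ⟨i+j-1, by omega⟩
  have key : ((i+j).choose j : ℝ) * (j.factorial : ℝ) * (i.factorial : ℝ) = ((i+j).factorial : ℝ) := by
    have := Nat.add_choose_mul_factorial_mul_factorial i j
    rw [← this]; push_cast; ring
  rw [poch_neg_nat, hn, Wc_succ]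
  rw [hn] at key
  have hf : ((n+1).factorial : ℝ) ≠ 0 := by positivity
  have hi : (i.factorial : ℝ) ≠ 0 := by positivity
  have e1 : (j.factorial : ℝ) * ((n+1).choose j : ℝ) = ((n+1).factorial : ℝ) / i.factorial := by
    rw [← key]; field_simp
  have e2 : poch σ n * poch (((n+1:ℕ):ℝ) + σ - 1) j = poch σ (n+j) := by
    rw [poch_add]; congr 2; push_cast; ring
  have e3 : poch σ (n+j) * (σ + 2*n+1) / i.factorial = poch σ (2*j) * Wc (σ+2*j) i := by
    rcases i with _ | i
    · have : j = n+1 := by omega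
      subst this
      rw [Wc_zero, show 2*(n+1) = n+(n+1)+1 by ring, poch_succ]
      rw [Nat.factorial_zero, Nat.cast_one, div_one, mul_one]; push_cast; ring
    · rw [Wc_succ]
      have : n = i + j := by omega
      subst this
      rw [show i+j+j = 2*j+i by ring, poch_add]
      push_cast; ring
  calc _ = (-1)^j * ((poch σ n * poch (((n+1:ℕ):ℝ) + σ - 1) j) * (σ+2*n+1) / ((n+1).factorial : ℝ) *
        ((j.factorial : ℝ) * ((n+1).choose j : ℝ))) := by push_cast; ring
    _ = _ := by rw [e1, e2, mul_assoc, ← e3]; congr 1; field_simp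
lemma hq_nonneg {σ c : ℝ} (hσ : 0 < σ) (hc : 0 < c) (j : ℕ) : 0 ≤ hq σ c j := by
  unfold hq; have := poch_pos hσ (2*j); have := poch_pos hc j; positivity
lemma hq_le {σ c A : ℝ} (hσ : 0 < σ) (hc : 0 < c) (hA : 1 ≤ A) (h : σ ≤ 2*A*c) (j : ℕ) :
    hq σ c j ≤ bn ((σ+1)/2) j * (4*A)^j := by
  unfold hq bn
  rw [poch_double]
  have h1 := poch_ratio_le (x := σ/2) pvv hc hA lnn j
  have p := poch_pos hc j
  have p2 := poch_pos (show 0 < (σ+1)/2 by linarith) j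
  rw [div_le_iff₀ pvv]
  calc _ ≤ 4^j * (A^j * poch c j) * poch ((σ+1)/2) j := by gcongr
    _ = _ := by rw [mul_pow]; field_simp
lemma hq_summable {σ c A y : ℝ} (hσ : 0 < σ) (hc : 0 < c) (hA : 1 ≤ A) (h : σ ≤ 2*A*c)
    (hy : 4*A*|y| < 1) : Summable (fun j => hq σ c j * |y|^j) ∧
      ∑' j, hq σ c j * |y|^j ≤ (1 - 4*A*|y|)^(-((σ+1)/2)) := by
  have hs := hasSum_bn_real ((σ+1)/2) (x := 4*A*|y|) (by rwa [abs_of_nonneg pvv])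
  have hle : ∀ j, hq σ c j * |y|^j ≤ bn ((σ+1)/2) j * (4*A*|y|)^j := by
    intro j
    rw [mul_pow, ← mul_assoc]
    gcongr
    exact hq_le hσ hc hA h j
  have hsum : Summable (fun j => hq σ c j * |y|^j) :=
    Summable.of_nonneg_of_le (fun j => mul_nonneg (hq_nonneg hσ hc j) pvv) hle hs.summable
  exact ⟨hsum, (hsum.tsum_le_tsum hle hs.summable).trans hs.tsum_eq.le⟩
lemma Jp_antidiag (σ c v X : ℝ) (n : ℕ) :
    v^n * Jp σ c n X = ∑ p ∈ Finset.HasAntidiagonal.antidiagonal n,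
      hq σ c p.1 * (-(v*X))^p.1 * (Wc (σ+2*p.1) p.2 * v^p.2) := by
  rw [Finset.Nat.sum_antidiagonal_eq_sum_range_succ_mk]
  unfold Jp
  rw [← mul_assoc, Finset.mul_sum]
  refine Finset.sum_congr rfl fun j hj => ?_
  obtain ⟨i, rfl⟩ : ∃ i, n = i + j := ⟨n - j, by simp at hj; omega⟩
  have := W_coef σ i j
  simp only [Nat.add_sub_cancel]
  unfold hq
  calc _ = v^(i+j) * X^j / (poch c j * j.factorial) * (Wc σ (i+j) * (poch (-((i+j : ℕ):ℝ)) j * poch (((i+j:ℕ):ℝ) + σ - 1) j)) := by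
        ring
    _ = _ := by rw [this, neg_pow (v*X) j, mul_pow, pow_add]; ring
lemma rpow_shift {x : ℝ} (hx : 0 < x) (σ y : ℝ) (j : ℕ) :
    x^(-(σ+2*j)) * y^j = x^(-σ) * (y/x^2)^j := by
  have h1 : x^(-(σ+2*j)) = x^(-σ) * (x^(2*j))⁻¹ := by
    rw [neg_add, rpow_add hx, rpow_neg hx.le (2 * (j:ℝ))]
    congr 2
    rw [← rpow_natCast]; push_cast; rfl
  rw [h1, div_pow, pow_mul]; ring
set_option maxHeartbeats 400000 in
/-- Lemma L. -/
lemma lemL {σ c A v X : ℝ} (hσ : 0 < σ) (hc : 0 < c) (hA : 1 ≤ A) (h : σ ≤ 2*A*c)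
    (hv : |v| < 1) (hy : 4*A*(|v| * |X| / (1-|v|)^2) < 1) :
    HasSum (fun n => v^n * Jp σ c n X)
      ((1+v) * (1-v)^(-σ) * ∑' j, hq σ c j * (-(v*X)/(1-v)^2)^j) := by
  have hv1 : 0 < 1 - |v| := by linarith
  have hv2 : 0 < 1 - v := by linarith [le_abs_self v]
  have hy' : 4*A*|(|v| * |X| / (1-|v|)^2)| < 1 := by rwa [abs_of_nonneg pvv]
  simp only [Jp_antidiag]
  have Wabs : ∀ j : ℕ, HasSum (fun i => ‖hq σ c j * (-(v*X))^j * (Wc (σ+2*j) i * v^i)‖)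
      ((1+|v|) * (1-|v|)^(-σ) * (hq σ c j * |(|v| * |X| / (1-|v|)^2)|^j)) := by
    intro j
    have := (hasSum_Wc (σ+2*j) (v := |v|) (by simpa using hv)).mul_left (hq σ c j * (|v| * |X|)^j)
    refine hs_congr this (fun i => ?_) ?_
    · rw [norm_mul, norm_mul, norm_mul]
      simp only [Real.norm_eq_abs, abs_pow, abs_neg, abs_mul]
      rw [abs_of_nonneg (hq_nonneg hσ hc _), abs_of_nonneg (Wc_nonneg pvv _)]
    · rw [abs_of_nonneg (a := |v| * |X| / (1-|v|)^2) pvv]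
      linear_combination -(hq σ c j * (1+|v|)) * rpow_shift hv1 σ (|v| * |X|) j
  refine hasSum_antidiag (f := fun j i => hq σ c j * (-(v*X))^j * (Wc (σ+2*j) i * v^i)) (g := fun j => (1+v) * (1-v)^(-σ) * (hq σ c j * (-(v*X)/(1-v)^2)^j)) ?_ ?_ ?_
  · refine summable_prod_le (fun j => (Wabs j).summable) (fun j => (Wabs j).tsum_eq.le) ?_
    exact (hq_summable hσ hc hA h hy').1.mul_left _
  · intro j
    have := (hasSum_Wc (σ+2*j) hv).mul_left (hq σ c j * (-(v*X))^j)
    refine hs_congr this (fun i => rfl) ?_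
    linear_combination -(hq σ c j * (1+v)) * rpow_shift hv2 σ (-(v*X)) j
  · apply HasSum.mul_left
    apply Summable.hasSum
    apply Summable.of_norm
    refine Summable.of_nonneg_of_le (fun _ => norm_nonneg _) (fun j => ?_) (hq_summable hσ hc hA h hy').1
    rw [norm_mul, norm_pow, Real.norm_eq_abs, Real.norm_eq_abs, abs_of_nonneg (hq_nonneg hσ hc _)]
    have := hq_nonneg hσ hc j
    refine mul_le_mul_of_nonneg_left (pow_le_pow_left₀ (abs_nonneg _) ?_ _) this
    rw [abs_div, abs_neg, abs_mul, abs_of_nonneg (a := |v| * |X| / (1-|v|)^2) pvv, abs_of_pos (a := (1-v)^2) pvv]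
    gcongr
    exact le_abs_self v
lemma Jp_abs_le {σ c : ℝ} (hσ : 0 < σ) (hc : 0 < c) (n : ℕ) (X : ℝ) :
    |Jp σ c n X| ≤ Jp σ c n (-|X|) := by
  have h1 := Jp_antidiag σ c 1 X n
  have h2 := Jp_antidiag σ c 1 (-|X|) n
  simp only [one_pow, one_mul, mul_one] at h1 h2
  rw [h1, h2]
  refine (Finset.abs_sum_le_sum_abs _ _).trans (Finset.sum_le_sum fun p _ => ?_)
  rw [abs_mul, abs_mul, abs_of_nonneg (hq_nonneg hσ hc _), abs_of_nonneg (Wc_nonneg pvv _),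
    neg_neg, abs_pow, abs_neg]
/-- absolute bound for the generating series -/
lemma lemL_abs {σ c A v X : ℝ} (hσ : 0 < σ) (hc : 0 < c) (hA : 1 ≤ A) (h : σ ≤ 2*A*c)
    (hv : |v| < 1) (hy : 4*A*(|v| * |X| / (1-|v|)^2) < 1) :
    Summable (fun n => |v^n * Jp σ c n X|) ∧ ∑' n, |v^n * Jp σ c n X| ≤
      2 * (1-|v|)^(-σ) * (1 - 4*A*(|v| * |X| / (1-|v|)^2))^(-((σ+1)/2)) := by
  have H := lemL (v := |v|) (X := -|X|) hσ hc hA h (by simpa) (by simpa using hy)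
  have hle : ∀ n, |v^n * Jp σ c n X| ≤ |v|^n * Jp σ c n (-|X|) := by
    intro n; rw [abs_mul, abs_pow]; gcongr; exact Jp_abs_le hσ hc n X
  have hs := Summable.of_nonneg_of_le (fun _ => abs_nonneg _) hle H.summable
  refine ⟨hs, (hs.tsum_le_tsum hle H.summable).trans (H.tsum_eq.le.trans ?_)⟩
  have hv1 : 0 < 1 - |v| := by linarith
  have hq2 := (hq_summable (y := |v| * |X| / (1-|v|)^2) hσ hc hA h (by rwa [abs_of_nonneg pvv])).2
  rw [abs_of_nonneg pvv] at hq2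
  have hnn : 0 ≤ ∑' j, hq σ c j * (|v| * |X| / (1-|v|)^2)^j :=
    tsum_nonneg fun j => mul_nonneg (hq_nonneg hσ hc j) pvv
  rw [show -(|v| * -|X|) = |v| * |X| by ring]
  have : (1 + |v|) ≤ 2 := by linarith
  gcongr
set_option maxHeartbeats 400000 in
/-- K-identity. -/
lemma lemK {σ c A K : ℝ} (hσ : 0 < σ) (hc : 0 < c) (hA : 1 ≤ A) (h : σ ≤ 2*A*c)
    (hK : 0 ≤ K) (hK1 : K < 1) (hy : 4*A*(K / (1-K)^2) < 1) :
    HasSum (fun n => poch σ n / poch c n * (bn (σ-c+1) n * K^n))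
      ((1+K)^(-σ) * ∑' j, hq σ c j * (K/(1+K)^2)^j) := by
  have hv1 : 0 < 1 - K := by linarith
  have hy' : 4*A*|(K / (1-K)^2)| < 1 := by rwa [abs_of_nonneg pvv]
  have hco : ∀ n, poch σ n / poch c n * (bn (σ-c+1) n * K^n) =
      ∑ p ∈ Finset.HasAntidiagonal.antidiagonal n, hq σ c p.1 * K^p.1 * (bn (σ+2*p.1) p.2 * (-K)^p.2) := by
    intro n
    rw [Finset.Nat.sum_antidiagonal_eq_sum_range_succ_mk]
    have e := chuV n (σ+n) c hc
    have r := poch_reflect (c-σ) n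
    rw [show c - σ - n = c - (σ + n) by ring] at r
    rw [show σ - c + 1 = 1 - (c-σ) by ring]
    unfold bn
    rw [← r]
    have p1 := (poch_pos hc n).ne'
    calc _ = poch σ n / n.factorial * (-1)^n * K^n * (poch (c-(σ+n)) n / poch c n) := by ring
      _ = _ := by
        rw [← e, Finset.mul_sum]
        refine Finset.sum_congr rfl fun j hj => ?_
        obtain ⟨i, rfl⟩ : ∃ i, n = i + j := ⟨n - j, by simp at hj; omega⟩
        have key : ((i+j).choose j : ℝ) * (j.factorial : ℝ) * (i.factorial : ℝ) = ((i+j).factorial : ℝ) := by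
          have := Nat.add_choose_mul_factorial_mul_factorial i j
          rw [← this]; push_cast; ring
        simp only [Nat.add_sub_cancel]
        have e1 : poch σ (i+j) * poch (σ+(i+j:ℕ)) j = poch σ (2*j) * poch (σ+2*j) i := by
          rw [← poch_add, show i+j+j = 2*j+i by ring, poch_add]; push_cast; rfl
        have hi : (i.factorial : ℝ) ≠ 0 := by positivity
        have hj' : (j.factorial : ℝ) ≠ 0 := by positivity
        have hc' : ((i+j).choose j : ℝ) ≠ 0 := by
          intro h0; rw [h0, zero_mul, zero_mul] at key; exact absurd key.symm pvv
        have pj := (poch_pos hc j).ne'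
        unfold hq
        rw [← key]
        rw [neg_pow K i]
        have s1 : (-1:ℝ)^(i+j) * (-1)^j = (-1)^i := by
          rw [pow_add, mul_assoc, ← pow_add, ← two_mul, pow_mul]; simp
        calc _ = ((-1:ℝ)^(i+j) * (-1)^j) * K^(i+j) * (poch σ (i+j) * poch (σ+(i+j:ℕ)) j) / (poch c j * j.factorial * i.factorial) := by
              field_simp
          _ = _ := by rw [e1, s1, pow_add]; field_simp
  simp only [hco]
  have Wabs : ∀ j : ℕ, HasSum (fun i => ‖hq σ c j * K^j * (bn (σ+2*j) i * (-K)^i)‖)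
      ((1-K)^(-σ) * (hq σ c j * |K / (1-K)^2|^j)) := by
    intro j
    have := (hasSum_bn_real (σ+2*j) (x := K) (by rwa [abs_of_nonneg hK])).mul_left (hq σ c j * K^j)
    refine hs_congr this (fun i => ?_) ?_
    · rw [norm_mul, norm_mul, norm_mul]
      simp only [Real.norm_eq_abs, abs_pow, abs_neg, abs_of_nonneg hK]
      rw [abs_of_nonneg (hq_nonneg hσ hc _), abs_of_nonneg (bn_nonneg pvv _)]
    · rw [abs_of_nonneg (a := K / (1-K)^2) pvv]
      linear_combination -(hq σ c j) * rpow_shift hv1 σ K j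
  refine hasSum_antidiag (f := fun j i => hq σ c j * K^j * (bn (σ+2*j) i * (-K)^i)) (g := fun j => (1+K)^(-σ) * (hq σ c j * (K/(1+K)^2)^j)) ?_ ?_ ?_
  · refine summable_prod_le (fun j => (Wabs j).summable) (fun j => (Wabs j).tsum_eq.le) ?_
    exact (hq_summable hσ hc hA h hy').1.mul_left _
  · intro j
    have := (hasSum_bn_real (σ+2*j) (x := -K) (by rwa [abs_neg, abs_of_nonneg hK])).mul_left (hq σ c j * K^j)
    refine hs_congr this (fun i => rfl) ?_
    rw [sub_neg_eq_add]
    linear_combination -(hq σ c j) * rpow_shift (show 0 < 1 + K by linarith) σ K j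
  · apply HasSum.mul_left
    apply Summable.hasSum
    refine Summable.of_nonneg_of_le (fun j => mul_nonneg (hq_nonneg hσ hc j) pvv) (fun j => ?_) (hq_summable hσ hc hA h hy').1
    have := hq_nonneg hσ hc j
    rw [abs_of_nonneg pvv]
    gcongr
    linarith
lemma coef_zero {d : ℕ → ℂ} {r0 : ℝ} (hr0 : 0 < r0)
    (h : ∀ r : ℝ, 0 < r → r < r0 → HasSum (fun n => d n * (r:ℂ)^n) 0) : ∀ n, d n = 0 := by
  have hs : Summable (fun n => ‖d n‖ * (r0/2)^n) := by
    have := (h (r0/2) pvv lnn).summable.norm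
    refine this.congr fun n => ?_
    rw [norm_mul, norm_pow, Complex.norm_real, Real.norm_eq_abs, abs_of_pos pvv]
  set p := FormalMultilinearSeries.ofScalars ℂ d with hp
  have hrad : (((Real.toNNReal (r0/2)) : NNReal) : ENNReal) ≤ p.radius := by
    apply FormalMultilinearSeries.le_radius_of_summable_norm
    refine hs.congr fun n => ?_
    rw [hp, FormalMultilinearSeries.ofScalars_norm, Real.coe_toNNReal _ pvv]
  have hpos : 0 < p.radius := lt_of_lt_of_le (by
    rw [ENNReal.coe_pos, Real.toNNReal_pos]; exact half_pos hr0) hrad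
  have H := p.hasFPowerSeriesOnBall hpos
  have hA := H.analyticAt
  have hz : ∀ r : ℝ, 0 < r → r < r0 → p.sum (r:ℂ) = 0 := by
    intro r h1 h2
    unfold FormalMultilinearSeries.sum
    simp only [hp, FormalMultilinearSeries.ofScalars_apply_eq, smul_eq_mul]
    exact (h r h1 h2).tsum_eq
  have hf : ∃ᶠ z in nhdsWithin (0:ℂ) {0}ᶜ, p.sum z = 0 := by
    have ht : Tendsto (fun r : ℝ => (r:ℂ)) (nhdsWithin 0 (Ioi 0)) (nhdsWithin (0:ℂ) {0}ᶜ) := by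
      apply tendsto_nhdsWithin_of_tendsto_nhds_of_eventually_within
      · exact (Complex.continuous_ofReal.tendsto' 0 0 (by simp)).mono_left nhdsWithin_le_nhds
      · filter_upwards [self_mem_nhdsWithin] with r hr
        simpa using (ne_of_gt hr)
    apply ht.frequently
    apply Filter.Eventually.frequently
    filter_upwards [Ioo_mem_nhdsGT hr0] with r hr
    exact hz r hr.1 hr.2
  have hev := hA.frequently_zero_iff_eventually_zero.1 hf
  have : HasFPowerSeriesAt (0 : ℂ → ℂ) p 0 := H.hasFPowerSeriesAt.congr hev
  have h0 := this.eq_zero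
  rw [hp, FormalMultilinearSeries.ofScalars_series_eq_zero] at h0
  intro n; rw [h0]; rfl
lemma ident {P : ℕ → ℂ} {G : ℂ → ℂ} (hG : DifferentiableOn ℂ G (Metric.ball 0 1)) {r0 : ℝ} (hr0 : 0 < r0)
    (h : ∀ r : ℝ, 0 < r → r < r0 → HasSum (fun n => P n * (r:ℂ)^n) (G r)) {z : ℂ} (hz : ‖z‖ < 1) :
    HasSum (fun n => P n * z^n) (G z) := by
  have T : ∀ z : ℂ, ‖z‖ < 1 → HasSum (fun n : ℕ => ((n.factorial : ℂ)⁻¹ * iteratedDeriv n G 0) * z^n) (G z) := by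
    intro z hz
    refine hs_congr (Complex.hasSum_taylorSeries_on_ball hG (by simpa using hz)) (fun n => ?_) rfl
    simp only [sub_zero, smul_eq_mul]; ring
  have e : ∀ n, P n - (n.factorial : ℂ)⁻¹ * iteratedDeriv n G 0 = 0 := by
    apply coef_zero (r0 := min r0 1) pvv
    intro r h1 h2
    refine hs_congr ((h r h1 (h2.trans_le (min_le_left _ _))).sub (T r ?_)) (fun n => by ring) (by ring)
    rw [Complex.norm_real, Real.norm_eq_abs, abs_of_pos h1]; exact h2.trans_le (min_le_right _ _)
  refine hs_congr (T z hz) (fun n => ?_) rfl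
  rw [sub_eq_zero.1 (e n)]
/-- subexponential sequences -/
def SE (f : ℕ → ℝ) : Prop := ∀ ρ : ℝ, 0 ≤ ρ → ρ < 1 → Summable (fun n => |f n| * ρ^n)
lemma SE_bn (ν : ℝ) : SE (bn ν) := by
  intro ρ h0 h1
  have := poch_abs_summable ν (x := ρ) (by rwa [abs_of_nonneg h0])
  simpa [abs_of_nonneg h0] using this
/-- the point on the unit circle -/
noncomputable def wt1 (t : ℝ) : ℂ := ⟨t, √(1-t^2)⟩
lemma wt1_norm {t : ℝ} (ht : t^2 ≤ 1) : ‖wt1 t‖ = 1 := by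
  have : ‖wt1 t‖^2 = 1 := by
    rw [← Complex.normSq_eq_norm_sq, Complex.normSq_apply]
    simp only [wt1]
    rw [mul_self_sqrt lnn]; ring
  have h0 := norm_nonneg (wt1 t)
  nlinarith
noncomputable def Zf (b : ℝ) (k : ℕ) (t : ℝ) : ℝ := Jp (2*b+1) (b+1/2) k ((1-t)/2)
noncomputable def Zgen (b t : ℝ) (v : ℂ) : ℂ :=
  (1 - v^2) * (1 - v * wt1 t)^(-((b+1 : ℝ):ℂ)) * (1 - v * (starRingEnd ℂ) (wt1 t))^(-((b+1:ℝ):ℂ))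
lemma slit_of_norm {z : ℂ} (h : ‖z‖ < 1) : 1 - z ∈ Complex.slitPlane := by
  left
  have := (Complex.abs_re_le_norm z).trans_lt h
  have := le_abs_self z.re
  simp only [Complex.sub_re, Complex.one_re]; linarith
lemma Zgen_diff {b t : ℝ} (ht : t^2 ≤ 1) : DifferentiableOn ℂ (Zgen b t) (Metric.ball 0 1) := by
  intro z hz
  have hz : ‖z‖ < 1 := by simpa using hz
  apply DifferentiableAt.differentiableWithinAt
  have h1 : 1 - z * wt1 t ∈ Complex.slitPlane := slit_of_norm (by rw [norm_mul, wt1_norm ht, mul_one]; exact hz)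
  have h2 : 1 - z * (starRingEnd ℂ) (wt1 t) ∈ Complex.slitPlane :=
    slit_of_norm (by rw [norm_mul, RCLike.norm_conj, wt1_norm ht, mul_one]; exact hz)
  unfold Zgen
  refine DifferentiableAt.mul (DifferentiableAt.mul fpp ?_) ?_
  · exact DifferentiableAt.cpow fpp fpp h1
  · exact DifferentiableAt.cpow fpp fpp h2
lemma Zgen_real {b t v : ℝ} (ht : t^2 ≤ 1) (hv : |v| < 1) :
    Zgen b t v = (((1-v^2) * (1 - 2*v*t+v^2)^(-(b+1)) : ℝ) : ℂ) := by
  have h1 : 1 - v * wt1 t ∈ Complex.slitPlane := slit_of_norm (by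
    rw [norm_mul, wt1_norm ht, mul_one, Complex.norm_real]; exact hv)
  have e : (1 - (v:ℂ) * (starRingEnd ℂ) (wt1 t)) = (starRingEnd ℂ) (1 - v * wt1 t) := by
    rw [map_sub, map_one, map_mul, Complex.conj_ofReal]
  have e2 : (-((b+1 : ℝ):ℂ)) = (starRingEnd ℂ) (-((b+1 : ℝ):ℂ)) := by
    rw [map_neg, Complex.conj_ofReal]
  have e3 : (1 - (v:ℂ) * (starRingEnd ℂ) (wt1 t))^(-((b+1:ℝ):ℂ)) =
      (starRingEnd ℂ) ((1 - v * wt1 t)^(-((b+1 : ℝ):ℂ))) := by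
    rw [e]
    conv_lhs => rw [e2]
    rw [Complex.conj_cpow _ _ (Complex.slitPlane_arg_ne_pi h1), Complex.conj_conj]
  unfold Zgen
  rw [e3, mul_assoc, Complex.mul_conj, Complex.normSq_eq_norm_sq]
  rw [show (-((b+1 : ℝ):ℂ)) = ((-(b+1) : ℝ) : ℂ) by push_cast; ring, Complex.norm_cpow_real]
  have n2 : ‖1 - v * wt1 t‖^2 = 1 - 2*v*t + v^2 := by
    rw [← Complex.normSq_eq_norm_sq, Complex.normSq_apply]
    have hs : √(1-t^2) * √(1-t^2) = 1 - t^2 := mul_self_sqrt lnn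
    simp [wt1]
    linear_combination v^2 * hs
  have : (‖1 - v * wt1 t‖^(-(b+1)))^2 = (1 - 2*v*t+v^2)^(-(b+1)) := by
    rw [← n2, ← rpow_natCast, ← rpow_mul (norm_nonneg _), ← rpow_natCast, ← rpow_mul (norm_nonneg _)]; congr 1; ring
  rw [this]; push_cast; rfl
lemma Z_small {b t : ℝ} (hb : -(1/2) < b) (ht : t^2 ≤ 1) {v : ℝ} (hv0 : 0 < v) (hv : v < 1/10) :
    HasSum (fun k => (Zf b k t : ℂ) * (v:ℂ)^k) (Zgen b t v) := by
  have hX : |(1-t)/2| ≤ 1 := by rw [abs_le]; constructor <;> nlinarith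
  have hX0 : 0 ≤ (1-t)/2 := by nlinarith
  have hv' : |v| = v := abs_of_pos hv0
  rw [Zgen_real ht (by rw [hv']; linarith)]
  have ysm : v * |(1-t)/2| / (1-v)^2 ≤ 1/8 := by
    rw [div_le_iff₀ (by nlinarith)]
    nlinarith
  have H := lemL (σ := 2*b+1) (c := b+1/2) (A := 1) (v := v) (X := (1-t)/2) lnn lnn le_rfl lnn
    (by rw [hv']; linarith) (by rw [hv']; linarith)
  have hy : |4 * (-(v*((1-t)/2))/(1-v)^2)| < 1 := by
    rw [abs_mul, abs_div, abs_neg, abs_mul, hv', abs_of_nonneg (sq_nonneg (1-v)), abs_of_pos (by norm_num : (0:ℝ)<4)]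
    linarith
  have Hs := hasSum_bn_real (b+1) hy
  have e : ∑' j, hq (2*b+1) (b+1/2) j * (-(v*((1-t)/2))/(1-v)^2)^j =
      (1 - 4 * (-(v*((1-t)/2))/(1-v)^2))^(-(b+1)) := by
    rw [← Hs.tsum_eq]
    congr 1; funext j
    unfold hq bn
    rw [poch_double, show (2*b+1)/2 = b+1/2 by ring, show (2*b+1+1)/2 = b+1 by ring, mul_pow]
    have := (poch_pos (show 0 < b+1/2 by linarith) j).ne'
    generalize poch (b+1/2) j = q at this ⊢
    field_simp
  rw [e] at H
  have hv1 : 0 < 1 - v := by linarith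
  have q1 : 0 < 1 - 2*v*t+v^2 := by nlinarith
  have e2 : (1+v) * (1-v)^(-(2*b+1)) * (1 - 4 * (-(v*((1-t)/2))/(1-v)^2))^(-(b+1)) =
      (1-v^2) * (1 - 2*v*t+v^2)^(-(b+1)) := by
    rw [show 1 - 4 * (-(v*((1-t)/2))/(1-v)^2) = (1-2*v*t+v^2)/(1-v)^2 by field_simp; ring,
      div_rpow q1.le pvv, ← rpow_natCast (1-v), ← rpow_mul hv1.le,
      show -(2*b+1) = 1 + ((2:ℕ):ℝ) * -(b+1) by push_cast; ring, rpow_add hv1, rpow_one]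
    have := (rpow_pos_of_pos hv1 (((2:ℕ):ℝ) * -(b+1))).ne'
    field_simp
    ring
  rw [e2] at H
  have H2 := Complex.hasSum_ofReal.2 H
  refine hs_congr H2 (fun n => ?_) rfl
  unfold Zf; push_cast; ring
lemma Z_hasSum {b t : ℝ} (hb : -(1/2) < b) (ht : t^2 ≤ 1) {v : ℂ} (hv : ‖v‖ < 1) :
    HasSum (fun k => (Zf b k t : ℂ) * v^k) (Zgen b t v) :=
  ident (Zgen_diff ht) (r0 := 1/10) nmm (fun _ h1 h2 => Z_small hb ht h1 h2) hv
lemma SE_Z {b t : ℝ} (hb : -(1/2) < b) (ht : t^2 ≤ 1) : SE (fun k => Zf b k t) := by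
  intro ρ h0 h1
  have := (Z_hasSum hb ht (v := (ρ:ℂ)) (by rw [Complex.norm_real, Real.norm_eq_abs, abs_of_nonneg h0]; exact h1)).summable.norm
  refine this.congr fun n => ?_
  rw [norm_mul, norm_pow, Complex.norm_real, Complex.norm_real, Real.norm_eq_abs, Real.norm_eq_abs, abs_of_nonneg h0]
noncomputable def kap (a b : ℝ) (m : ℕ) : ℝ := poch (a+b+2) m / poch (b+1) m
noncomputable def Pz (a b : ℝ) (Z : ℕ → ℝ) (ξ : ℝ) (n : ℕ) : ℝ :=
  ∑ p ∈ Finset.HasAntidiagonal.antidiagonal n, kap a b p.1 * ξ^p.1 * Z p.1 *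
    ((-1)^p.2 * Jp (a+b+2+p.1) (b+1+p.1) p.2 (ξ^2))
noncomputable def d0 (k : ℕ) : ℝ := if k = 0 then 1 else 0
lemma Jp_zero (σ c X : ℝ) : Jp σ c 0 X = 1 := by simp [Jp, Wc_zero, poch_zero]
lemma jac_one (m : ℕ) (α β : ℝ) : jacobiP m α β 1 = poch (α+1) m / m.factorial := by
  unfold jacobiP
  rw [Finset.sum_range_succ']
  simp [poch_zero]
lemma jac_neg_one (m : ℕ) {α : ℝ} (β : ℝ) (hα : -1 < α) :
    jacobiP m α β (-1) = (-1)^m * poch (β+1) m / m.factorial := by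
  unfold jacobiP
  have h := chuV m (m+α+β+1) (α+1) lnn
  have : ∑ j ∈ Finset.range (m + 1), (poch (-(m : ℝ)) j * poch ((m : ℝ) + α + β + 1) j) /
        (poch (α + 1) j * (j.factorial : ℝ)) * ((1 - (-1:ℝ)) / 2) ^ j = poch (α+1 - (m+α+β+1)) m / poch (α+1) m := by
    rw [← h]
    refine Finset.sum_congr rfl fun j _ => ?_
    rw [poch_neg_nat]
    have := (poch_pos (show 0 < α+1 by linarith) j).ne'
    have : (j.factorial : ℝ) ≠ 0 := by positivity
    norm_num
    field_simp
  rw [this]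
  have r := poch_reflect (-β) m
  rw [show α + 1 - (m+α+β+1) = -β - m by ring]
  have p := (poch_pos (show 0 < α+1 by linarith) m).ne'
  rw [show β + 1 = 1 - -β by ring, ← r, ← mul_assoc, ← mul_pow]
  field_simp
  simp
lemma Wc_eq {σ : ℝ} (m : ℕ) (h : σ - 1 + m ≠ 0) :
    Wc σ m = poch σ m * (σ - 1 + 2*m) / (m.factorial * (σ - 1 + m)) := by
  rcases m with _ | m
  · simp at h; rw [Wc_zero, poch_zero]; simp; rw [div_self h]
  · rw [Wc_succ, poch_succ]; push_cast at h ⊢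
    rw [show σ - 1 + (m+1 : ℝ) = σ + m by ring] at h ⊢
    field_simp
    ring
lemma jac_Jp (m : ℕ) (α β t : ℝ) (h : α+β+1+m ≠ 0) :
    jacobiP m α β t * (poch (α+β+2) m * (α+β+1+2*m)) =
      poch (α+1) m * (α+β+1+m) * Jp (α+β+2) (α+1) m ((1-t)/2) := by
  unfold Jp
  rw [Wc_eq m (by convert h using 1; ring)]
  unfold jacobiP
  rw [show (m:ℝ) + (α+β+2) - 1 = m + α + β + 1 by ring, show α+β+2-1+(m:ℝ) = α+β+1+m by ring]
  generalize ∑ j ∈ Finset.range (m + 1), poch (-(m:ℝ)) j * poch ((m:ℝ)+α+β+1) j /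
    (poch (α+1) j * (j.factorial:ℝ)) * ((1-t)/2)^j = T
  have : (m.factorial : ℝ) ≠ 0 := by positivity
  field_simp
  ring
lemma jac_ker_one (m : ℕ) {α β : ℝ} (t : ℝ) (hα : -1 < α) (hβ : -1 < β) (h : α+β+1+m ≠ 0) :
    jacobiP m α β 1 * jacobiP m α β t / hJ m α β =
      poch (α+1) m / poch (β+1) m * Jp (α+β+2) (α+1) m ((1-t)/2) := by
  have h2 := jac_Jp m α β t h
  have p1 := (poch_pos (show 0 < α+1 by linarith) m).ne'
  have p2 := (poch_pos (show 0 < β+1 by linarith) m).ne'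
  have p3 := (poch_pos (show 0 < α+β+2 by linarith) m).ne'
  have p4 : (m.factorial : ℝ) ≠ 0 := by positivity
  have p5 : α+β+1+2*m ≠ 0 := by
    rcases m with _ | m
    · simpa using h
    · push_cast; have : (0:ℝ) ≤ m := by positivity
      linarith
  unfold hJ
  rw [jac_one, show α+β+(m:ℝ)+1 = α+β+1+m by ring, show α+β+2*(m:ℝ)+1 = α+β+1+2*m by ring]
  generalize Jp (α+β+2) (α+1) m ((1-t)/2) = J at *
  generalize jacobiP m α β t = P at *
  generalize poch (α+1) m = q1 at *
  generalize poch (β+1) m = q2 at *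
  generalize poch (α+β+2) m = q3 at *
  generalize α+β+1+m = q6 at *
  generalize α+β+1+2*m = q5 at *
  field_simp
  linear_combination h2
lemma jac_ker_neg (m : ℕ) {α β : ℝ} (t : ℝ) (hα : -1 < α) (hβ : -1 < β) (h : α+β+1+m ≠ 0) :
    jacobiP m α β (-1) * jacobiP m α β t / hJ m α β =
      (-1)^m * Jp (α+β+2) (α+1) m ((1-t)/2) := by
  have h2 := jac_ker_one m t hα hβ h
  have p1 := (poch_pos (show 0 < α+1 by linarith) m).ne'
  have p2 := (poch_pos (show 0 < β+1 by linarith) m).ne'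
  rw [jac_one] at h2
  rw [jac_neg_one m β hα]
  generalize Jp (α+β+2) (α+1) m ((1-t)/2) = J at *
  have p4 : (m.factorial : ℝ) ≠ 0 := by positivity
  calc _ = (-1)^m * (poch (β+1) m / poch (α+1) m) * (poch (α+1) m / m.factorial * jacobiP m α β t / hJ m α β) := by
        field_simp
    _ = _ := by rw [h2]; field_simp
lemma Gamma_add_nat {x : ℝ} (hx : 0 < x) (k : ℕ) : Real.Gamma (x+k) = poch x k * Real.Gamma x := by
  induction k with
  | zero => simp [poch_zero]
  | succ k ih =>
    rw [poch_succ]; push_cast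
    rw [← add_assoc, Real.Gamma_add_one pvv, ih]; ring
lemma cJ_ratio {a b : ℝ} (ha : -1 < a) (hb : -(1/2) < b) (k : ℕ) :
    (cJ b a / cJ (b+k) a)⁻¹ = kap a b k := by
  unfold cJ kap
  rw [show b + (k:ℝ) + a + 2 = a+b+2+k by ring, show b + (k:ℝ) + 1 = b+1+k by ring, Gamma_add_nat lnn, Gamma_add_nat lnn,
    show b + a + 2 = a+b+2 by ring]
  have g1 := (Gamma_pos_of_pos (show 0 < a+b+2 by linarith)).ne'
  have g2 := (Gamma_pos_of_pos (show 0 < b+1 by linarith)).ne'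
  have g3 := (Gamma_pos_of_pos (show 0 < a+1 by linarith)).ne'
  have p1 := (poch_pos (show 0 < a+b+2 by linarith) k).ne'
  have p2 := (poch_pos (show 0 < b+1 by linarith) k).ne'
  field_simp
noncomputable def e1 (b : ℝ) : ℝ := if b = 0 then 1 else 0
noncomputable def e2 (a b : ℝ) : ℝ := if a+b+1 = 0 then 1 else 0
lemma kernel_eq {a b : ℝ} (ha : -1 < a) (hb : -(1/2) < b) (n : ℕ) (y : ℝ × ℝ) (hy : 0 ≤ y.2) :
    PnU a b n (1,1) y = Pz a b (fun k => Zf b k (y.1/√y.2)) (√y.2) n - e1 b * Pz a b d0 (√y.2) n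
      - e2 a b * d0 n := by
  have hsq : √y.2^2 = y.2 := sq_sqrt hy
  set ξ := √y.2 with hξ
  set t := y.1/ξ with ht
  have radial : ∀ k m : ℕ, jacobiP m (b+k) a (-1) * jacobiP m (b+k) a (1-2*y.2) / hJ m (b+k) a =
      (-1)^m * Jp (a+b+2+k) (b+1+k) m (ξ^2) - e2 a b * (d0 k * d0 m) := by
    intro k m
    by_cases h : b + k + a + 1 + m = 0
    · have hk0 : (0:ℝ) ≤ k := by positivity
      have hm0 : (0:ℝ) ≤ m := by positivity
      have hk : k = 0 := by
        by_contra hk; have : (1:ℝ) ≤ k := by exact_mod_cast Nat.one_le_iff_ne_zero.2 hk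
        linarith
      have hm : m = 0 := by
        by_contra hk; have : (1:ℝ) ≤ m := by exact_mod_cast Nat.one_le_iff_ne_zero.2 hk
        linarith
      subst hk hm
      have h' : a + b + 1 = 0 := by simp at h; linarith
      have h3 : hJ 0 (b+(0:ℕ)) a = 0 := by
        unfold hJ; simp only [poch_zero, Nat.cast_zero]
        rw [show b + 0 + a + 0 + 1 = 0 by linarith]; simp
      rw [h3, Jp_zero]; simp [e2, h', d0]
    · have hk0 : (0:ℝ) ≤ k := by positivity
      rw [jac_ker_neg m _ lnn ha h]
      have : e2 a b * (d0 k * d0 m) = 0 := by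
        unfold e2 d0
        split_ifs with h1 h2 h3 <;> simp
        subst h2 h3; apply h; push_cast; linarith
      rw [this, sub_zero]; congr 2
      · ring
      · ring
      · rw [hsq]; ring
  have ang : ∀ k : ℕ, jacobiP k (b-1/2) (b-1/2) 1 * jacobiP k (b-1/2) (b-1/2) t / hJ k (b-1/2) (b-1/2) =
      Zf b k t - e1 b * d0 k := by
    intro k
    by_cases h : b - 1/2 + (b-1/2) + 1 + k = 0
    · have hk : k = 0 := by
        by_contra hk; have : (1:ℝ) ≤ k := by exact_mod_cast Nat.one_le_iff_ne_zero.2 hk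
        linarith
      subst hk
      have hb0 : b = 0 := by simp at h; linarith
      subst hb0
      have h3 : hJ 0 (0-1/2) (0-1/2) = 0 := by
        unfold hJ; norm_num
      rw [h3]; simp [Zf, Jp_zero, e1, d0]
    · rw [jac_ker_one k _ lnn lnn h, div_self (poch_pos lnn k).ne', one_mul]
      have : e1 b * d0 k = 0 := by
        unfold e1 d0
        split_ifs with h1 h2 <;> simp
        subst h1 h2; apply h; push_cast; norm_num
      rw [this, sub_zero]; unfold Zf; congr 1 <;> ring
  have main : ∀ p ∈ Finset.HasAntidiagonal.antidiagonal n,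
      PknU a b p.1 n (1,1) * PknU a b p.1 n y / hknU a b p.1 n =
      kap a b p.1 * ξ^p.1 * (Zf b p.1 t - e1 b * d0 p.1) *
        ((-1)^p.2 * Jp (a+b+2+p.1) (b+1+p.1) p.2 (ξ^2) - e2 a b * (d0 p.1 * d0 p.2)) := by
    rintro ⟨k, m⟩ hp
    have hkm : k + m = n := by simpa using hp
    have hnk : n - k = m := by omega
    simp only
    rw [← radial, ← ang, ← cJ_ratio ha hb]
    unfold PknU hknU
    simp only [hnk, Real.sqrt_one, one_pow, mul_one, div_one]
    rw [← hξ, ← ht]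
    norm_num
    simp only [div_eq_mul_inv, mul_inv, inv_inv]
    ring
  unfold PnU
  rw [← Finset.Nat.sum_antidiagonal_eq_sum_range_succ_mk (fun p => PknU a b p.1 n (1,1) * PknU a b p.1 n y / hknU a b p.1 n),
    Finset.sum_congr rfl main]
  unfold Pz
  have last : e2 a b * d0 n = ∑ p ∈ Finset.HasAntidiagonal.antidiagonal n, e2 a b * (d0 p.1 * d0 p.2) := by
    rcases n with _ | n
    · simp [d0]
    · rw [Finset.sum_eq_zero]
      · simp [d0]
      · rintro ⟨k, m⟩ hp
        have hkm : k + m = n+1 := by simpa using hp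
        unfold d0
        split_ifs with h1 h2 <;> simp
        simp at h1 h2; omega
  rw [last, Finset.mul_sum, ← Finset.sum_sub_distrib, ← Finset.sum_sub_distrib]
  refine Finset.sum_congr rfl ?_
  rintro ⟨k, m⟩ hp
  simp only
  by_cases h : k = 0
  · subst h
    have hZ : e2 a b * (Zf b 0 t - e1 b * d0 0) = e2 a b := by
      unfold e2 e1 d0 Zf; rw [Jp_zero]
      split_ifs with h1 h2 <;> simp
      subst h2; linarith
    have : kap a b 0 = 1 := by simp [kap, poch_zero]
    rw [this, pow_zero]
    linear_combination -(d0 0 * d0 m) * hZ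
  · have : d0 k = 0 := by simp [d0, h]
    rw [this]; ring
lemma kap_nonneg {a b : ℝ} (ha : -1 < a) (hb : -(1/2) < b) (m : ℕ) : 0 ≤ kap a b m := by
  unfold kap
  have p1 := (poch_pos (show 0 < a+b+2 by linarith) m)
  have p2 := (poch_pos (show 0 < b+1 by linarith) m)
  positivity
lemma kap_add {a b : ℝ} (hb : -(1/2) < b) (k n : ℕ) :
    kap a b (k+n) = kap a b k * (poch (a+b+2+k) n / poch (b+1+k) n) := by
  unfold kap
  rw [poch_add, poch_add]
  have p2 := (poch_pos (show 0 < b+1 by linarith) k).ne'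
  have p3 := (poch_pos (show 0 < b+1+k by have : (0:ℝ) ≤ k := by positivity
                                          linarith) n).ne'
  field_simp
lemma inv_pow_le_two {x e : ℝ} (hx : 1/2 ≤ x) (he : 0 ≤ e) : x^(-e) ≤ 2^e := by
  have := rpow_le_rpow_of_nonpos (by norm_num : (0:ℝ) < 1/2) hx (neg_nonpos.2 he)
  refine this.trans (le_of_eq ?_)
  rw [one_div, inv_rpow nmm, rpow_neg nmm, inv_inv]
noncomputable def cmR (a K u : ℝ) (Z : ℕ → ℝ) (m : ℕ) : ℝ :=
  ∑ p ∈ Finset.HasAntidiagonal.antidiagonal m, u^p.1 * Z p.1 * (bn (a+2) p.2 * K^p.2)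
lemma smallA {a b : ℝ} (ha : -1 < a) (hb : -(1/2) < b) {Z : ℕ → ℝ} (hZ : SE Z) {ξ : ℝ} (h0 : 0 ≤ ξ) (h1 : ξ ≤ 1)
    {A : ℝ} (hA : 1 ≤ A) (hA2 : a+b+2 ≤ A*(b+1)) {r : ℝ} (hr0 : 0 < r) (hr : 40*A*r < 1)
    {K u ζ : ℝ} (hK0 : 0 ≤ K) (hKr : K ≤ r) (hζ0 : 0 < ζ) (hζ : ζ*(1+r) = 1+K) (hu : u = r*ξ*ζ) (hur : u ≤ r)
    (hKK : K/(1+K)^2 = r*ξ^2/(1+r)^2) :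
    HasSum (fun n => Pz a b Z ξ n * r^n) ((1-r) * ζ^(a+b+2) * ∑' m, kap a b m * cmR a K u Z m) := by
  have hr1 : r < 1/40 := by nlinarith
  have hu0 : 0 ≤ u := by rw [hu]; positivity
  have hsk : ∀ k : ℕ, a+b+2+k ≤ 2*A*(b+1+k) := by
    intro k
    have : (0:ℝ) ≤ k := by positivity
    nlinarith
  have hs0 : ∀ k : ℕ, 0 < a+b+2+(k:ℝ) := fun k => by have : (0:ℝ) ≤ k := by positivity
                                                     linarith
  have hc0 : ∀ k : ℕ, 0 < b+1+(k:ℝ) := fun k => by have : (0:ℝ) ≤ k := by positivity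
                                                   linarith
  have hkapA : ∀ k, kap a b k ≤ A^k := by
    intro k
    unfold kap
    rw [div_le_iff₀ (poch_pos lnn k)]
    exact poch_ratio_le lnn lnn hA hA2 k
  have hquad : 4*A*(r/(1-r)^2) < 1/2 := by
    rw [← mul_div_assoc, div_lt_iff₀ (by nlinarith)]
    nlinarith
  have hyL : 4*A*(|(-r)| * |ξ^2| / (1-|(-r)|)^2) ≤ 4*A*(r/(1-r)^2) := by
    rw [abs_neg, abs_of_pos hr0, abs_of_nonneg (sq_nonneg ξ)]
    have : r * ξ^2 ≤ r := mul_le_of_le_one_right hr0.le (pow_le_one₀ h0 h1)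
    gcongr
  have hyK : 4*A*(K / (1-K)^2) < 1 := by
    have : K/(1-K)^2 ≤ r/(1-r)^2 := by
      have : 0 < 1 - r := by linarith
      gcongr
    nlinarith
  have L := fun k : ℕ => lemL (σ := a+b+2+k) (c := b+1+k) (v := -r) (X := ξ^2) (hs0 k) (hc0 k) hA (hsk k)
    (by rw [abs_neg, abs_of_pos hr0]; linarith) lnn
  have Lab := fun k : ℕ => lemL_abs (σ := a+b+2+k) (c := b+1+k) (v := -r) (X := ξ^2) (hs0 k) (hc0 k) hA (hsk k)
    (by rw [abs_neg, abs_of_pos hr0]; linarith) lnn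
  have LK := fun k : ℕ => lemK (σ := a+b+2+k) (c := b+1+k) (hs0 k) (hc0 k) hA (hsk k) hK0 lnn hyK
  set RK : ℕ → ℝ := fun k => ∑' n, poch (a+b+2+k) n / poch (b+1+k) n * (bn (a+2) n * K^n) with hRK
  have LK2 : ∀ k : ℕ, HasSum (fun n => poch (a+b+2+k) n / poch (b+1+k) n * (bn (a+2) n * K^n)) (RK k) := by
    intro k
    have := (LK k).summable
    rw [show a+b+2+(k:ℝ) - (b+1+k) + 1 = a+2 by ring] at this
    exact this.hasSum
  have hH : ∀ k : ℕ, ∑' j, hq (a+b+2+k) (b+1+k) j * (r*ξ^2/(1+r)^2)^j = (1+K)^(a+b+2+k) * RK k := by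
    intro k
    have := (LK k).tsum_eq
    rw [show a+b+2+(k:ℝ) - (b+1+k) + 1 = a+2 by ring, hKK] at this
    rw [hRK]; simp only; rw [this, ← mul_assoc, ← rpow_add lnn]; simp
  -- first double sum
  set f : ℕ → ℕ → ℝ := fun k m => kap a b k * (ξ*r)^k * Z k * ((-r)^m * Jp (a+b+2+k) (b+1+k) m (ξ^2)) with hf
  set f2 : ℕ → ℕ → ℝ := fun k n => kap a b (k+n) * (u^k * Z k * (bn (a+2) n * K^n)) with hf2
  have row2 : ∀ k, HasSum (f2 k) (kap a b k * u^k * Z k * RK k) := by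
    intro k
    refine hs_congr ((LK2 k).mul_left (kap a b k * u^k * Z k)) (fun n => ?_) rfl
    simp only [hf2]; rw [kap_add hb]; ring
  have row1 : ∀ k, HasSum (f k) ((1-r) * ζ^(a+b+2) * (kap a b k * u^k * Z k * RK k)) := by
    intro k
    have := (L k).mul_left (kap a b k * (ξ*r)^k * Z k)
    refine hs_congr this (fun n => rfl) ?_
    rw [show -(-r*ξ^2)/(1- -r)^2 = r*ξ^2/(1+r)^2 by ring, hH]
    have e : ζ = (1+K)/(1+r) := by rw [← hζ]; field_simp
    have e3 : (1 - -r)^(-(a+b+2+k)) * (1+K)^(a+b+2+k) = ζ^(a+b+2) * ζ^k := by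
      rw [sub_neg_eq_add, rpow_neg lnn, ← rpow_natCast ζ, ← rpow_add hζ0, e, div_rpow lnn lnn]
      field_simp
    rw [hu]
    linear_combination (-(1-r) * (kap a b k * (ξ*r)^k * Z k) * RK k) * e3
  have sum1 : Summable (fun p : ℕ × ℕ => f p.1 p.2) := by
    refine summable_prod_le (G := fun k => |Z k| * (4*A*r)^k * (4 * 2^(a+b+2) * 2^(a+b+2))) (fun k => ?_) (fun k => ?_) ?_
    · have := (Lab k).1.mul_left (|kap a b k * (ξ*r)^k * Z k|)
      refine this.congr fun m => ?_
      exact (abs_mul _ _).symm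
    · have e : ∀ m, ‖f k m‖ = |kap a b k * (ξ*r)^k * Z k| * |(-r)^m * Jp (a+b+2+k) (b+1+k) m (ξ^2)| := by
        intro m; exact abs_mul _ _
      simp only [e]
      rw [tsum_mul_left]
      have b1 : |kap a b k * (ξ*r)^k * Z k| ≤ (A*r)^k * |Z k| := by
        rw [abs_mul, abs_mul, abs_of_nonneg (kap_nonneg ha hb k), abs_of_nonneg pvv, mul_pow A]
        have : (ξ*r)^k ≤ r^k := by gcongr; nlinarith
        gcongr
        exact hkapA k
      have hsk0 := (hs0 k).le
      have b2 : (1 - |(-r)|)^(-(a+b+2+k)) ≤ 2^(a+b+2+(k:ℝ)) := by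
        rw [abs_neg, abs_of_pos hr0]; exact inv_pow_le_two lnn (hs0 k).le
      have b3 : (1 - 4*A*(|(-r)| * |ξ^2| / (1-|(-r)|)^2))^(-((a+b+2+k+1)/2)) ≤ 2 * 2^(a+b+2+(k:ℝ)) := by
        refine (inv_pow_le_two lnn lnn).trans ?_
        have : (2:ℝ) * 2^(a+b+2+(k:ℝ)) = 2^(a+b+2+(k:ℝ)+1) := by rw [rpow_add_one nmm]; ring
        rw [this]
        apply rpow_le_rpow_of_exponent_le nmm; linarith
      have b3' : 0 ≤ (1 - 4*A*(|(-r)| * |ξ^2| / (1-|(-r)|)^2)) := by linarith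
      have e5 : (2:ℝ)^(a+b+2+(k:ℝ)) = 2^(a+b+2) * 2^k := by rw [rpow_add nmm, rpow_natCast]
      calc _ ≤ ((A*r)^k * |Z k|) * (2 * 2^(a+b+2+(k:ℝ)) * (2 * 2^(a+b+2+(k:ℝ)))) := by
            refine mul_le_mul b1 ((Lab k).2.trans ?_) (tsum_nonneg fun _ => abs_nonneg _) pvv
            refine mul_le_mul ?_ b3 (rpow_nonneg b3' _) pvv
            linarith
        _ = _ := by rw [e5, show (4*A*r)^k = (A*r)^k * (2^k * 2^k) by rw [← mul_pow, ← mul_pow]; ring]; ring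
    · exact (hZ (4*A*r) pvv lnn).mul_right _
  have sum2 : Summable (fun p : ℕ × ℕ => f2 p.1 p.2) := by
    have s1 : Summable (fun k => |Z k| * (A*r)^k) := hZ (A*r) pvv (by nlinarith)
    have s2 : Summable (fun n => |bn (a+2) n| * (A*r)^n) := SE_bn (a+2) (A*r) pvv (by nlinarith)
    have s3 := s1.mul_of_nonneg s2 (fun _ => by positivity) (fun _ => by positivity)
    apply Summable.of_norm
    refine Summable.of_nonneg_of_le (fun _ => norm_nonneg _) (fun p => ?_) s3
    simp only [hf2]
    rw [Real.norm_eq_abs, abs_mul, abs_mul, abs_mul, abs_mul, abs_of_nonneg (kap_nonneg ha hb _), abs_of_nonneg (pow_nonneg hu0 _),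
      abs_of_nonneg (pow_nonneg hK0 _)]
    calc _ ≤ A^(p.1+p.2) * (r^p.1 * |Z p.1| * (|bn (a+2) p.2| * r^p.2)) := by
          gcongr
          exact hkapA _
      _ = _ := by rw [pow_add, mul_pow, mul_pow]; ring
  have tot2 := hasSum_antidiag sum2 row2 (sum2.prod.congr (fun k => (row2 k).tsum_eq)).hasSum
  have tot1 := hasSum_antidiag sum1 row1 ((sum2.prod.congr (fun k => (row2 k).tsum_eq)).hasSum.mul_left _)
  refine hs_congr tot1 (fun n => ?_) ?_
  · unfold Pz
    rw [Finset.sum_mul]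
    refine Finset.sum_congr rfl ?_
    rintro ⟨k, m⟩ hp
    have hkm : k + m = n := by simpa using hp
    simp only [hf, ← hkm]
    rw [pow_add, mul_pow, neg_pow r m]; ring
  · rw [← tot2.tsum_eq]
    congr 1
    congr 1; funext m
    unfold cmR
    rw [Finset.mul_sum]
    refine Finset.sum_congr rfl ?_
    rintro ⟨k, j⟩ hp
    have hkm : k + j = m := by simpa using hp
    simp only [hf2, ← hkm]
noncomputable def pp (r : ℂ) : ℂ := (1-r)/(1+r)
noncomputable def SS (X : ℝ) (r : ℂ) : ℂ := ((1-X:ℝ) + X * (pp r)^2)^(2⁻¹:ℂ)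
noncomputable def KK (X : ℝ) (r : ℂ) : ℂ := (1 - SS X r)/(1 + SS X r)
noncomputable def UU (X : ℝ) (r : ℂ) : ℂ := (√X : ℝ) * (1 - pp r)/(1 + SS X r)
noncomputable def cmC (a : ℝ) (K u : ℂ) (Z : ℕ → ℝ) (m : ℕ) : ℂ :=
  ∑ p ∈ Finset.HasAntidiagonal.antidiagonal m, u^p.1 * (Z p.1 : ℂ) * ((bn (a+2) p.2 : ℂ) * K^p.2)
noncomputable def Ft (a b : ℝ) (Z : ℕ → ℝ) (X : ℝ) (r : ℂ) : ℂ :=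
  (1-r) * ((1 + pp r)^((a+b+2:ℝ):ℂ) * (1 + SS X r)^((-(a+b+2):ℝ):ℂ)) * ∑' m, (kap a b m : ℂ) * cmC a (KK X r) (UU X r) Z m
lemma one_add_ne {r : ℂ} (hr : ‖r‖ < 1) : 1 + r ≠ 0 := by
  intro h
  have : r = -1 := by linear_combination h
  rw [this] at hr; simp at hr
lemma pp_re {r : ℂ} (hr : ‖r‖ < 1) : 0 < (pp r).re := by
  have h := one_add_ne hr
  have h2 : 0 < Complex.normSq (1+r) := Complex.normSq_pos.2 h
  have h3 : Complex.normSq r < 1 := by rw [Complex.normSq_eq_norm_sq]; nlinarith [norm_nonneg r]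
  rw [Complex.normSq_apply] at h3
  unfold pp
  rw [Complex.div_re]
  rw [← add_div]
  apply div_pos _ h2
  simp; nlinarith
lemma SS_arg {X : ℝ} (h0 : 0 ≤ X) (h1 : X ≤ 1) {r : ℂ} (hr : ‖r‖ < 1) :
    ((1-X:ℝ) + X * (pp r)^2 : ℂ) ∈ Complex.slitPlane := by
  have hp := pp_re hr
  rw [Complex.mem_slitPlane_iff]
  by_cases hi : (pp r).im = 0
  · left
    have : ((1-X:ℝ) + X * (pp r)^2 : ℂ).re = 1 - X + X * (pp r).re^2 := by
      simp [pow_two, hi]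
    rw [this]
    rcases h0.eq_or_lt with h | h
    · rw [← h]; norm_num
    · have : 0 < X * (pp r).re^2 := by positivity
      linarith
  · rcases h0.eq_or_lt with h | h
    · left; rw [← h]; simp
    · right
      have : ((1-X:ℝ) + X * (pp r)^2 : ℂ).im = X * (2 * (pp r).re * (pp r).im) := by
        simp [pow_two]; left; ring
      rw [this]
      positivity
lemma SS_sq (X : ℝ) (r : ℂ) : (SS X r)^2 = (1-X:ℝ) + X * (pp r)^2 := by
  unfold SS
  have := Complex.cpow_nat_inv_pow ((1-X:ℝ) + X * (pp r)^2 : ℂ) (n := 2) nmm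
  simpa using this
lemma SS_re {X : ℝ} (h0 : 0 ≤ X) (h1 : X ≤ 1) {r : ℂ} (hr : ‖r‖ < 1) : 0 < (SS X r).re := by
  have h := SS_arg h0 h1 hr
  unfold SS
  set q := ((1-X:ℝ) + X * (pp r)^2 : ℂ)
  rw [Complex.cpow_inv_two_re]
  apply Real.sqrt_pos.2
  rcases Complex.mem_slitPlane_iff.1 h with h | h
  · have := norm_nonneg q; linarith
  · have : |q.re| < ‖q‖ := Complex.abs_re_lt_norm.2 h
    have := neg_abs_le q.re
    linarith
lemma one_add_SS_re {X : ℝ} (h0 : 0 ≤ X) (h1 : X ≤ 1) {r : ℂ} (hr : ‖r‖ < 1) : 1 < (1 + SS X r).re := by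
  have := SS_re h0 h1 hr
  simp; exact this
lemma one_add_SS_ne {X : ℝ} (h0 : 0 ≤ X) (h1 : X ≤ 1) {r : ℂ} (hr : ‖r‖ < 1) : 1 + SS X r ≠ 0 := by
  intro h
  have := one_add_SS_re h0 h1 hr
  rw [h] at this; simp at this; linarith
lemma KK_norm {X : ℝ} (h0 : 0 ≤ X) (h1 : X ≤ 1) {r : ℂ} (hr : ‖r‖ < 1) : ‖KK X r‖ < 1 := by
  have hs := SS_re h0 h1 hr
  unfold KK
  rw [norm_div, div_lt_one (norm_pos_iff.2 (one_add_SS_ne h0 h1 hr))]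
  apply lt_of_pow_lt_pow_left₀ 2 (norm_nonneg _)
  rw [← Complex.normSq_eq_norm_sq, ← Complex.normSq_eq_norm_sq, Complex.normSq_apply, Complex.normSq_apply]
  simp; nlinarith
lemma UU_sq {X : ℝ} (h0 : 0 ≤ X) (h1 : X ≤ 1) {r : ℂ} (hr : ‖r‖ < 1) : (UU X r)^2 = KK X r * r := by
  have e1 := one_add_SS_ne h0 h1 hr
  have e2 := one_add_ne hr
  have hs := SS_sq X r
  have hX : ((√X:ℝ):ℂ)^2 = X := by rw [← Complex.ofReal_pow, sq_sqrt h0]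
  have hr' : r = (1 - pp r)/(1+pp r) := by
    have : 1 + pp r = 2/(1+r) := by unfold pp; field_simp; ring
    rw [this]; unfold pp; field_simp; ring
  have e3 : 1 + pp r ≠ 0 := by
    have : 1 + pp r = 2/(1+r) := by unfold pp; field_simp; ring
    rw [this]; exact div_ne_zero two_ne_zero e2
  have : KK X r * r = KK X r * ((1 - pp r)/(1+pp r)) := by rw [← hr']
  rw [this]
  unfold UU KK
  rw [div_pow, mul_pow, hX]
  field_simp
  push_cast at hs
  linear_combination ((1:ℂ) - pp r) * hs
lemma UU_norm {X : ℝ} (h0 : 0 ≤ X) (h1 : X ≤ 1) {r : ℂ} (hr : ‖r‖ < 1) : ‖UU X r‖ < 1 := by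
  have h := congrArg norm (UU_sq h0 h1 hr)
  rw [norm_pow, norm_mul] at h
  have := KK_norm h0 h1 hr
  nlinarith [norm_nonneg (KK X r), norm_nonneg r, norm_nonneg (UU X r)]
lemma pp_diff {r : ℂ} (hr : ‖r‖ < 1) : DifferentiableAt ℂ pp r := by
  unfold pp
  exact DifferentiableAt.div fpp fpp (one_add_ne hr)
lemma SS_diff {X : ℝ} (h0 : 0 ≤ X) (h1 : X ≤ 1) {r : ℂ} (hr : ‖r‖ < 1) : DifferentiableAt ℂ (SS X) r := by
  unfold SS
  have := pp_diff hr
  exact DifferentiableAt.cpow fpp fpp (SS_arg h0 h1 hr)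
lemma KK_diff {X : ℝ} (h0 : 0 ≤ X) (h1 : X ≤ 1) {r : ℂ} (hr : ‖r‖ < 1) : DifferentiableAt ℂ (KK X) r := by
  unfold KK
  have := SS_diff h0 h1 hr
  exact DifferentiableAt.div fpp fpp (one_add_SS_ne h0 h1 hr)
lemma UU_diff {X : ℝ} (h0 : 0 ≤ X) (h1 : X ≤ 1) {r : ℂ} (hr : ‖r‖ < 1) : DifferentiableAt ℂ (UU X) r := by
  unfold UU
  have := SS_diff h0 h1 hr
  have := pp_diff hr
  exact DifferentiableAt.div fpp fpp (one_add_SS_ne h0 h1 hr)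
lemma SE_conv {f g : ℕ → ℝ} (hf : SE f) (hg : SE g) :
    SE (fun m => ∑ p ∈ Finset.HasAntidiagonal.antidiagonal m, |f p.1| * |g p.2|) := by
  intro ρ h0 h1
  have := summable_sum_mul_antidiagonal_of_summable_mul (f := fun n => |f n| * ρ^n) (g := fun n => |g n| * ρ^n)
    ((hf ρ h0 h1).mul_of_nonneg (hg ρ h0 h1) (fun _ => by positivity) (fun _ => by positivity))
  refine this.congr fun m => ?_
  rw [abs_of_nonneg (Finset.sum_nonneg fun _ _ => by positivity), Finset.sum_mul]
  refine Finset.sum_congr rfl ?_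
  rintro ⟨i, j⟩ hp
  have hkm : i + j = m := by simpa using hp
  simp only [← hkm, pow_add]; ring
lemma SE_mul {f g : ℕ → ℝ} (hf : SE f) (hg : SE g) : SE (fun m => f m * g m) := by
  intro ρ h0 h1
  have q0 : 0 ≤ √ρ := sqrt_nonneg _
  have q1 : √ρ < 1 := by rw [Real.sqrt_lt' one_pos]; simpa using h1
  have s1 := hf _ q0 q1
  have s2 := hg _ q0 q1
  obtain ⟨C, hC⟩ := s2.tendsto_atTop_zero.bddAbove_range
  refine Summable.of_nonneg_of_le (fun _ => by positivity) (fun n => ?_) (s1.mul_right C)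
  have : ρ^n = √ρ^n * √ρ^n := by rw [← mul_pow, mul_self_sqrt h0]
  rw [this, abs_mul]
  have h2 : |g n| * √ρ^n ≤ C := hC ⟨n, rfl⟩
  calc _ = (|f n| * √ρ^n) * (|g n| * √ρ^n) := by ring
    _ ≤ _ := by gcongr
lemma SE_kap {a b : ℝ} (ha : -1 < a) (hb : -(1/2) < b) : SE (kap a b) := by
  intro ρ h0 h1
  rcases h0.eq_or_lt with h | h
  · rw [← h]
    apply summable_of_ne_finset_zero (s := {0})
    intro n hn
    simp only [Finset.mem_singleton] at hn
    simp [hn]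
  have hk : ∀ n, 0 < kap a b n := fun n => div_pos (poch_pos lnn n) (poch_pos lnn n)
  apply summable_of_ratio_test_tendsto_lt_one h1
  · exact Eventually.of_forall fun n => by have := hk n; positivity
  · have e : ∀ n : ℕ, ‖|kap a b (n+1)| * ρ^(n+1)‖ / ‖|kap a b n| * ρ^n‖ = (1 + (a+1) / (b+1+n)) * ρ := by
      intro n
      rw [Real.norm_eq_abs, Real.norm_eq_abs, abs_mul, abs_mul, abs_abs, abs_abs, abs_of_pos (hk _), abs_of_pos (hk _),
        abs_of_pos (pow_pos h _), abs_of_pos (pow_pos h _), kap_add hb n 1, poch_one, poch_one]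
      have := (hk n).ne'
      have : b+1+(n:ℝ) ≠ 0 := by have : (0:ℝ) ≤ n := by positivity
                                 linarith
      field_simp
      ring
    simp only [e]
    have : Tendsto (fun n : ℕ => b+1+(n:ℝ)) atTop atTop := tendsto_atTop_add_const_left _ _ tendsto_natCast_atTop_atTop
    simpa using ((this.const_div_atTop (a+1)).const_add 1).mul_const ρ
lemma cmC_le {a : ℝ} {K u : ℂ} (Z : ℕ → ℝ) {q : ℝ} (hK : ‖K‖ ≤ q) (hu : ‖u‖ ≤ q) (m : ℕ) :
    ‖cmC a K u Z m‖ ≤ (∑ p ∈ Finset.HasAntidiagonal.antidiagonal m, |Z p.1| * |bn (a+2) p.2|) * q^m := by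
  unfold cmC
  rw [Finset.sum_mul]
  refine (norm_sum_le _ _).trans (Finset.sum_le_sum ?_)
  rintro ⟨i, j⟩ hp
  have hkm : i + j = m := by simpa using hp
  simp only [← hkm, pow_add, norm_mul, norm_pow, Complex.norm_real, Real.norm_eq_abs]
  have q0 : 0 ≤ q := (norm_nonneg _).trans hK
  calc _ ≤ q^i * |Z i| * (|bn (a+2) j| * q^j) := by gcongr
    _ = _ := by ring
/-- majorant sequence -/
lemma maj_summable {a b : ℝ} (ha : -1 < a) (hb : -(1/2) < b) {Z : ℕ → ℝ} (hZ : SE Z) {q : ℝ} (h0 : 0 ≤ q) (h1 : q < 1) :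
    Summable (fun m => kap a b m * ((∑ p ∈ Finset.HasAntidiagonal.antidiagonal m, |Z p.1| * |bn (a+2) p.2|) * q^m)) := by
  have := SE_mul (SE_kap ha hb) (SE_conv hZ (SE_bn (a+2))) q h0 h1
  refine this.congr fun m => ?_
  rw [abs_of_nonneg, mul_assoc]
  exact mul_nonneg (kap_nonneg ha hb m) (Finset.sum_nonneg fun _ _ => by positivity)
lemma Ft_diff {a b : ℝ} (ha : -1 < a) (hb : -(1/2) < b) {Z : ℕ → ℝ} (hZ : SE Z) {X : ℝ} (h0 : 0 ≤ X) (h1 : X ≤ 1) :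
    DifferentiableOn ℂ (Ft a b Z X) (Metric.ball 0 1) := by
  intro r0 hr0
  have hr : ‖r0‖ < 1 := by simpa using hr0
  apply DifferentiableAt.differentiableWithinAt
  have d1 := pp_diff hr
  have d2 := SS_diff h0 h1 hr
  have sl1 : 1 + pp r0 ∈ Complex.slitPlane := by left; have := pp_re hr; simp; linarith
  have sl2 : 1 + SS X r0 ∈ Complex.slitPlane := by left; have := one_add_SS_re h0 h1 hr; linarith
  have hd : DifferentiableAt ℂ (fun r => ∑' m, (kap a b m : ℂ) * cmC a (KK X r) (UU X r) Z m) r0 := by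
    obtain ⟨q, hq1, hq2⟩ := exists_between (max_lt (KK_norm h0 h1 hr) (UU_norm h0 h1 hr))
    have q0 : 0 ≤ q := (norm_nonneg _).trans ((le_max_left _ _).trans hq1.le)
    have ev : ∀ᶠ r in nhds r0, ‖r‖ < 1 ∧ ‖KK X r‖ < q ∧ ‖UU X r‖ < q := by
      refine (continuous_norm.continuousAt.eventually_lt continuousAt_const hr).and
        (((KK_diff h0 h1 hr).continuousAt.norm.eventually_lt continuousAt_const ((le_max_left _ _).trans_lt hq1)).and
          ((UU_diff h0 h1 hr).continuousAt.norm.eventually_lt continuousAt_const ((le_max_right _ _).trans_lt hq1)))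
    obtain ⟨V, hV, hVo, hrV⟩ := eventually_nhds_iff.1 ev
    have := Complex.differentiableOn_tsum_of_summable_norm (F := fun m r => (kap a b m : ℂ) * cmC a (KK X r) (UU X r) Z m)
      (maj_summable ha hb hZ q0 hq2) (U := V) (fun m r hrV => ?_) hVo (fun m r hrV => ?_)
    · exact (this r0 hrV).differentiableAt (hVo.mem_nhds hrV)
    · apply DifferentiableAt.differentiableWithinAt
      have k1 := KK_diff h0 h1 (hV r hrV).1
      have k2 := UU_diff h0 h1 (hV r hrV).1
      unfold cmC
      fun_prop
    · rw [norm_mul, Complex.norm_real, Real.norm_eq_abs, abs_of_nonneg (kap_nonneg ha hb m)]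
      have := cmC_le (a := a) Z (hV r hrV).2.1.le (hV r hrV).2.2.le m
      have := kap_nonneg ha hb m
      gcongr
  unfold Ft
  refine DifferentiableAt.mul (DifferentiableAt.mul fpp (DifferentiableAt.mul ?_ ?_)) hd
  · exact DifferentiableAt.cpow fpp fpp sl1
  · exact DifferentiableAt.cpow fpp fpp sl2
lemma Ft_real {a b : ℝ} (ha : -1 < a) (hb : -(1/2) < b) {Z : ℕ → ℝ} (hZ : SE Z) {X : ℝ} (h0 : 0 ≤ X) (h1 : X ≤ 1)
    {r : ℝ} (hr0 : 0 < r) (hr : r < 1/(40 * max 1 ((a+b+2)/(b+1)))) :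
    HasSum (fun n => (Pz a b Z (√X) n : ℂ) * (r:ℂ)^n) (Ft a b Z X r) := by
  set A := max 1 ((a+b+2)/(b+1)) with hAd
  have hA : 1 ≤ A := le_max_left _ _
  have hA2 : a+b+2 ≤ A*(b+1) := by
    rw [← div_le_iff₀ lnn]; exact le_max_right _ _
  have hrA : 40*A*r < 1 := by
    rw [lt_div_iff₀ pvv] at hr; linarith
  have hr1 : r < 1 := by nlinarith
  set p : ℝ := (1-r)/(1+r) with hp
  have hp0 : 0 < p := by rw [hp]; apply div_pos <;> linarith
  have hp1 : p ≤ 1 := by rw [hp, div_le_one lnn]; linarith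
  have hpc : pp (r:ℂ) = (p:ℂ) := by rw [hp]; unfold pp; push_cast; rfl
  set S : ℝ := √((1-X) + X*p^2) with hS
  have hq0 : 0 ≤ (1-X) + X*p^2 := by have : 0 ≤ 1 - X := by linarith
                                     positivity
  have hSS : S^2 = (1-X) + X*p^2 := sq_sqrt hq0
  have hS0 : 0 ≤ S := sqrt_nonneg _
  have hp2 : p^2 ≤ 1 := pow_le_one₀ hp0.le hp1
  have hS1 : S ≤ 1 := by
    apply Real.sqrt_le_one.2
    nlinarith
  have hpS : p ≤ S := by
    apply Real.le_sqrt_of_sq_le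
    nlinarith
  have hSc : SS X (r:ℂ) = (S:ℂ) := by
    unfold SS
    rw [hpc, hS, Real.sqrt_eq_rpow, Complex.ofReal_cpow hq0]
    push_cast
    congr 1
    norm_num
  have e1 : 1 + p = 2/(1+r) := by rw [hp]; field_simp; ring
  have e2 : 1 - p = 2*r/(1+r) := by rw [hp]; field_simp; ring
  set K : ℝ := (1-S)/(1+S) with hK
  set ζ : ℝ := (1+p)/(1+S) with hζ
  set u : ℝ := √X * (1-p)/(1+S) with hu
  have eK : 1 + K = 2/(1+S) := by rw [hK]; field_simp; ring
  have hζr : ζ*(1+r) = 1+K := by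
    rw [eK, hζ, e1]; field_simp
  have hX1 : √X ≤ 1 := Real.sqrt_le_one.2 h1
  have hX0 : 0 ≤ √X := sqrt_nonneg _
  have hζ0 : 0 < ζ := by positivity
  have hζ1 : ζ ≤ 1 := by rw [hζ, div_le_one lnn]; linarith
  have eu : u = r*√X*ζ := by
    rw [hu, e2, hζ, e1]; field_simp
  have main := smallA ha hb hZ hX0 hX1 hA hA2 hr0 hrA (K := K) (u := u) (ζ := ζ)
    (by rw [hK]; apply div_nonneg <;> linarith)
    (by
      have : r = (1-p)/(1+p) := by rw [e1, e2]; field_simp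
      rw [this, hK, div_le_div_iff₀ lnn lnn]; nlinarith)
    hζ0 hζr eu
    (by
      rw [eu, mul_assoc]; apply mul_le_of_le_one_right hr0.le
      exact mul_le_one₀ hX1 hζ0.le hζ1)
    (by
      rw [eK, sq_sqrt h0, hK]
      have e3 : (1-S)/(1+S)/(2/(1+S))^2 = (1-S^2)/4 := by field_simp; ring
      have e4 : r*X/(1+r)^2 = X*(1-p^2)/4 := by
        rw [show 1 - p^2 = (1+p)*(1-p) by ring, e1, e2]; field_simp; ring
      rw [e3, e4, hSS]; ring)
  have cK : KK X (r:ℂ) = (K:ℂ) := by unfold KK; rw [hSc, hK]; push_cast; rfl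
  have cU : UU X (r:ℂ) = (u:ℂ) := by unfold UU; rw [hSc, hpc, hu]; push_cast; rfl
  refine hs_congr ((Complex.hasSum_ofReal).2 main) (fun n => by push_cast; rfl) ?_
  unfold Ft
  rw [cK, cU, hSc, hpc]
  have ez : ζ^(a+b+2) = (1+p)^(a+b+2) * (1+S)^(-(a+b+2)) := by
    rw [hζ, div_rpow lnn lnn, rpow_neg lnn]; rfl
  rw [ez]
  push_cast
  rw [Complex.ofReal_cpow lnn, Complex.ofReal_cpow lnn]
  push_cast
  congr 1
  congr 1; funext m
  unfold cmR cmC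
  push_cast
  rfl
lemma Ft_hasSum {a b : ℝ} (ha : -1 < a) (hb : -(1/2) < b) {Z : ℕ → ℝ} (hZ : SE Z) {X : ℝ} (h0 : 0 ≤ X) (h1 : X ≤ 1)
    {r : ℂ} (hr : ‖r‖ < 1) : HasSum (fun n => (Pz a b Z (√X) n : ℂ) * r^n) (Ft a b Z X r) :=
  ident (Ft_diff ha hb hZ h0 h1) (r0 := 1/(40 * max 1 ((a+b+2)/(b+1)))) pvv
    (fun _ h h' => Ft_real ha hb hZ h0 h1 h h') hr
noncomputable def Bt (u v : ℝ) : ℝ := Real.Gamma u * Real.Gamma v / Real.Gamma (u+v)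
lemma Bt_pos {u v : ℝ} (hu : 0 < u) (hv : 0 < v) : 0 < Bt u v := by
  unfold Bt
  have := Gamma_pos_of_pos hu
  have := Gamma_pos_of_pos hv
  have := Gamma_pos_of_pos (add_pos hu hv)
  positivity
lemma beta_int {u v : ℝ} (hu : 0 < u) (hv : 0 < v) :
    IntegrableOn (fun z : ℝ => z^(u-1) * (1-z)^(v-1)) (Ioo 0 1) ∧ ∫ z in Ioo (0:ℝ) 1, z^(u-1) * (1-z)^(v-1) = Bt u v := by
  have hc := Complex.betaIntegral_convergent (u := u) (v := v) (by simpa) (by simpa)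
  have he : ∀ x ∈ Ioo (0:ℝ) 1, (x:ℂ)^((u:ℂ)-1) * (1-x:ℂ)^((v:ℂ)-1) = ((x^(u-1) * (1-x)^(v-1) : ℝ) : ℂ) := by
    intro x hx
    have h1 : 0 ≤ x := hx.1.le
    have h2 : 0 ≤ 1 - x := by linarith [hx.2]
    push_cast
    rw [Complex.ofReal_cpow h1, Complex.ofReal_cpow h2]
    push_cast; rfl
  rw [intervalIntegrable_iff_integrableOn_Ioo_of_le zero_le_one] at hc
  have hc2 : IntegrableOn (fun x : ℝ => ((x^(u-1) * (1-x)^(v-1) : ℝ) : ℂ)) (Ioo 0 1) :=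
    hc.congr_fun he measurableSet_Ioo
  have hc3 : IntegrableOn (fun x : ℝ => x^(u-1) * (1-x)^(v-1)) (Ioo 0 1) := by
    have := hc2.re
    show Integrable _ _
    simpa using this
  refine ⟨hc3, ?_⟩
  have h3 := ProbabilityTheory.beta_eq_betaIntegralReal u v hu hv
  unfold ProbabilityTheory.beta at h3
  unfold Bt
  rw [h3, Complex.betaIntegral, intervalIntegral.integral_of_le zero_le_one, integral_Ioc_eq_integral_Ioo,
    setIntegral_congr_fun measurableSet_Ioo he]
  have h5 : ∫ x in Ioo (0:ℝ) 1, ((x^(u-1) * (1-x)^(v-1) : ℝ) : ℂ) = ((∫ x in Ioo (0:ℝ) 1, x^(u-1) * (1-x)^(v-1) : ℝ) : ℂ) :=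
    integral_ofReal
  rw [h5, Complex.ofReal_re]
lemma Bt_add {u v : ℝ} (hu : 0 < u) (hv : 0 < v) (i j : ℕ) :
    Bt (u+i) (v+j) = Bt u v * (poch u i * poch v j / poch (u+v) (i+j)) := by
  unfold Bt
  rw [Gamma_add_nat hu, Gamma_add_nat hv, show u+i+(v+j) = (u+v)+((i+j:ℕ):ℝ) by push_cast; ring, Gamma_add_nat lnn]
  have h1 := (Gamma_pos_of_pos (add_pos hu hv)).ne'
  have h2 := (poch_pos (add_pos hu hv) (i+j)).ne'
  field_simp
/-- basic bound of x^{M-1}(x+ℓ)^{-N} -/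
lemma g_int {M N l : ℝ} (hM : 0 < M) (hMN : M < N) (hl : 0 < l) :
    IntegrableOn (fun x : ℝ => x^(M-1) * (x+l)^(-N)) (Ioi 0) ∧
    ∫ x in Ioi (0:ℝ), x^(M-1) * (x+l)^(-N) ≤ (1/M + 1/(N-M)) * l^(M-N) := by
  have meas : Measurable (fun x : ℝ => x^(M-1) * (x+l)^(-N)) := by fun_prop
  have i1 : IntegrableOn (fun x : ℝ => l^(-N) * x^(M-1)) (Ioc 0 l) :=
    ((intervalIntegrable_iff_integrableOn_Ioc_of_le hl.le).1 (intervalIntegral.intervalIntegrable_rpow' lnn)).const_mul _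
  have i2 : IntegrableOn (fun x : ℝ => x^(M-N-1)) (Ioi l) := integrableOn_Ioi_rpow_of_lt lnn hl
  have b1 : ∀ x ∈ Ioc 0 l, x^(M-1) * (x+l)^(-N) ≤ l^(-N) * x^(M-1) := by
    intro x hx
    rw [mul_comm]
    have h0 := hx.1
    gcongr ?_ * _
    exact rpow_le_rpow_of_nonpos hl lnn lnn
  have b2 : ∀ x ∈ Ioi l, x^(M-1) * (x+l)^(-N) ≤ x^(M-N-1) := by
    intro x hx
    have h0 : 0 < x := hl.trans hx
    rw [show M-N-1 = (M-1)+(-N) by ring, rpow_add h0]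
    gcongr _ * ?_
    exact rpow_le_rpow_of_nonpos h0 lnn lnn
  have p1 : ∀ x, 0 < x → 0 ≤ x^(M-1) * (x+l)^(-N) := fun x hx => by positivity
  have j1 : IntegrableOn (fun x : ℝ => x^(M-1) * (x+l)^(-N)) (Ioc 0 l) := by
    refine Integrable.mono' i1 meas.aestronglyMeasurable ?_
    filter_upwards [ae_restrict_mem measurableSet_Ioc] with x hx
    rw [Real.norm_eq_abs, abs_of_nonneg (p1 x hx.1)]; exact b1 x hx
  have j2 : IntegrableOn (fun x : ℝ => x^(M-1) * (x+l)^(-N)) (Ioi l) := by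
    refine Integrable.mono' i2 meas.aestronglyMeasurable ?_
    filter_upwards [ae_restrict_mem measurableSet_Ioi] with x hx
    rw [Real.norm_eq_abs, abs_of_nonneg (p1 x (hl.trans hx))]; exact b2 x hx
  have hu : Ioc 0 l ∪ Ioi l = Ioi 0 := Ioc_union_Ioi_eq_Ioi hl.le
  refine ⟨by rw [← hu]; exact j1.union j2, ?_⟩
  rw [← hu, setIntegral_union (Ioc_disjoint_Ioi le_rfl) measurableSet_Ioi j1 j2]
  have k1 := setIntegral_mono_on j1 i1 measurableSet_Ioc b1
  have k2 := setIntegral_mono_on j2 i2 measurableSet_Ioi b2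
  rw [integral_Ioi_rpow_of_lt lnn hl] at k2
  have k3 : ∫ x in Ioc 0 l, x^(M-1) = (l^(M-1+1) - 0^(M-1+1))/(M-1+1) := by
    rw [← intervalIntegral.integral_of_le hl.le, integral_rpow (Or.inl lnn)]
  rw [integral_const_mul, k3] at k1
  refine (add_le_add k1 k2).trans (le_of_eq ?_)
  rw [show M-1+1 = M by ring, zero_rpow hM.ne', show M-N-1+1 = M-N by ring, sub_zero, ← mul_div_assoc, ← rpow_add hl,
    show -N+M = M-N by ring]
  have : M-N ≠ 0 := by linarith
  have : N-M ≠ 0 := by linarith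
  field_simp
  ring
noncomputable def Phi (b : ℝ) (Φ : ℂ → ℂ) : ℕ → ℂ → ℂ
  | 0 => Φ
  | (i+1) => fun z => ((b+1+i:ℝ):ℂ) * Phi b Φ i z + z * deriv (Phi b Φ i) z
lemma hasSum_zderiv {Ψ : ℂ → ℂ} {c : ℕ → ℂ} (hd : DifferentiableOn ℂ Ψ (Metric.ball 0 1))
    (hs : ∀ z : ℂ, ‖z‖ < 1 → HasSum (fun m => c m * z^m) (Ψ z)) (z : ℂ) (hz : ‖z‖ < 1) :
    HasSum (fun m : ℕ => (m:ℂ) * c m * z^m) (z * deriv Ψ z) := by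
  have hc : ∀ m, c m = iteratedDeriv m Ψ 0 / m.factorial := by
    have := coef_zero (d := fun m => c m - iteratedDeriv m Ψ 0 / m.factorial) (r0 := 1) one_pos ?_
    · intro m; exact sub_eq_zero.1 (this m)
    · intro r h0 h1
      have hr : ‖(r:ℂ)‖ < 1 := by rw [Complex.norm_real, Real.norm_eq_abs, abs_of_pos h0]; exact h1
      have t := Complex.hasSum_taylorSeries_on_ball hd (z := (r:ℂ)) (by simpa using hr)
      refine hs_congr ((hs r hr).sub t) ?_ (by simp)
      intro n
      simp only [sub_zero, smul_eq_mul]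
      ring
  have hd' : DifferentiableOn ℂ (deriv Ψ) (Metric.ball 0 1) := hd.deriv Metric.isOpen_ball
  have t := Complex.hasSum_taylorSeries_on_ball hd' (z := z) (by simpa using hz)
  rw [← hasSum_nat_add_iff' 1]
  refine hs_congr (t.mul_left z) ?_ (by simp)
  intro n
  rw [hc]
  simp only [sub_zero, smul_eq_mul]
  rw [← iteratedDeriv_succ', Nat.factorial_succ]
  have : (n.factorial : ℂ) ≠ 0 := by exact_mod_cast n.factorial_ne_zero
  have h2 : ((n:ℂ)+1) ≠ 0 := by exact_mod_cast n.succ_ne_zero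
  push_cast
  field_simp
  ring
lemma Phi_diff (b : ℝ) {Φ : ℂ → ℂ} {V : Set ℂ} (hV : IsOpen V) (hd : DifferentiableOn ℂ Φ V) (i : ℕ) :
    DifferentiableOn ℂ (Phi b Φ i) V := by
  induction i with
  | zero => exact hd
  | succ i ih =>
    have := ih.deriv hV
    unfold Phi
    fun_prop
lemma Phi_hasSum (b : ℝ) {Φ : ℂ → ℂ} {c : ℕ → ℂ} (hd : DifferentiableOn ℂ Φ (Metric.ball 0 1))
    (hs : ∀ z : ℂ, ‖z‖ < 1 → HasSum (fun m => c m * z^m) (Φ z)) (i : ℕ) :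
    ∀ z : ℂ, ‖z‖ < 1 → HasSum (fun m : ℕ => (poch (b+1+m) i : ℂ) * c m * z^m) (Phi b Φ i z) := by
  induction i with
  | zero => intro z hz; simpa [poch_zero, Phi] using hs z hz
  | succ i ih =>
    intro z hz
    have h2 := hasSum_zderiv (Phi_diff b Metric.isOpen_ball hd i) ih z hz
    refine hs_congr (((ih z hz).mul_left ((b+1+i:ℝ):ℂ)).add h2) ?_ rfl
    intro m
    rw [poch_succ]; push_cast; ring
lemma Phi_bound {b c' : ℝ} (hb : -(1/2) < b) (hc : 0 < c') (hc1 : c' < 1) (i : ℕ) : ∃ B : ℝ, 0 ≤ B ∧ ∀ (Φ : ℂ → ℂ) (V : Set ℂ) (l Q : ℝ),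
    IsOpen V → DifferentiableOn ℂ Φ V → 0 < l → l ≤ 2 → 0 ≤ Q →
    (∀ z : ℝ, 0 ≤ z → z < 1 → Metric.ball (z:ℂ) (c' * (1-z+l)) ⊆ V) →
    (∀ z : ℝ, 0 ≤ z → z < 1 → ∀ w ∈ Metric.ball (z:ℂ) (c' * (1-z+l)), ‖Φ w‖ ≤ Q) →
    ∀ z : ℝ, 0 ≤ z → z < 1 → ∀ w ∈ Metric.ball (z:ℂ) (c'/2^i * (1-z+l)), ‖Phi b Φ i w‖ ≤ B * Q * ((1-z+l)^i)⁻¹ := by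
  induction i with
  | zero =>
    refine ⟨1, zero_le_one, fun Φ V l Q _ _ _ _ _ _ h z hz hz1 w hw => ?_⟩
    simp only [pow_zero, div_one] at hw
    simpa [Phi] using h z hz hz1 w hw
  | succ i ih =>
    obtain ⟨B, hB, ih⟩ := ih
    refine ⟨(b+1+i)*B*3 + 4*(B/(c'/2^i/4)), ?_, fun Φ V l Q hV hd hl hl2 hQ hsub h z hz hz1 w hw => ?_⟩
    · have : 0 ≤ b+1+i := by have : (0:ℝ) ≤ i := Nat.cast_nonneg i; linarith
      positivity
    have ih := ih Φ V l Q hV hd hl hl2 hQ hsub h z hz hz1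
    set x := 1 - z + l with hx
    have hx0 : 0 < x := by linarith
    have hx3 : x ≤ 3 := by linarith
    have hbi : 0 ≤ b+1+i := by have : (0:ℝ) ≤ i := Nat.cast_nonneg i; linarith
    set R := c'/2^i * x with hR
    have hR0 : 0 < R := by positivity
    have hRc : R ≤ c' * x := by
      rw [hR]; gcongr; apply div_le_self hc.le; exact one_le_pow₀ nmm
    have hR2 : c'/2^(i+1) * x = R/2 := by rw [hR, pow_succ]; field_simp
    rw [hR2, Metric.mem_ball] at hw
    have hball : Metric.closedBall w (R/4) ⊆ Metric.ball (z:ℂ) R := by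
      intro v hv
      rw [Metric.mem_closedBall] at hv
      rw [Metric.mem_ball]
      linarith [dist_triangle v w (z:ℂ)]
    have hballV : Metric.closedBall w (R/4) ⊆ V := hball.trans ((Metric.ball_subset_ball hRc).trans (hsub z hz hz1))
    have e1 : ‖Phi b Φ i w‖ ≤ B * Q * (x^i)⁻¹ := ih w (hball (Metric.mem_closedBall_self pvv))
    have e2 : ‖deriv (Phi b Φ i) w‖ ≤ B * Q * (x^i)⁻¹ / (R/4) := by
      apply Complex.norm_deriv_le_of_forall_mem_sphere_norm_le pvv
      · apply DifferentiableOn.diffContOnCl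
        rw [closure_ball _ pvv]
        exact (Phi_diff b hV hd i).mono hballV
      · intro v hv
        exact ih v (hball (Metric.sphere_subset_closedBall hv))
    have e3 : ‖w‖ ≤ 4 := by
      have h1 : ‖w‖ ≤ dist w z + ‖(z:ℂ)‖ := by
        have := norm_add_le (w - z) (z:ℂ); rw [sub_add_cancel] at this; rwa [dist_eq_norm]
      rw [Complex.norm_real, Real.norm_eq_abs, abs_of_nonneg hz] at h1
      nlinarith
    have hn : ‖((b+1+i:ℝ):ℂ)‖ = b+1+i := by rw [Complex.norm_real, Real.norm_eq_abs, abs_of_nonneg hbi]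
    calc ‖Phi b Φ (i+1) w‖ ≤ ‖((b+1+i:ℝ):ℂ) * Phi b Φ i w‖ + ‖w * deriv (Phi b Φ i) w‖ := norm_add_le _ _
      _ ≤ (b+1+i) * (B * Q * (x^i)⁻¹) + 4 * (B * Q * (x^i)⁻¹ / (R/4)) := by
        rw [norm_mul, norm_mul, hn]; gcongr
      _ = (b+1+i) * B * x * (Q * (x^(i+1))⁻¹) + 4 * (B/(c'/2^i/4)) * (Q * (x^(i+1))⁻¹) := by
        rw [hR, pow_succ]; field_simp
      _ ≤ (b+1+i) * B * 3 * (Q * (x^(i+1))⁻¹) + 4 * (B/(c'/2^i/4)) * (Q * (x^(i+1))⁻¹) := by gcongr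
      _ = _ := by ring
lemma gI_bound {s M : ℝ} {N : ℕ} (hs : 1/2 < s) (hM : 0 < M) (hMN : M < N) : ∃ C : ℝ, 0 ≤ C ∧ ∀ l : ℝ, 0 < l → l ≤ 2 →
    IntegrableOn (fun z : ℝ => z^(s-1) * (1-z)^(M-1) * ((1-z+l)^N)⁻¹) (Ioo 0 1) ∧
    ∫ z in Ioo (0:ℝ) 1, z^(s-1) * (1-z)^(M-1) * ((1-z+l)^N)⁻¹ ≤ C * l^(M-N) := by
  have hs0 : 0 < s := by linarith
  have hB := Bt_pos hs0 hM
  have hNM : 0 < (N:ℝ) - M := by linarith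
  refine ⟨2^N * Bt s M * 2^((N:ℝ)-M) + 2*(1/M + 1/((N:ℝ)-M)), by positivity, fun l hl hl2 => ?_⟩
  obtain ⟨g1, g2⟩ := g_int (N := (N:ℝ)) hM hMN hl
  obtain ⟨b1, b2⟩ := beta_int hs0 hM
  have g3 : IntervalIntegrable (fun x : ℝ => x^(M-1) * (x+l)^(-(N:ℝ))) volume 0 1 := by
    rw [intervalIntegrable_iff_integrableOn_Ioo_of_le zero_le_one]
    exact g1.mono_set (fun x hx => hx.1)
  have g4 : IntegrableOn (fun x : ℝ => (1-x)^(M-1) * (1-x+l)^(-(N:ℝ))) (Ioo 0 1) := by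
    rw [← intervalIntegrable_iff_integrableOn_Ioo_of_le zero_le_one]
    have := (g3.comp_sub_left 1).symm
    simpa using this
  have g5 : ∫ x in Ioo (0:ℝ) 1, (1-x)^(M-1) * (1-x+l)^(-(N:ℝ)) ≤ (1/M + 1/((N:ℝ)-M)) * l^(M-N) := by
    have := intervalIntegral.integral_comp_sub_left (a := 0) (b := 1) (fun x : ℝ => x^(M-1) * (x+l)^(-(N:ℝ))) 1
    rw [intervalIntegral.integral_of_le zero_le_one, integral_Ioc_eq_integral_Ioo] at this
    rw [this, sub_self, sub_zero, intervalIntegral.integral_of_le zero_le_one]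
    refine le_trans ?_ g2
    apply setIntegral_mono_set g1
    · filter_upwards [ae_restrict_mem measurableSet_Ioi] with x hx
      have : (0:ℝ) < x := hx
      show 0 ≤ _
      positivity
    · exact HasSubset.Subset.eventuallyLE (fun x hx => hx.1)
  have key : ∀ z ∈ Ioo (0:ℝ) 1, z^(s-1) * (1-z)^(M-1) * ((1-z+l)^N)⁻¹ ≤
      2^N * (z^(s-1) * (1-z)^(M-1)) + 2 * ((1-z)^(M-1) * (1-z+l)^(-(N:ℝ))) := by
    intro z hz
    have h0 := hz.1
    have h1 : 0 < 1 - z := by linarith [hz.2]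
    have e : (1-z+l)^(-(N:ℝ)) = ((1-z+l)^N)⁻¹ := by rw [rpow_neg lnn, rpow_natCast]
    rw [e]
    have hl1 : 0 < 1 - z + l := by linarith
    rcases le_total z (1/2) with h | h
    · have : ((1-z+l)^N)⁻¹ ≤ 2^N := by
        rw [← inv_pow]; gcongr
        rw [inv_le_comm₀ hl1 nmm]; linarith
      have h2 : z^(s-1) * (1-z)^(M-1) * ((1-z+l)^N)⁻¹ ≤ z^(s-1) * (1-z)^(M-1) * 2^N := by gcongr
      have h3 : 0 ≤ 2 * ((1-z)^(M-1) * ((1-z+l)^N)⁻¹) := by positivity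
      linarith
    · have : z^(s-1) ≤ 2 := by
        calc z^(s-1) ≤ z^(-1:ℝ) := rpow_le_rpow_of_exponent_ge h0 hz.2.le lnn
          _ = z⁻¹ := rpow_neg_one z
          _ ≤ 2 := by rw [inv_le_comm₀ h0 nmm]; linarith
      have h2 : z^(s-1) * ((1-z)^(M-1) * ((1-z+l)^N)⁻¹) ≤ 2 * ((1-z)^(M-1) * ((1-z+l)^N)⁻¹) := by gcongr
      have h3 : 0 ≤ 2^N * (z^(s-1) * (1-z)^(M-1)) := by positivity
      linarith
  have hint := (b1.const_mul (2^N)).add (g4.const_mul 2)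
  have hI : IntegrableOn (fun z : ℝ => z^(s-1) * (1-z)^(M-1) * ((1-z+l)^N)⁻¹) (Ioo 0 1) := by
    refine Integrable.mono' hint fpp ?_
    filter_upwards [ae_restrict_mem measurableSet_Ioo] with z hz
    have h0 := hz.1
    have h1 : 0 < 1 - z := by linarith [hz.2]
    have hl1 : 0 < 1 - z + l := by linarith
    rw [Real.norm_eq_abs, abs_of_nonneg pvv]
    exact key z hz
  refine ⟨hI, (setIntegral_mono_on hI hint measurableSet_Ioo key).trans ?_⟩
  simp only [Pi.add_apply]
  rw [integral_add (b1.const_mul (2^N)) (g4.const_mul 2), integral_const_mul, integral_const_mul, b2]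
  have hl3 : 1 ≤ 2^((N:ℝ)-M) * l^(M-N) := by
    rw [show M - N = -((N:ℝ)-M) by ring, rpow_neg hl.le, ← div_eq_mul_inv, ← div_rpow nmm hl.le]
    apply one_le_rpow _ hNM.le
    rw [le_div_iff₀ hl]; linarith
  calc _ ≤ 2^N * Bt s M * 1 + 2 * ((1/M + 1/((N:ℝ)-M)) * l^(M-N)) := by rw [mul_one]; gcongr
    _ ≤ 2^N * Bt s M * (2^((N:ℝ)-M) * l^(M-N)) + 2 * ((1/M + 1/((N:ℝ)-M)) * l^(M-N)) := by gcongr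
    _ = _ := by ring
lemma pw {a b c' : ℝ} (ha : -1 < a) (hb : -(1/2) < b) (hc : 0 < c') (hc1 : c' < 1) : ∃ C : ℝ, 0 ≤ C ∧
    ∀ (Φ : ℂ → ℂ) (c : ℕ → ℂ) (V : Set ℂ) (l Q : ℝ),
    IsOpen V → DifferentiableOn ℂ Φ V → 0 < l → l ≤ 2 → 0 ≤ Q → Metric.ball 0 1 ⊆ V →
    (∀ z : ℝ, 0 ≤ z → z < 1 → Metric.ball (z:ℂ) (c' * (1-z+l)) ⊆ V) →
    (∀ z : ℝ, 0 ≤ z → z < 1 → ∀ w ∈ Metric.ball (z:ℂ) (c' * (1-z+l)), ‖Φ w‖ ≤ Q) →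
    (∀ z : ℂ, ‖z‖ < 1 → HasSum (fun m => c m * z^m) (Φ z)) → Summable (fun m => kap a b m * ‖c m‖) →
    ‖∑' m, (kap a b m : ℂ) * c m‖ ≤ C * Q * l^(-(a+1)) := by
  set N := ⌊a+1⌋₊ + 1 with hN
  set M : ℝ := N - (a+1) with hMdef
  have hM : 0 < M := by have := Nat.lt_floor_add_one (a+1); rw [hMdef, hN]; push_cast; linarith
  have hMN : M < N := by linarith
  set s := a+b+2 with hsdef
  have hs : 1/2 < s := by linarith
  have hs0 : 0 < s := by linarith
  obtain ⟨C1, hC1, H1⟩ := gI_bound hs hM hMN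
  obtain ⟨B, hB, H2⟩ := Phi_bound hb hc hc1 N
  have hpb := poch_pos (show 0 < b+1 by linarith) N
  have hBt := Bt_pos hs0 hM
  refine ⟨(poch (b+1) N * Bt s M)⁻¹ * (B * C1), by positivity, ?_⟩
  intro Φ c V l Q hV hd hl hl2 hQ hV1 hsub hQb hsum hsm
  have hkap : ∀ m, (poch (b+1) N * Bt s M) * kap a b m = Bt (s+m) M * poch (b+1+m) N := by
    intro m
    have e1 := Bt_add hs0 hM m 0
    rw [Nat.cast_zero, add_zero, poch_zero, add_zero, mul_one, show s + M = b+1+N by rw [hsdef, hMdef]; ring] at e1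
    rw [e1]
    have e2 := poch_add (b+1) m N
    rw [add_comm m N, poch_add (b+1) N m] at e2
    unfold kap
    have h1 := (poch_pos (show 0 < b+1 by linarith) m).ne'
    have h2 := (poch_pos (show 0 < b+1+N by have : (0:ℝ) ≤ N := Nat.cast_nonneg N; linarith) m).ne'
    rw [← hsdef]
    field_simp
    linear_combination (poch s m) * e2
  have hi : ∀ m : ℕ, ∫ z in Ioo (0:ℝ) 1, z^(s+m-1) * (1-z)^(M-1) = Bt (s+m) M := fun m =>
    (beta_int pvv hM).2
  have hii : ∀ m : ℕ, IntegrableOn (fun z : ℝ => z^(s+m-1) * (1-z)^(M-1)) (Ioo 0 1) := fun m =>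
    (beta_int pvv hM).1
  set F : ℕ → ℝ → ℂ := fun m z => ((z^(s+m-1) * (1-z)^(M-1) : ℝ):ℂ) * ((poch (b+1+m) N : ℂ) * c m) with hF
  have hFi : ∀ m, Integrable (F m) (volume.restrict (Ioo 0 1)) := fun m => ((hii m).ofReal (𝕜 := ℂ)).mul_const _
  have hpp : ∀ m : ℕ, 0 < poch (b+1+m) N := fun m => poch_pos (by have : (0:ℝ) ≤ m := Nat.cast_nonneg m; linarith) N
  have hFint : ∀ m, ∫ z in Ioo (0:ℝ) 1, F m z = ((poch (b+1) N * Bt s M : ℝ):ℂ) * ((kap a b m : ℂ) * c m) := by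
    intro m
    have h5 : ∫ z in Ioo (0:ℝ) 1, ((z^(s+m-1) * (1-z)^(M-1) : ℝ):ℂ) = ((∫ z in Ioo (0:ℝ) 1, z^(s+m-1) * (1-z)^(M-1) : ℝ):ℂ) :=
      integral_ofReal
    rw [hF]; simp only []
    rw [integral_mul_const, h5, hi, ← mul_assoc, ← mul_assoc]
    have := congrArg (fun x : ℝ => (x:ℂ)) (hkap m)
    simp only [Complex.ofReal_mul] at this ⊢
    rw [this]
  have hFn : ∀ m, ∫ z in Ioo (0:ℝ) 1, ‖F m z‖ = (poch (b+1) N * Bt s M) * (kap a b m * ‖c m‖) := by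
    intro m
    have : ∀ z ∈ Ioo (0:ℝ) 1, ‖F m z‖ = (z^(s+m-1) * (1-z)^(M-1)) * (poch (b+1+m) N * ‖c m‖) := by
      intro z hz
      have h0 := hz.1
      have h1 : 0 < 1 - z := by linarith [hz.2]
      rw [hF]; simp only [norm_mul, Complex.norm_real, Real.norm_eq_abs]
      rw [abs_of_pos (hpp m), ← abs_mul, abs_of_nonneg pvv]
    rw [setIntegral_congr_fun measurableSet_Ioo this, integral_mul_const, hi, ← mul_assoc, ← mul_assoc, hkap]
  have hS : Summable (fun m => ∫ z in Ioo (0:ℝ) 1, ‖F m z‖) := by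
    simp only [hFn]; exact hsm.mul_left _
  have hsumI := hasSum_integral_of_summable_integral_norm hFi hS
  have hpt : ∀ z ∈ Ioo (0:ℝ) 1, ∑' m, F m z = ((z^(s-1) * (1-z)^(M-1) : ℝ):ℂ) * Phi b Φ N z := by
    intro z hz
    have h0 := hz.1
    have hz1 : ‖(z:ℂ)‖ < 1 := by rw [Complex.norm_real, Real.norm_eq_abs, abs_of_pos h0]; exact hz.2
    have := (Phi_hasSum b (hd.mono hV1) hsum N z hz1).mul_left ((z^(s-1) * (1-z)^(M-1) : ℝ):ℂ)
    refine HasSum.tsum_eq (hs_congr this ?_ rfl)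
    intro m
    rw [hF]; simp only []
    rw [show s+m-1 = (s-1)+m by ring, rpow_add h0, rpow_natCast]
    push_cast; ring
  rw [setIntegral_congr_fun measurableSet_Ioo hpt] at hsumI
  simp only [hFint] at hsumI
  have h6 := hsumI.tsum_eq
  rw [tsum_mul_left] at h6
  obtain ⟨G1, G2⟩ := H1 l hl hl2
  have h7 : ‖∫ z in Ioo (0:ℝ) 1, ((z^(s-1) * (1-z)^(M-1) : ℝ):ℂ) * Phi b Φ N z‖ ≤ B * Q * (C1 * l^(M-N)) := by
    refine (norm_integral_le_of_norm_le (G1.const_mul (B*Q)) ?_).trans ?_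
    · filter_upwards [ae_restrict_mem measurableSet_Ioo] with z hz
      have h0 := hz.1
      have h1 : 0 < 1 - z := by linarith [hz.2]
      have := H2 Φ V l Q hV hd hl hl2 hQ hsub hQb z h0.le hz.2 z (Metric.mem_ball_self pvv)
      rw [norm_mul, Complex.norm_real, Real.norm_eq_abs, abs_of_nonneg pvv]
      calc _ ≤ z^(s-1) * (1-z)^(M-1) * (B * Q * ((1-z+l)^N)⁻¹) := by gcongr
        _ = _ := by ring
    · rw [integral_const_mul]; gcongr
  rw [← h6, norm_mul, Complex.norm_real, Real.norm_eq_abs, abs_of_pos pvv, show M - N = -(a+1) by rw [hMdef]; ring] at h7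
  calc _ = (poch (b+1) N * Bt s M)⁻¹ * ((poch (b+1) N * Bt s M) * ‖∑' m, (kap a b m : ℂ) * c m‖) := by field_simp
    _ ≤ (poch (b+1) N * Bt s M)⁻¹ * (B * Q * (C1 * l^(-(a+1)))) := by gcongr
    _ = _ := by ring
lemma cm_hasSum (a : ℝ) {K u : ℂ} (hK : ‖K‖ < 1) (hu : ‖u‖ < 1) {Z : ℕ → ℝ} (hZ : SE Z) {Zg : ℂ → ℂ}
    (hg : ∀ v : ℂ, ‖v‖ < 1 → HasSum (fun k => (Z k : ℂ) * v^k) (Zg v)) (z : ℂ) (hz : ‖z‖ < 1) :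
    HasSum (fun m => cmC a K u Z m * z^m) ((1-K*z)^(-((a+2:ℝ):ℂ)) * Zg (u*z)) := by
  have hKz : ‖K*z‖ < 1 := by rw [norm_mul]; exact mul_lt_one_of_nonneg_of_lt_one_left (norm_nonneg _) hK hz.le
  have huz : ‖u*z‖ < 1 := by rw [norm_mul]; exact mul_lt_one_of_nonneg_of_lt_one_left (norm_nonneg _) hu hz.le
  have h1 := hg _ huz
  have h2 := hasSum_bn (a+2) hKz
  have s1 : Summable (fun k => ‖(Z k : ℂ) * (u*z)^k‖) := by
    refine (hZ ‖u*z‖ (norm_nonneg _) huz).congr fun k => ?_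
    simp only [norm_mul, norm_pow, Complex.norm_real, Real.norm_eq_abs]
  have s2 : Summable (fun k => ‖(bn (a+2) k : ℂ) * (K*z)^k‖) := by
    refine (SE_bn (a+2) ‖K*z‖ (norm_nonneg _) hKz).congr fun k => ?_
    simp only [norm_mul, norm_pow, Complex.norm_real, Real.norm_eq_abs]
  set f1 : ℕ → ℂ := fun k => (Z k : ℂ) * (u*z)^k with hf1
  set f2 : ℕ → ℂ := fun k => (bn (a+2) k : ℂ) * (K*z)^k with hf2
  have hs12 : Summable (fun p : ℕ × ℕ => f1 p.1 * f2 p.2) :=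
    summable_mul_of_summable_norm (f := f1) (g := f2) s1 s2
  have h3 := hasSum_antidiag (f := fun i j => f1 i * f2 j) hs12 (fun i => h2.mul_left (f1 i)) (h1.mul_right _)
  refine hs_congr h3 ?_ (mul_comm _ _)
  intro m
  unfold cmC
  rw [Finset.sum_mul]
  refine Finset.sum_congr rfl ?_
  rintro ⟨i, j⟩ hp
  have hkm : i + j = m := by simpa using hp
  simp only [hf1, hf2, ← hkm, pow_add, mul_pow]; ring
lemma slit_pert {A B : ℂ} (hA : 0 < A.re) (hB : ‖B‖ ≤ ‖A‖/2) : A - B ∈ Complex.slitPlane := by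
  by_contra h
  rw [Complex.mem_slitPlane_iff, not_or, not_lt, not_not] at h
  obtain ⟨h1, h2⟩ := h
  have hB2 : ‖B‖^2 ≤ ‖A‖^2/4 := by nlinarith [norm_nonneg A, norm_nonneg B]
  rw [← Complex.normSq_eq_norm_sq, ← Complex.normSq_eq_norm_sq, Complex.normSq_apply, Complex.normSq_apply] at hB2
  simp only [Complex.sub_re, Complex.sub_im] at h1 h2
  have h3 : B.im = A.im := by linarith
  rw [h3] at hB2
  nlinarith [mul_self_nonneg A.im]
lemma one_sub_lower {α : ℂ} (hα : ‖α‖ ≤ 1) {z : ℝ} (h0 : 0 ≤ z) (h1 : z < 1) :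
    (1 - z + ‖1-α‖)/3 ≤ ‖1 - α*z‖ ∧ 0 < (1-α*z).re := by
  have e1 : 1 - z ≤ ‖1-α*z‖ := by
    have h := norm_sub_norm_le (1:ℂ) (α*z)
    rw [norm_one, norm_mul, Complex.norm_real, Real.norm_eq_abs, abs_of_nonneg h0] at h
    nlinarith [norm_nonneg α]
  have e2 : ‖1-α‖ - (1-z) ≤ ‖1-α*z‖ := by
    have h := norm_sub_norm_le (1-α) (-(α*(1-z:ℝ)))
    rw [norm_neg, norm_mul, Complex.norm_real, Real.norm_eq_abs, abs_of_nonneg (by linarith : 0 ≤ 1-z)] at h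
    have e3 : (1-α) - -(α*(1-z:ℝ)) = 1 - α*z := by push_cast; ring
    rw [e3] at h
    nlinarith [norm_nonneg α]
  refine ⟨by linarith, ?_⟩
  have := (Complex.abs_re_le_norm (α*z))
  rw [norm_mul, Complex.norm_real, Real.norm_eq_abs z, abs_of_nonneg h0] at this
  have h4 := le_abs_self (α*z).re
  simp only [Complex.sub_re, Complex.one_re]
  nlinarith [norm_nonneg α]
/-- perturbation -/
lemma one_sub_pert {α : ℂ} (hα : ‖α‖ ≤ 1) {z c0 l : ℝ} (hc0 : 0 < c0) (hc1 : c0 ≤ 1) (h0 : 0 ≤ z) (h1 : z < 1) (hl : c0 * l ≤ ‖1-α‖)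
    {w : ℂ} (hw : w ∈ Metric.ball (z:ℂ) (c0/6*(1-z+l))) :
    1 - α*w ∈ Complex.slitPlane ∧ (1-z+‖1-α‖)/6 ≤ ‖1-α*w‖ := by
  obtain ⟨e1, e2⟩ := one_sub_lower hα h0 h1
  rw [Metric.mem_ball, dist_eq_norm] at hw
  have e3 : 1 - α*w = (1-α*z) - α*(w-z) := by ring
  have e4 : ‖α*(w-z)‖ ≤ ‖1-α*z‖/2 := by
    rw [norm_mul]
    nlinarith [norm_nonneg α, norm_nonneg (w-z)]
  refine ⟨e3 ▸ slit_pert e2 e4, ?_⟩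
  rw [e3]
  have := norm_sub_norm_le (1-α*z) (α*(w-z))
  linarith
lemma core {a b c0 : ℝ} (ha : -1 < a) (hb : -(1/2) < b) (hc0 : 0 < c0) (hc1 : c0 ≤ 1) : ∃ C : ℝ, 0 ≤ C ∧
    ∀ (K u : ℂ) (Z : ℕ → ℝ) (Zg : ℂ → ℂ) (V : Set ℂ) (Q : ℝ), ‖K‖ < 1 → ‖u‖ < 1 → SE Z →
    (∀ v : ℂ, ‖v‖ < 1 → HasSum (fun k => (Z k : ℂ) * v^k) (Zg v)) → IsOpen V →
    DifferentiableOn ℂ (fun z => Zg (u*z)) V → 0 ≤ Q → Metric.ball 0 1 ⊆ V →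
    (∀ z : ℝ, 0 ≤ z → z < 1 → Metric.ball (z:ℂ) (c0/6 * (1-z+‖1-K‖)) ⊆ V) →
    (∀ z : ℝ, 0 ≤ z → z < 1 → ∀ w ∈ Metric.ball (z:ℂ) (c0/6 * (1-z+‖1-K‖)),
      (1-z+‖1-K‖)^(-(a+2)) * ‖Zg (u*w)‖ ≤ Q) →
    ‖∑' m, (kap a b m : ℂ) * cmC a K u Z m‖ ≤ C * Q * ‖1-K‖^(-(a+1)) := by
  obtain ⟨C, hC, H⟩ := pw (a := a) (b := b) (c' := c0/6) ha hb lnn lnn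
  refine ⟨C * 6^(a+2), by positivity, ?_⟩
  intro K u Z Zg V Q hK hu hZ hg hV hd hQ hV1 hsub hb1
  have hl : 0 < ‖1-K‖ := by
    rw [norm_pos_iff, sub_ne_zero]; rintro rfl; simp at hK
  have hl2 : ‖1-K‖ ≤ 2 := by
    have := norm_sub_le (1:ℂ) K; rw [norm_one] at this; linarith
  set V2 := V ∩ (fun z : ℂ => 1 - K*z) ⁻¹' Complex.slitPlane with hV2
  have pert := fun (z : ℝ) (h0 : 0 ≤ z) (h1 : z < 1) (w : ℂ) (hw : w ∈ Metric.ball (z:ℂ) (c0/6 * (1-z+‖1-K‖))) =>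
    one_sub_pert hK.le hc0 hc1 h0 h1 (l := ‖1-K‖) (by nlinarith) hw
  have := H (fun z => (1-K*z)^(-((a+2:ℝ):ℂ)) * Zg (u*z)) (cmC a K u Z) V2 ‖1-K‖ (6^(a+2)*Q)
    (hV.inter (Complex.isOpen_slitPlane.preimage fpp)) ?_ hl hl2 pvv ?_ ?_ ?_
    (cm_hasSum a hK hu hZ hg) ?_
  · refine this.trans (le_of_eq (by ring))
  · apply DifferentiableOn.mul _ (hd.mono inter_subset_left)
    intro z hz
    have hz2 : 1 - K*z ∈ Complex.slitPlane := hz.2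
    have d1 : DifferentiableAt ℂ (fun z : ℂ => 1 - K*z) z := by fun_prop
    exact (d1.cpow (differentiableAt_const _) hz2).differentiableWithinAt
  · intro z hz
    refine ⟨hV1 hz, slit_of_norm ?_⟩
    have hz : ‖z‖ < 1 := by simpa using hz
    rw [norm_mul]; nlinarith [norm_nonneg K, norm_nonneg z]
  · intro z h0 h1 w hw
    exact ⟨hsub z h0 h1 hw, (pert z h0 h1 w hw).1⟩
  · intro z h0 h1 w hw
    have h2 := (pert z h0 h1 w hw).2
    have hx : 0 < 1-z+‖1-K‖ := by linarith
    have e : ‖(1-K*w)^(-((a+2:ℝ):ℂ))‖ ≤ 6^(a+2) * (1-z+‖1-K‖)^(-(a+2)) := by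
      rw [← Complex.ofReal_neg, Complex.norm_cpow_real]
      refine (rpow_le_rpow_of_nonpos pvv h2 lnn).trans (le_of_eq ?_)
      rw [div_rpow hx.le nmm, rpow_neg (by norm_num : (0:ℝ) ≤ 6), div_inv_eq_mul, mul_comm]
    rw [norm_mul]
    calc _ ≤ 6^(a+2) * (1-z+‖1-K‖)^(-(a+2)) * ‖Zg (u*w)‖ := by gcongr
      _ ≤ 6^(a+2) * Q := by rw [mul_assoc]; gcongr; exact hb1 z h0 h1 w hw
  · set q := max ‖K‖ ‖u‖
    have hq1 : q < 1 := max_lt hK hu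
    refine Summable.of_nonneg_of_le (fun m => mul_nonneg (kap_nonneg ha hb m) (norm_nonneg _)) (fun m => ?_)
      (maj_summable ha hb hZ (q := q) ((norm_nonneg K).trans (le_max_left _ _)) hq1)
    exact mul_le_mul_of_nonneg_left (cmC_le Z (le_max_left _ _) (le_max_right _ _) m) (kap_nonneg ha hb m)
lemma SE_d0 : SE d0 := by
  intro ρ h0 h1
  refine summable_of_ne_finset_zero (s := {0}) ?_
  intro n hn
  simp [d0] at hn ⊢
  simp [hn]
lemma sum_d0 {a b : ℝ} (ha : -1 < a) (hb : -(1/2) < b) : ∃ C : ℝ, 0 ≤ C ∧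
    ∀ (K u : ℂ), ‖K‖ < 1 → ‖u‖ < 1 → ‖∑' m, (kap a b m : ℂ) * cmC a K u d0 m‖ ≤ C * ‖1-K‖^(-(2*a+3)) := by
  obtain ⟨C, hC, H⟩ := core (c0 := 1) ha hb one_pos le_rfl
  refine ⟨C, hC, fun K u hK hu => ?_⟩
  have hl : 0 < ‖1-K‖ := by
    rw [norm_pos_iff, sub_ne_zero]; rintro rfl; simp at hK
  have := H K u d0 (fun _ => 1) univ (‖1-K‖^(-(a+2))) hK hu SE_d0 ?_ isOpen_univ fpp pvv
    (subset_univ _) (fun _ _ _ => subset_univ _) ?_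
  · refine this.trans (le_of_eq ?_)
    rw [mul_assoc, ← rpow_add hl]; congr 2; ring
  · intro v hv
    refine hs_congr (hasSum_ite_eq 0 (1:ℂ)) ?_ rfl
    intro n
    by_cases h : n = 0 <;> simp [d0, h]
  · intro z h0 h1 w hw
    rw [norm_one, mul_one]
    exact rpow_le_rpow_of_nonpos hl lnn lnn
set_option maxHeartbeats 1000000 in
lemma sum_Z {a b c0 : ℝ} (ha : -1 < a) (hb : -(1/2) < b) (hc0 : 0 < c0) (hc1 : c0 ≤ 1) : ∃ C : ℝ, 0 ≤ C ∧
    ∀ (K u : ℂ) (t T D : ℝ), ‖K‖ < 1 → ‖u‖ < 1 → t^2 ≤ 1 → ‖1-K‖ ≤ 2*T → ‖1-u‖ ≤ 2*T → c0 * ‖1-K‖ ≤ D →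
    D ≤ ‖1 - u * wt1 t‖ → D ≤ ‖1 - u * (starRingEnd ℂ) (wt1 t)‖ →
    ‖∑' m, (kap a b m : ℂ) * cmC a K u (fun k => Zf b k t) m‖ ≤ C * (T * ‖1-K‖^(-(2*a+3)) * D^(-(2*(b+1)))) := by
  obtain ⟨C, hC, H⟩ := core (c0 := c0) ha hb hc0 hc1
  refine ⟨C * (32 * 6^(2*(b+1))), by positivity, fun K u t T D hK hu ht hKT huT hKD hD1 hD2 => ?_⟩
  have hl : 0 < ‖1-K‖ := by
    rw [norm_pos_iff, sub_ne_zero]; rintro rfl; simp at hK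
  have hD : 0 < D := lt_of_lt_of_le pvv hKD
  have hT : 0 < T := by linarith
  have n1 : ‖u * wt1 t‖ ≤ 1 := by rw [norm_mul, wt1_norm ht, mul_one]; exact hu.le
  have n2 : ‖u * (starRingEnd ℂ) (wt1 t)‖ ≤ 1 := by rw [norm_mul, RCLike.norm_conj, wt1_norm ht, mul_one]; exact hu.le
  have q1 : ∀ z w : ℂ, u*z*w = u*w*z := fun z w => by ring
  set V := (fun z : ℂ => 1 - u * wt1 t * z) ⁻¹' Complex.slitPlane ∩ (fun z : ℂ => 1 - u * (starRingEnd ℂ) (wt1 t) * z) ⁻¹' Complex.slitPlane with hV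
  have := H K u (fun k => Zf b k t) (Zgen b t) V (32*6^(2*(b+1)) * (T * ‖1-K‖^(-(a+2)) * D^(-(2*(b+1))))) hK hu (SE_Z hb ht)
    (fun v hv => Z_hasSum hb ht hv)
    ((Complex.isOpen_slitPlane.preimage fpp).inter (Complex.isOpen_slitPlane.preimage fpp)) ?_ pvv ?_ ?_ ?_
  · refine this.trans (le_of_eq ?_)
    rw [show -(2*a+3) = -(a+2) + -(a+1) by ring, rpow_add hl]; ring
  · intro z hz
    apply DifferentiableAt.differentiableWithinAt
    unfold Zgen
    refine DifferentiableAt.mul (DifferentiableAt.mul fpp ?_) ?_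
    · exact DifferentiableAt.cpow fpp fpp (by rw [q1]; exact hz.1)
    · exact DifferentiableAt.cpow fpp fpp (by rw [q1]; exact hz.2)
  · intro z hz
    have hz : ‖z‖ < 1 := by simpa using hz
    constructor
    · refine slit_of_norm ?_
      rw [norm_mul]; nlinarith [norm_nonneg (u * wt1 t), norm_nonneg z]
    · refine slit_of_norm ?_
      rw [norm_mul]; nlinarith [norm_nonneg (u * (starRingEnd ℂ) (wt1 t)), norm_nonneg z]
  · intro z h0 h1 w hw
    exact ⟨(one_sub_pert n1 hc0 hc1 h0 h1 (hKD.trans hD1) hw).1, (one_sub_pert n2 hc0 hc1 h0 h1 (hKD.trans hD2) hw).1⟩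
  · intro z h0 h1 w hw
    have p1 := (one_sub_pert n1 hc0 hc1 h0 h1 (hKD.trans hD1) hw).2
    have p2 := (one_sub_pert n2 hc0 hc1 h0 h1 (hKD.trans hD2) hw).2
    rw [Metric.mem_ball, dist_eq_norm] at hw
    set x := 1 - z with hx
    set l := ‖1-K‖ with hldef
    have hx0 : 0 < x := by linarith
    have hl2 : l ≤ 2 := by
      have := norm_sub_le (1:ℂ) K; rw [norm_one] at this; linarith
    have hcp : ∀ A : ℂ, D/6 ≤ ‖A‖ → ‖A^(-((b+1:ℝ):ℂ))‖ ≤ 6^(b+1) * D^(-(b+1)) := by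
      intro A hA
      rw [← Complex.ofReal_neg, Complex.norm_cpow_real]
      refine (rpow_le_rpow_of_nonpos pvv hA lnn).trans (le_of_eq ?_)
      rw [div_rpow hD.le nmm, rpow_neg (by norm_num : (0:ℝ) ≤ 6), div_inv_eq_mul, mul_comm]
    have c1 := hcp (1 - u*w*wt1 t) (by rw [q1]; linarith)
    have c2 := hcp (1 - u*w*(starRingEnd ℂ) (wt1 t)) (by rw [q1]; linarith)
    have hwz : ‖w - z‖ ≤ x + l := by nlinarith
    have hw1 : ‖1 - w‖ ≤ 2*x + l := by
      have := norm_sub_le ((1-z:ℝ):ℂ) (w-z)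
      rw [Complex.norm_real, Real.norm_eq_abs, abs_of_nonneg (by linarith : 0 ≤ 1-z)] at this
      have e : ((1-z:ℝ):ℂ) - (w-z) = 1 - w := by push_cast; ring
      rw [e] at this; linarith
    have huw : ‖1 - u*w‖ ≤ 4*T + 2*x := by
      have := norm_add_le (1-u) (u*(1-w))
      have e : (1-u) + u*(1-w) = 1 - u*w := by ring
      rw [e, norm_mul] at this
      have h5 : ‖u‖ * ‖1-w‖ ≤ 1 * (2*x+l) := mul_le_mul hu.le hw1 (norm_nonneg _) zero_le_one
      linarith
    have h3' : ‖1 - (u*w)^2‖ ≤ 16 * (T + x) := by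
      have e : 1 - (u*w)^2 = (1-u*w)*(1+u*w) := by ring
      rw [e, norm_mul]
      have huw3 : ‖1 + u*w‖ ≤ 4 := by
        have hw3 : ‖w‖ ≤ 3 := by
          have h5 : ‖w - z‖ ≤ 1/6*(x+l) := hw.le.trans (by gcongr)
          have := norm_add_le (w-z) (z:ℂ)
          rw [sub_add_cancel, Complex.norm_real, Real.norm_eq_abs, abs_of_nonneg h0] at this
          linarith
        have := norm_add_le 1 (u*w)
        rw [norm_one, norm_mul] at this
        have h5 : ‖u‖ * ‖w‖ ≤ 1 * 3 := mul_le_mul hu.le hw3 (norm_nonneg _) zero_le_one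
        linarith
      have h5 := mul_le_mul huw huw3 (norm_nonneg _) pvv
      linarith
    have h4 : (x+l)^(-(a+2)) * (T+x) ≤ 2*(T * l^(-(a+2))) := by
      have hxl : 0 < x + l := by linarith
      rw [show -(a+2) = -(a+1) - 1 by ring, rpow_sub_one hxl.ne', rpow_sub_one hl.ne']
      have h5 : (x+l)^(-(a+1)) ≤ l^(-(a+1)) := rpow_le_rpow_of_nonpos hl lnn lnn
      have h6 : (T+x)/(x+l) ≤ 2*T/l := by
        rw [div_le_div_iff₀ hxl hl]; nlinarith
      calc _ = (x+l)^(-(a+1)) * ((T+x)/(x+l)) := by ring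
        _ ≤ l^(-(a+1)) * (2*T/l) := by gcongr
        _ = _ := by ring
    unfold Zgen
    rw [norm_mul, norm_mul]
    calc (x+l)^(-(a+2)) * (‖1 - (u*w)^2‖ * ‖(1 - u*w*wt1 t)^(-((b+1:ℝ):ℂ))‖ * ‖(1 - u*w*(starRingEnd ℂ) (wt1 t))^(-((b+1:ℝ):ℂ))‖)
        ≤ (x+l)^(-(a+2)) * ((16 * (T+x)) * (6^(b+1) * D^(-(b+1))) * (6^(b+1) * D^(-(b+1)))) := by gcongr
      _ = 16 * ((x+l)^(-(a+2)) * (T+x)) * ((6^(b+1) * D^(-(b+1))) * (6^(b+1) * D^(-(b+1)))) := by ring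
      _ ≤ 16 * (2*(T * l^(-(a+2)))) * ((6^(b+1) * D^(-(b+1))) * (6^(b+1) * D^(-(b+1)))) := by gcongr
      _ = _ := by
        have g1 : (6:ℝ)^(2*(b+1)) = 6^(b+1) * 6^(b+1) := by rw [← rpow_add nmm]; congr 1; ring
        have g2 : D^(-(2*(b+1))) = D^(-(b+1)) * D^(-(b+1)) := by rw [← rpow_add hD]; congr 1; ring
        rw [g1, g2]; ring
lemma one_add_pp {r : ℂ} (hr : ‖r‖ < 1) : (1 + pp r) * (1 + r) = 2 := by
  have e2 := one_add_ne hr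
  unfold pp; field_simp; ring
lemma one_sub_r {r : ℂ} (hr : ‖r‖ < 1) : 1 - r = pp r * (1 + r) := by
  have e2 := one_add_ne hr
  unfold pp; field_simp
lemma norm_one_sub_r {r : ℂ} (hr : ‖r‖ < 1) : ‖1 - r‖ ≤ 2 * ‖pp r‖ := by
  rw [one_sub_r hr, norm_mul]
  have := norm_add_le 1 r
  rw [norm_one] at this
  nlinarith [norm_nonneg (pp r)]
lemma S_norm_sq {X : ℝ} (h0 : 0 ≤ X) (h1 : X ≤ 1) (r : ℂ) : ‖SS X r‖^2 ≤ (1-X) + X * ‖pp r‖^2 := by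
  rw [← norm_pow, SS_sq]
  refine (norm_add_le _ _).trans (le_of_eq ?_)
  rw [norm_mul, norm_pow, Complex.norm_real, Complex.norm_real, Real.norm_eq_abs, Real.norm_eq_abs, abs_of_nonneg h0, abs_of_nonneg lnn]
lemma S_norm {X : ℝ} (h0 : 0 ≤ X) (h1 : X ≤ 1) (r : ℂ) : ‖SS X r‖ ≤ √(1-X) + ‖pp r‖ := by
  apply abs_le_of_sq_le_sq' _ pvv |>.2
  have := S_norm_sq h0 h1 r
  have h2 := sq_sqrt (show 0 ≤ 1-X by linarith)
  nlinarith [sqrt_nonneg (1-X), norm_nonneg (pp r), sq_nonneg (‖pp r‖)]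
lemma one_add_S_le {X : ℝ} (h0 : 0 ≤ X) (h1 : X ≤ 1) {r : ℂ} (hp : ‖pp r‖ < 1/8) : ‖1 + SS X r‖ ≤ 2 := by
  have := S_norm_sq h0 h1 r
  have h3 := norm_add_le 1 (SS X r)
  rw [norm_one] at h3
  have hq : ‖pp r‖^2 ≤ 1 := by nlinarith [norm_nonneg (pp r)]
  have h4 : ‖SS X r‖^2 ≤ 1 := by nlinarith [mul_le_of_le_one_right h0 hq]
  have := abs_le_of_sq_le_sq' (by linarith : ‖SS X r‖^2 ≤ 1^2) zero_le_one
  linarith [this.2]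
lemma one_add_S_ge {X : ℝ} (h0 : 0 ≤ X) (h1 : X ≤ 1) {r : ℂ} (hr : ‖r‖ < 1) : 1 ≤ ‖1 + SS X r‖ := by
  have := one_add_SS_re h0 h1 hr
  exact this.le.trans ((le_abs_self _).trans (Complex.abs_re_le_norm _))
lemma one_sub_KK {X : ℝ} (h0 : 0 ≤ X) (h1 : X ≤ 1) {r : ℂ} (hr : ‖r‖ < 1) (hp : ‖pp r‖ < 1/8) :
    ‖SS X r‖ ≤ ‖1 - KK X r‖ ∧ ‖1 - KK X r‖ ≤ 2 * ‖SS X r‖ := by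
  have e := one_add_SS_ne h0 h1 hr
  have : 1 - KK X r = 2 * SS X r / (1 + SS X r) := by unfold KK; field_simp; ring
  have u := one_add_S_le h0 h1 hp
  have l := one_add_S_ge h0 h1 hr
  rw [this, norm_div, norm_mul, Complex.norm_ofNat]
  constructor
  · rw [le_div_iff₀ lnn]; nlinarith [norm_nonneg (SS X r)]
  · exact div_le_self pvv l
lemma one_sub_UU {X : ℝ} (h0 : 0 ≤ X) (h1 : X ≤ 1) {r : ℂ} (hr : ‖r‖ < 1) :
    ‖1 - UU X r‖ ≤ 2 * (√(1-X) + ‖pp r‖) := by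
  have e := one_add_SS_ne h0 h1 hr
  have : 1 - UU X r = ((1-√X:ℝ) + SS X r + (√X:ℝ) * pp r) / (1 + SS X r) := by unfold UU; field_simp; push_cast; ring
  have l := one_add_S_ge h0 h1 hr
  rw [this, norm_div]
  refine (div_le_self (norm_nonneg _) l).trans ?_
  have n1 := norm_add₃_le (a := ((1-√X:ℝ):ℂ)) (b := SS X r) (c := (√X:ℝ) * pp r)
  have s1 : √X ≤ 1 := Real.sqrt_le_one.mpr h1
  have s0 := sqrt_nonneg X
  rw [norm_mul, Complex.norm_real, Complex.norm_real, Real.norm_eq_abs, Real.norm_eq_abs, abs_of_nonneg s0, abs_of_nonneg lnn] at n1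
  have n2 := S_norm h0 h1 r
  have n3 : 1 - √X ≤ √(1-X) := by
    apply Real.le_sqrt_of_sq_le
    nlinarith [sq_sqrt h0]
  nlinarith [norm_nonneg (pp r)]
lemma UU_far {X : ℝ} (h0 : 0 ≤ X) (h1 : X ≤ 1) {r : ℂ} (hr : ‖r‖ < 1) (hp : ‖pp r‖ < 1/8) (hs : 4 * ‖pp r‖ ≤ √(1-X)) :
    √(1-X)/5 ≤ 1 - ‖UU X r‖ := by
  set σ := √(1-X)
  have hσ : 0 ≤ σ := sqrt_nonneg _
  have hσ2 : σ^2 = 1 - X := sq_sqrt lnn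
  have u := one_add_S_le h0 h1 hp
  have l := one_add_S_ge h0 h1 hr
  have hsq := congrArg Complex.re (SS_sq X r)
  have hre := SS_re h0 h1 hr
  have e := one_add_SS_ne h0 h1 hr
  have hp2 : |((pp r)^2).re| ≤ ‖pp r‖^2 := by rw [← norm_pow]; exact Complex.abs_re_le_norm _
  rw [Complex.add_re, Complex.re_ofReal_mul, Complex.ofReal_re, pow_two, Complex.mul_re] at hsq
  have r1 : (0.9*σ) ≤ (SS X r).re := by
    apply abs_le_of_sq_le_sq' _ hre.le |>.2
    have := (abs_le.1 hp2).1
    have h7 : ‖pp r‖^2 ≤ σ^2/16 := by nlinarith [norm_nonneg (pp r)]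
    nlinarith [mul_self_nonneg (SS X r).im]
  have k1 : ‖KK X r‖^2 ≤ 1 - 0.9*σ := by
    unfold KK
    rw [norm_div, div_pow, div_le_iff₀ pvv]
    have u2 : ‖1 + SS X r‖^2 ≤ 4 := by nlinarith
    have e1 : ‖1 - SS X r‖^2 = ‖1 + SS X r‖^2 - 4 * (SS X r).re := by
      rw [← Complex.normSq_eq_norm_sq, ← Complex.normSq_eq_norm_sq, Complex.normSq_apply, Complex.normSq_apply]
      simp; ring
    rw [e1]
    nlinarith
  have k2 : ‖UU X r‖^2 ≤ ‖KK X r‖ := by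
    rw [← norm_pow, UU_sq h0 h1 hr, norm_mul]
    nlinarith [norm_nonneg (KK X r)]
  have n0 := norm_nonneg (UU X r)
  have n1 := UU_norm h0 h1 hr
  have k3 : (‖UU X r‖^2)^2 ≤ 1 - 0.9*σ := (pow_le_pow_left₀ pvv k2 2).trans k1
  set x := ‖UU X r‖
  nlinarith [sq_nonneg (x-1), sq_nonneg (x^2-1), mul_nonneg n0 (sq_nonneg (x-1))]
lemma D_far {X t : ℝ} (h0 : 0 ≤ X) (h1 : X ≤ 1) (ht : t^2 ≤ 1) {r : ℂ} (hr : ‖r‖ < 1) (hp : ‖pp r‖ < 1/8)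
    (hs : 4 * ‖pp r‖ ≤ √(1-X) ∨ 4 * (√(1-X) + ‖pp r‖) ≤ ‖1 - wt1 t‖) {w : ℂ} (hw : ‖w‖ = 1) (hw1 : ‖1-w‖ = ‖1 - wt1 t‖) :
    (√(1-X) + ‖pp r‖ + ‖1 - wt1 t‖)/50 ≤ ‖1 - UU X r * w‖ := by
  have a1 := one_sub_UU h0 h1 hr
  have a2 : ‖1 - wt1 t‖ - ‖1 - UU X r‖ ≤ ‖1 - UU X r * w‖ := by
    rw [← hw1]
    have := norm_sub_le (1 - UU X r * w) ((1-UU X r)*w)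
    rw [norm_mul, hw, mul_one] at this
    have e : (1 - UU X r * w) - ((1-UU X r)*w) = 1 - w := by ring
    rw [e] at this; linarith
  have hσ : 0 ≤ √(1-X) := sqrt_nonneg _
  rcases hs with hs | hs
  · have a3 := UU_far h0 h1 hr hp hs
    have a4 : 1 - ‖UU X r‖ ≤ ‖1 - UU X r * w‖ := by
      have := norm_sub_norm_le 1 (UU X r * w)
      rwa [norm_one, norm_mul, hw, mul_one] at this
    linarith
  · linarith [norm_nonneg (pp r)]
lemma wt1_conj (t : ℝ) : ‖1 - (starRingEnd ℂ) (wt1 t)‖ = ‖1 - wt1 t‖ := by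
  rw [← RCLike.norm_conj (1 - wt1 t), map_sub, map_one]
lemma Ft_pre {a b : ℝ} (ha : -1 < a) (hb : -(1/2) < b) {X : ℝ} (h0 : 0 ≤ X) (h1 : X ≤ 1) {r : ℂ} (hr : ‖r‖ < 1) (hp : ‖pp r‖ < 1/8) (Z : ℕ → ℝ) :
    ‖Ft a b Z X r‖ ≤ 2 * 2^(a+b+2) * ‖pp r‖ * ‖∑' m, (kap a b m : ℂ) * cmC a (KK X r) (UU X r) Z m‖ := by
  unfold Ft
  rw [norm_mul, norm_mul, norm_mul, Complex.norm_cpow_real, Complex.norm_cpow_real]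
  have h2 := norm_one_sub_r hr
  have h3 : ‖1 + pp r‖ ≤ 2 := by
    have := norm_add_le 1 (pp r); rw [norm_one] at this; linarith
  have h4 : ‖1 + pp r‖^(a+b+2) ≤ 2^(a+b+2) := rpow_le_rpow (norm_nonneg _) h3 lnn
  have h5 : ‖1 + SS X r‖^(-(a+b+2)) ≤ 1 := rpow_le_one_of_one_le_of_nonpos (one_add_S_ge h0 h1 hr) lnn
  calc _ ≤ (2 * ‖pp r‖) * (2^(a+b+2) * 1) * _ := by gcongr
    _ = _ := by ring
lemma S_pos {X : ℝ} (h0 : 0 ≤ X) (h1 : X ≤ 1) {r : ℂ} (hr : ‖r‖ < 1) : 0 < ‖SS X r‖ :=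
  (SS_re h0 h1 hr).trans_le ((le_abs_self _).trans (Complex.abs_re_le_norm _))
lemma pt_d0 {a b : ℝ} (ha : -1 < a) (hb : -(1/2) < b) : ∃ C : ℝ, 0 ≤ C ∧ ∀ (r : ℂ) (X : ℝ), ‖r‖ < 1 → ‖pp r‖ < 1/8 →
    0 ≤ X → X ≤ 1 → ‖Ft a b d0 X r‖ ≤ C * (‖pp r‖ * ‖SS X r‖^(-(2*a+3))) := by
  obtain ⟨C, hC, H⟩ := sum_d0 ha hb
  refine ⟨2 * 2^(a+b+2) * C, by positivity, fun r X hr hp h0 h1 => ?_⟩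
  refine (Ft_pre ha hb h0 h1 hr hp d0).trans ?_
  have h2 := H (KK X r) (UU X r) (KK_norm h0 h1 hr) (UU_norm h0 h1 hr)
  have h3 : ‖1-KK X r‖^(-(2*a+3)) ≤ ‖SS X r‖^(-(2*a+3)) :=
    rpow_le_rpow_of_nonpos (S_pos h0 h1 hr) (one_sub_KK h0 h1 hr hp).1 lnn
  calc _ ≤ 2 * 2^(a+b+2) * ‖pp r‖ * (C * ‖SS X r‖^(-(2*a+3))) := by
        gcongr; exact h2.trans (by gcongr)
    _ = _ := by ring
lemma pt_Z {a b : ℝ} (ha : -1 < a) (hb : -(1/2) < b) : ∃ C : ℝ, 0 ≤ C ∧ ∀ (r : ℂ) (X t : ℝ), ‖r‖ < 1 → ‖pp r‖ < 1/8 →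
    0 ≤ X → X ≤ 1 → t^2 ≤ 1 → (4 * ‖pp r‖ ≤ √(1-X) ∨ 4 * (√(1-X) + ‖pp r‖) ≤ ‖1 - wt1 t‖) →
    ‖Ft a b (fun k => Zf b k t) X r‖ ≤ C * (‖pp r‖ * ‖SS X r‖^(-(2*a+3)) *
      ((√(1-X) + ‖pp r‖) * (√(1-X) + ‖pp r‖ + ‖1 - wt1 t‖)^(-(2*(b+1))))) := by
  obtain ⟨C, hC, H⟩ := sum_Z (c0 := 1/100) ha hb nmm nmm
  refine ⟨2 * 2^(a+b+2) * C * 50^(2*(b+1)), by positivity, fun r X t hr hp h0 h1 ht hs => ?_⟩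
  refine (Ft_pre ha hb h0 h1 hr hp _).trans ?_
  set T := √(1-X) + ‖pp r‖ with hT
  set θ := ‖1 - wt1 t‖ with hθ
  have hSp := S_pos h0 h1 hr
  have hST := S_norm h0 h1 r
  have hT0 : 0 < T := hSp.trans_le hST
  have hθ0 : 0 ≤ θ := norm_nonneg _
  obtain ⟨k1, k2⟩ := one_sub_KK h0 h1 hr hp
  have h2 := H (KK X r) (UU X r) t T ((T+θ)/50) (KK_norm h0 h1 hr) (UU_norm h0 h1 hr) ht lnn
    (one_sub_UU h0 h1 hr) lnn (D_far h0 h1 ht hr hp hs (wt1_norm ht) rfl)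
    (D_far h0 h1 ht hr hp hs (by rw [RCLike.norm_conj, wt1_norm ht]) (wt1_conj t))
  have h3 : ‖1-KK X r‖^(-(2*a+3)) ≤ ‖SS X r‖^(-(2*a+3)) :=
    rpow_le_rpow_of_nonpos hSp k1 lnn
  have h4 : ((T+θ)/50)^(-(2*(b+1))) = 50^(2*(b+1)) * (T+θ)^(-(2*(b+1))) := by
    rw [div_rpow pvv nmm, rpow_neg (by norm_num : (0:ℝ) ≤ 50), div_inv_eq_mul, mul_comm]
  rw [h4] at h2
  calc _ ≤ 2 * 2^(a+b+2) * ‖pp r‖ * (C * (T * ‖SS X r‖^(-(2*a+3)) * (50^(2*(b+1)) * (T+θ)^(-(2*(b+1)))))) := by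
        gcongr; exact h2.trans (by gcongr)
    _ = _ := by ring
lemma pp_real_S {ρ : ℝ} (h0 : 0 ≤ ρ) (h1 : ρ < 1) : SS 1 (ρ:ℂ) = pp ρ ∧ KK 1 (ρ:ℂ) = ρ ∧ UU 1 (ρ:ℂ) = ρ := by
  have hr : ‖(ρ:ℂ)‖ < 1 := by rw [Complex.norm_real, Real.norm_eq_abs, abs_of_nonneg h0]; exact h1
  have e1 := SS_sq 1 (ρ:ℂ)
  have e2 := SS_re zero_le_one le_rfl hr
  have e3 := pp_re hr
  have hS : SS 1 (ρ:ℂ) = pp ρ := by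
    simp at e1
    rcases sq_eq_sq_iff_eq_or_eq_neg.1 e1 with h | h
    · exact h
    · rw [h, Complex.neg_re] at e2; linarith
  have e4 := one_add_pp hr
  have e5 := one_add_ne hr
  have e6 : 1 + pp (ρ:ℂ) ≠ 0 := by intro h; rw [h] at e4; simp at e4
  have e7 : (ρ:ℂ) = (1 - pp ρ)/(1+pp ρ) := by
    rw [eq_div_iff e6]; linear_combination e4
  refine ⟨hS, ?_, ?_⟩
  · unfold KK; rw [hS]; exact e7.symm
  · unfold UU; rw [hS, Real.sqrt_one, Complex.ofReal_one, one_mul]; exact e7.symm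
lemma pt_one {a b : ℝ} (ha : -1 < a) (hb : -(1/2) < b) : ∃ C : ℝ, 0 ≤ C ∧ ∀ ρ : ℝ, 0 ≤ ρ → ρ < 1 →
    ‖Ft a b (fun k => Zf b k 1) 1 ρ‖ ≤ C * (1-ρ)^(-(2*(a+b+3/2))) ∧ ‖Ft a b d0 1 ρ‖ ≤ C * (1-ρ)^(-(2*(a+b+3/2))) := by
  obtain ⟨C1, hC1, H1⟩ := sum_Z (c0 := 1) ha hb nmm nmm
  obtain ⟨C2, hC2, H2⟩ := sum_d0 ha hb
  refine ⟨C1 + C2, by positivity, fun ρ h0 h1 => ?_⟩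
  have hr : ‖(ρ:ℂ)‖ < 1 := by rw [Complex.norm_real, Real.norm_eq_abs, abs_of_nonneg h0]; exact h1
  obtain ⟨hS, hK, hU⟩ := pp_real_S h0 h1
  have hx : 0 < 1 - ρ := by linarith
  have hn : ‖1-(ρ:ℂ)‖ = 1 - ρ := by
    rw [← Complex.ofReal_one, ← Complex.ofReal_sub, Complex.norm_real, Real.norm_eq_abs, abs_of_pos hx]
  have hw : wt1 1 = 1 := by apply Complex.ext <;> simp [wt1]
  have e4 := one_add_pp hr
  have e6 : 1 + pp (ρ:ℂ) ≠ 0 := by intro h; rw [h] at e4; simp at e4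
  have F : ∀ Z, ‖Ft a b Z 1 ρ‖ = (1-ρ) * ‖∑' m, (kap a b m : ℂ) * cmC a ρ ρ Z m‖ := by
    intro Z
    unfold Ft
    rw [hS, hK, hU, norm_mul, norm_mul, norm_mul, Complex.norm_cpow_real, Complex.norm_cpow_real, ← rpow_add (norm_pos_iff.2 e6), hn]
    simp
  have a1 := H1 ρ ρ 1 (1-ρ) (1-ρ) hr hr nmm (by rw [hn]; linarith) (by rw [hn]; linarith) (by rw [hn]; linarith)
    (by rw [hw, mul_one, hn]) (by rw [hw, map_one, mul_one, hn])
  have a2 := H2 ρ ρ hr hr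
  rw [hn] at a1 a2
  rw [F, F]
  have m1 : ∀ e : ℝ, (1-ρ) * (1-ρ)^e = (1-ρ)^(1+e) := fun e => by rw [rpow_add hx, rpow_one]
  constructor
  · calc _ ≤ (1-ρ) * (C1 * ((1-ρ) * (1-ρ)^(-(2*a+3)) * (1-ρ)^(-(2*(b+1))))) := by gcongr
      _ = C1 * (1-ρ)^(-(2*(a+b+3/2))) := by
        rw [m1, ← rpow_add hx, mul_left_comm, m1]; congr 2; ring
      _ ≤ _ := by gcongr; linarith
  · calc _ ≤ (1-ρ) * (C2 * (1-ρ)^(-(2*a+3))) := by gcongr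
      _ = C2 * (1-ρ)^(1+-(2*a+3)) := by rw [mul_left_comm, m1]
      _ ≤ C2 * (1-ρ)^(-(2*(a+b+3/2))) := by
        gcongr ?_ * ?_
        exact rpow_le_rpow_of_exponent_ge hx lnn lnn
      _ ≤ _ := by gcongr; linarith
noncomputable def wm (α β : ℝ) : Measure ℝ :=
  (volume.restrict (Ioo 0 1)).withDensity (fun x => eoo (x^α * (1-x)^β))
lemma wm_meas (α β : ℝ) : Measurable (fun x : ℝ => eoo (x^α * (1-x)^β)) := by fun_prop
lemma wm_lint (α β : ℝ) {f : ℝ → ℝ≥0∞} (hf : Measurable f) :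
    ∫⁻ x, f x ∂(wm α β) = ∫⁻ x in Ioo 0 1, eoo (x^α * (1-x)^β) * f x := by
  unfold wm
  rw [lintegral_withDensity_eq_lintegral_mul _ (wm_meas α β) hf]; rfl
lemma wm_fin {α β : ℝ} (hα : -1 < α) (hβ : -1 < β) : IsFiniteMeasure (wm α β) := by
  refine isFiniteMeasure_withDensity_ofReal ?_
  have := (beta_int (u := α+1) (v := β+1) lnn lnn).1
  simp only [add_sub_cancel_right] at this
  exact this.2
instance (α β : ℝ) : SFinite (wm α β) := by unfold wm; infer_instance
lemma wm_ae (α β : ℝ) : ∀ᵐ x ∂(wm α β), x ∈ Ioo (0:ℝ) 1 := by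
  have : wm α β ≪ volume.restrict (Ioo 0 1) := withDensity_absolutelyContinuous _ _
  exact this.ae_le (ae_restrict_mem measurableSet_Ioo)
noncomputable def pim (a b : ℝ) : Measure (ℝ × ℝ) := (wm b a).prod (wm (b-1/2) (b-1/2))
noncomputable def ph (q : ℝ × ℝ) : ℝ × ℝ := (√q.1 * (1 - 2*q.2), q.1)
lemma ph_meas : Measurable ph := by unfold ph; fun_prop
lemma lint_affine {c : ℝ} (hc : 0 < c) (f : ℝ → ℝ≥0∞) (hf : Measurable f) :
    ∫⁻ u, f u = eoo (2*c) * ∫⁻ s, f (c * (1-2*s)) := by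
  have h1 : ∫⁻ u, f u = ∫⁻ u, f (c + u) := (lintegral_add_left_eq_self f c).symm
  have h2 := Real.smul_map_volume_mul_left (a := -2*c) lnn
  have h3 : ∫⁻ u, f (c+u) = ∫⁻ u, f (c+u) ∂(eoo |-2*c| • Measure.map (fun x => -2*c*x) volume) := by rw [h2]
  rw [h1, h3, lintegral_smul_measure, lintegral_map fpp fpp, abs_of_neg lnn]
  rw [smul_eq_mul]
  congr 2
  · ring
  · ext s; congr 1; ring
lemma Udom_meas : MeasurableSet Udom := by
  have h1 : MeasurableSet {x : ℝ × ℝ | x.1^2 ≤ x.2} := measurableSet_le fpp fpp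
  have h2 : MeasurableSet {x : ℝ × ℝ | x.2 ≤ 1} := measurableSet_le fpp fpp
  exact h1.inter h2
lemma mchange (a b : ℝ) {g : ℝ × ℝ → ℝ≥0∞} (hg : Measurable g) :
    ∫⁻ y in Udom, g y * eoo (Uw a b y) = eoo (2 * 4^(b-1/2)) * ∫⁻ q, g (ph q) ∂(pim a b) := by
  have hU := Udom_meas
  have hUw : Measurable (Uw a b) := by unfold Uw; fun_prop
  have hG : Measurable (fun q => g (ph q)) := hg.comp ph_meas
  have hM : Measurable (Udom.indicator (fun y => g y * eoo (Uw a b y))) :=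
    Measurable.indicator fpp hU
  rw [← lintegral_indicator hU, Measure.volume_eq_prod, lintegral_prod_symm' _ hM]
  have e1 : ∀ x : ℝ, x ≠ 0 → x ≠ 1 → ∫⁻ u, Udom.indicator (fun y => g y * eoo (Uw a b y)) (u,x)
      = (Ioo (0:ℝ) 1).indicator (fun x => eoo (2 * 4^(b-1/2)) * (eoo (x^b * (1-x)^a) * ∫⁻ s, g (ph (x,s)) ∂(wm (b-1/2) (b-1/2)))) x := by
    intro x hx0 hx1
    by_cases hx : x ∈ Ioo (0:ℝ) 1
    · rw [indicator_of_mem hx, wm_lint _ _ (f := fun s => g (ph (x,s))) (hG.comp (g := fun q : ℝ × ℝ => g (ph q)) (f := fun s => (x,s)) fpp)]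
      have hs : 0 < √x := Real.sqrt_pos.2 hx.1
      have hsq := sq_sqrt hx.1.le
      rw [lint_affine hs (fun u => Udom.indicator (fun y => g y * eoo (Uw a b y)) (u,x)) (hM.comp (f := fun u => (u,x)) fpp)]
      rw [← lintegral_const_mul' _ _ ENNReal.ofReal_ne_top]
      rw [← lintegral_const_mul' _ _ ENNReal.ofReal_ne_top, ← lintegral_const_mul' _ _ ENNReal.ofReal_ne_top]
      rw [← lintegral_indicator measurableSet_Ioo]
      apply lintegral_congr_ae
      have hc : ({0,1} : Set ℝ)ᶜ ∈ ae (volume : Measure ℝ) := by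
        rw [compl_mem_ae_iff]; exact (Set.toFinite _).measure_zero _
      filter_upwards [hc] with s hs01
      simp only [mem_compl_iff, mem_insert_iff, mem_singleton_iff, not_or] at hs01
      by_cases h : s ∈ Ioo (0:ℝ) 1
      · rw [indicator_of_mem h, indicator_of_mem]
        · show _ * (g (√x * (1-2*s), x) * _) = _ * (_ * (_ * g (√x * (1-2*s), x)))
          have : 2 * √x * Uw a b (√x * (1-2*s), x) = 2 * 4^(b-1/2) * (x^b * (1-x)^a * (s^(b-1/2) * (1-s)^(b-1/2))) := by
            unfold Uw
            simp only
            rw [show x - (√x * (1-2*s))^2 = x * (4 * (s * (1-s))) by rw [mul_pow, hsq]; ring]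
            rw [mul_rpow hx.1.le (by nlinarith [h.1, h.2]), mul_rpow nmm (by nlinarith [h.1, h.2]),
              mul_rpow h.1.le (by linarith [h.2]), show x^b = √x * x^(b-1/2) by
                rw [Real.sqrt_eq_rpow, ← rpow_add hx.1]; ring_nf]
            ring
          have h' : 0 ≤ 1 - s := by linarith [h.2]
          have hx' : 0 ≤ 1 - x := by linarith [hx.2]
          have hsn := h.1.le
          have hxn := hx.1.le
          calc _ = eoo (2*√x * Uw a b (√x * (1-2*s), x)) * g (√x * (1-2*s), x) := by
                rw [ENNReal.ofReal_mul (p := 2*√x) pvv]; ring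
            _ = _ := by
                rw [this, ENNReal.ofReal_mul (p := 2 * 4^(b-1/2)) pvv, ENNReal.ofReal_mul (p := x^b * (1-x)^a) pvv]; ring
        · refine ⟨?_, hx.2.le⟩
          show (√x * (1-2*s))^2 ≤ x
          rw [mul_pow, hsq]; nlinarith [mul_pos hx.1 (mul_pos h.1 (sub_pos.2 h.2))]
      · rw [indicator_of_notMem h, indicator_of_notMem, mul_zero]
        rintro ⟨h1, -⟩
        apply h
        change (√x * (1-2*s))^2 ≤ x at h1
        rw [mul_pow, hsq] at h1
        have h2 : 0 ≤ s * (1-s) := by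
          by_contra hh; push Not at hh
          nlinarith [mul_neg_of_pos_of_neg hx.1 hh]
        constructor
        · by_contra hh; push Not at hh
          have : s < 0 := lt_of_le_of_ne hh hs01.1
          nlinarith
        · by_contra hh; push Not at hh
          have : 1 < s := lt_of_le_of_ne hh (Ne.symm hs01.2)
          nlinarith
    · rw [indicator_of_notMem hx]
      have : ∀ u, Udom.indicator (fun y => g y * eoo (Uw a b y)) (u,x) = 0 := by
        intro u
        apply indicator_of_notMem
        rintro ⟨h1, h2⟩
        apply hx
        exact ⟨lt_of_le_of_ne ((sq_nonneg u).trans h1) (Ne.symm hx0), lt_of_le_of_ne h2 hx1⟩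
      simp [this]
  have hc : ({0,1} : Set ℝ)ᶜ ∈ ae (volume : Measure ℝ) := by
    rw [compl_mem_ae_iff]; exact (Set.toFinite _).measure_zero _
  have e2 := lintegral_congr_ae (μ := volume) (f := fun x => ∫⁻ u, Udom.indicator (fun y => g y * eoo (Uw a b y)) (u,x)) (g := (Ioo (0:ℝ) 1).indicator (fun x => eoo (2 * 4^(b-1/2)) * (eoo (x^b * (1-x)^a) * ∫⁻ s, g (ph (x,s)) ∂(wm (b-1/2) (b-1/2))))) (by
    filter_upwards [hc] with x hx
    simp only [mem_compl_iff, mem_insert_iff, mem_singleton_iff, not_or] at hx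
    exact e1 x hx.1 hx.2)
  rw [e2, lintegral_indicator measurableSet_Ioo, lintegral_const_mul' _ _ ENNReal.ofReal_ne_top]
  unfold pim
  rw [lintegral_prod _ hG.aemeasurable, wm_lint]
  exact hG.lintegral_prod_right'
lemma jac_meas (n : ℕ) (α β : ℝ) : Continuous (jacobiP n α β) := by unfold jacobiP; fun_prop
lemma Pkn_meas (a b : ℝ) (k n : ℕ) : Measurable (PknU a b k n) := by
  unfold PknU
  have h1 := (jac_meas (n-k) (b+k) a).measurable
  have h2 := (jac_meas k (b-1/2) (b-1/2)).measurable
  fun_prop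
lemma Pn_meas (a b : ℝ) (n : ℕ) (x : ℝ × ℝ) : Measurable (PnU a b n x) := by
  unfold PnU
  refine Finset.measurable_sum _ fun k _ => ?_
  have := Pkn_meas a b k n
  fun_prop
lemma KnCes_meas (a b δ : ℝ) (n : ℕ) (x : ℝ × ℝ) : Measurable (KnUCes a b δ n x) := by
  unfold KnUCes KnU
  have := fun n => Pn_meas a b n x
  fun_prop
/-- reduction to a bound of the lower integral over `pim` -/
lemma reduce (a b δ : ℝ) (C : ℝ) (hC : 0 ≤ C)
    (h : ∀ n, ∫⁻ q, eoo |KnUCes a b δ n (1,1) (ph q)| ∂(pim a b) ≤ eoo C) :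
    ∃ C : ℝ, ∀ n : ℕ, dU a b * ∫ y in Udom, |KnUCes a b δ n (1, 1) y| * Uw a b y ≤ C := by
  have hU := Udom_meas
  have hUw : Measurable (Uw a b) := by unfold Uw; fun_prop
  have hpos : ∀ y ∈ Udom, 0 ≤ Uw a b y := by
    rintro y ⟨h1, h2⟩
    unfold Uw
    have : 0 ≤ 1 - y.2 := by linarith
    have : 0 ≤ y.2 - y.1^2 := by linarith
    positivity
  have hd : 0 ≤ dU a b := by
    unfold dU
    exact inv_nonneg.2 (setIntegral_nonneg hU hpos)
  refine ⟨dU a b * (2 * 4^(b-1/2) * C), fun n => mul_le_mul_of_nonneg_left ?_ hd⟩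
  have hm := KnCes_meas a b δ n (1,1)
  rw [integral_eq_lintegral_of_nonneg_ae]
  · apply ENNReal.toReal_le_of_le_ofReal pvv
    calc _ = ∫⁻ y in Udom, eoo |KnUCes a b δ n (1, 1) y| * eoo (Uw a b y) := by
          congr 1; ext y; rw [ENNReal.ofReal_mul (abs_nonneg _)]
      _ ≤ _ := by
          rw [mchange a b fpp, ENNReal.ofReal_mul (p := 2 * 4^(b-1/2)) pvv]
          exact mul_le_mul' le_rfl (h n)
  · filter_upwards [ae_restrict_mem hU] with y hy
    exact mul_nonneg (abs_nonneg _) (hpos y hy)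
  · exact (by fun_prop : Measurable fun y => |KnUCes a b δ n (1, 1) y| * Uw a b y).aestronglyMeasurable
lemma wm_integral (α β : ℝ) (f : ℝ → ℝ) : ∫ x, f x ∂(wm α β) = ∫ x in Ioo 0 1, x^α * (1-x)^β * f x := by
  unfold wm
  rw [integral_withDensity_eq_integral_toReal_smul (wm_meas α β) (by simp)]
  apply setIntegral_congr_fun measurableSet_Ioo
  intro x hx
  have h1 : 0 ≤ x := hx.1.le
  have h2 : 0 ≤ 1 - x := by linarith [hx.2]
  simp only [smul_eq_mul]
  rw [ENNReal.toReal_ofReal pvv]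
lemma wm_int_cont {α β : ℝ} (hα : -1 < α) (hβ : -1 < β) {f : ℝ → ℝ} (hf : Continuous f) : Integrable f (wm α β) := by
  have := wm_fin hα hβ
  obtain ⟨C, hC⟩ := (isCompact_Icc (a := (0:ℝ)) (b := 1)).exists_bound_of_continuousOn hf.continuousOn
  refine Integrable.of_bound hf.aestronglyMeasurable C ?_
  filter_upwards [wm_ae α β] with x hx
  exact hC x ⟨hx.1.le, hx.2.le⟩
lemma wm_mon {α β : ℝ} (hα : -1 < α) (hβ : -1 < β) (j i : ℕ) :
    ∫ x, x^j * (1-x)^i ∂(wm α β) = Bt (α+1+j) (β+1+i) := by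
  rw [wm_integral, ← (beta_int (u := α+1+j) (v := β+1+i) (by have : (0:ℝ) ≤ j := j.cast_nonneg; linarith) (by have : (0:ℝ) ≤ i := i.cast_nonneg; linarith)).2]
  apply setIntegral_congr_fun measurableSet_Ioo
  intro x hx
  have h1 : 0 < x := hx.1
  have h2 : 0 < 1 - x := by linarith [hx.2]
  simp only
  rw [show α+1+j-1 = α+j by ring, show β+1+i-1 = β+i by ring, rpow_add h1, rpow_add h2, rpow_natCast, rpow_natCast]
  ring
noncomputable def JJ (n : ℕ) (α β x : ℝ) : ℝ := jacobiP n α β (1-2*x)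
noncomputable def jc (n : ℕ) (α β : ℝ) (j : ℕ) : ℝ := (poch (α+1) n / n.factorial) * ((-1)^j * (n.choose j : ℝ) * poch (n+α+β+1) j / poch (α+1) j)
lemma JJ_eq (n : ℕ) (α β x : ℝ) : JJ n α β x = ∑ j ∈ Finset.range (n+1), jc n α β j * x^j := by
  unfold JJ jacobiP jc
  rw [Finset.mul_sum]
  apply Finset.sum_congr rfl
  intro j _
  rw [poch_neg_nat, show (1 - (1-2*x))/2 = x by ring]
  have : (j.factorial : ℝ) ≠ 0 := by positivity
  field_simp
lemma JJ_cont (n : ℕ) (α β : ℝ) : Continuous (JJ n α β) := by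
  unfold JJ; exact (jac_meas n α β).comp fpp
noncomputable def Iv (α β : ℝ) (n i : ℕ) : ℝ := poch (α+1) n / n.factorial * Bt (α+1) (β+1+i) * (poch ((i:ℝ)+1-n) n / poch (α+β+2+i) n)
lemma int_one_sub {α β : ℝ} (hα : -1 < α) (hβ : -1 < β) (n i : ℕ) :
    ∫ x, JJ n α β x * (1-x)^i ∂(wm α β) = Iv α β n i := by
  have hi : (0:ℝ) ≤ i := i.cast_nonneg
  have e : ∀ x, JJ n α β x * (1-x)^i = ∑ j ∈ Finset.range (n+1), jc n α β j * (x^j * (1-x)^i) := by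
    intro x; rw [JJ_eq, Finset.sum_mul]; exact Finset.sum_congr rfl fun j _ => by ring
  simp_rw [e]
  rw [integral_finset_sum _ (fun j _ => (wm_int_cont hα hβ fpp))]
  have h := chuV n (n+α+β+1) (α+β+2+i) lnn
  rw [show α+β+2+i - (n+α+β+1) = (i:ℝ)+1-n by ring] at h
  unfold Iv
  rw [← h, Finset.mul_sum]
  apply Finset.sum_congr rfl
  intro j _
  rw [integral_const_mul, wm_mon hα hβ]
  have hb := Bt_add (u := α+1) (v := β+1+i) lnn lnn j 0
  simp only [Nat.cast_zero, add_zero, poch_zero, mul_one] at hb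
  rw [hb, show α+1+(β+1+i) = α+β+2+i by ring]
  unfold jc
  have := (poch_pos (show 0 < α+1 by linarith) j).ne'
  field_simp
lemma Iv_zero {α β : ℝ} {n i : ℕ} (h : i < n) : Iv α β n i = 0 := by
  have : poch ((i:ℝ)+1-n) n = 0 := by
    unfold poch
    apply Finset.prod_eq_zero (i := n-1-i) (Finset.mem_range.2 (by omega))
    rw [Nat.sub_sub, Nat.cast_sub (by omega)]; push_cast; ring
  simp [Iv, this]
lemma int_pow {α β : ℝ} (hα : -1 < α) (hβ : -1 < β) (n j : ℕ) :
    ∫ x, JJ n α β x * x^j ∂(wm α β) = ∑ i ∈ Finset.range (j+1), (-1)^i * (j.choose i : ℝ) * Iv α β n i := by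
  have e : ∀ x, JJ n α β x * x^j = ∑ i ∈ Finset.range (j+1), ((-1)^i * (j.choose i : ℝ)) * (JJ n α β x * (1-x)^i) := by
    intro x
    have : x^j = ((-(1-x)) + 1)^j := by ring
    rw [this, add_pow, Finset.mul_sum]
    refine Finset.sum_congr rfl fun i _ => ?_
    rw [neg_pow]; ring
  simp_rw [e]
  have hc := JJ_cont n α β
  rw [integral_finset_sum _ (fun i _ => (wm_int_cont hα hβ fpp))]
  refine Finset.sum_congr rfl fun i _ => ?_
  rw [integral_const_mul, int_one_sub hα hβ]
lemma int_pow_lt {α β : ℝ} (hα : -1 < α) (hβ : -1 < β) {n j : ℕ} (h : j < n) : ∫ x, JJ n α β x * x^j ∂(wm α β) = 0 := by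
  rw [int_pow hα hβ]
  apply Finset.sum_eq_zero
  intro i hi
  rw [Finset.mem_range] at hi
  rw [Iv_zero (by omega), mul_zero]
lemma JJ_orth_lt {α β : ℝ} (hα : -1 < α) (hβ : -1 < β) {n m : ℕ} (h : m < n) :
    ∫ x, JJ n α β x * JJ m α β x ∂(wm α β) = 0 := by
  have e : ∀ x, JJ n α β x * JJ m α β x = ∑ j ∈ Finset.range (m+1), jc m α β j * (JJ n α β x * x^j) := by
    intro x; rw [JJ_eq m, Finset.mul_sum]; exact Finset.sum_congr rfl fun j _ => by ring
  simp_rw [e]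
  have hc := JJ_cont n α β
  rw [integral_finset_sum _ (fun i _ => (wm_int_cont hα hβ fpp))]
  apply Finset.sum_eq_zero
  intro i hi
  rw [Finset.mem_range] at hi
  rw [integral_const_mul, int_pow_lt hα hβ (by omega), mul_zero]
lemma JJ_orth {α β : ℝ} (hα : -1 < α) (hβ : -1 < β) {n m : ℕ} (h : n ≠ m) :
    ∫ x, JJ n α β x * JJ m α β x ∂(wm α β) = 0 := by
  rcases lt_or_gt_of_ne h with h | h
  · simp_rw [mul_comm (JJ n α β _)]; exact JJ_orth_lt hα hβ h
  · exact JJ_orth_lt hα hβ h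
lemma JJ_norm {α β : ℝ} (hα : -1 < α) (hβ : -1 < β) (n : ℕ) (hs : α + β + 2*n + 1 ≠ 0) :
    ∫ x, JJ n α β x * JJ n α β x ∂(wm α β) = Bt (α+1) (β+1) * hJ n α β := by
  have e : ∀ x, JJ n α β x * JJ n α β x = ∑ j ∈ Finset.range (n+1), jc n α β j * (JJ n α β x * x^j) := by
    intro x; conv_lhs => rw [JJ_eq n, Finset.sum_mul]
    refine Finset.sum_congr rfl fun j _ => ?_
    rw [← JJ_eq]; ring
  simp_rw [e]
  have hc := JJ_cont n α β
  rw [integral_finset_sum _ (fun i _ => (wm_int_cont hα hβ fpp))]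
  rw [Finset.sum_range_succ, Finset.sum_eq_zero, zero_add, integral_const_mul, int_pow hα hβ, Finset.sum_range_succ, Finset.sum_eq_zero, zero_add]
  · unfold jc Iv hJ
    have hb := Bt_add (u := α+1) (v := β+1) lnn lnn 0 n
    simp only [Nat.cast_zero, add_zero, poch_zero, one_mul, zero_add] at hb
    rw [hb, show (n:ℝ)+1-n = 1 by ring, poch_one_eq, Nat.choose_self]
    have hn : (0:ℝ) ≤ n := n.cast_nonneg
    have p1 := (poch_pos (show 0 < α+1 by linarith) n).ne'
    have p2 := (poch_pos (show 0 < α+β+2 by linarith) n).ne'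
    have p3 := (poch_pos (show 0 < α+β+2+n by linarith) n).ne'
    have f : (n.factorial : ℝ) ≠ 0 := by positivity
    have key : poch (n+α+β+1) n * (α+β+2*n+1) = (α+β+n+1) * poch (α+β+2+n) n := by
      have k1 := poch_succ (n+α+β+1) n
      have k2 := poch_succ' (n+α+β+1) n
      rw [k1] at k2
      rw [show α+β+2*n+1 = n+α+β+1+n by ring, k2, show (n:ℝ)+α+β+1+1 = α+β+2+n by ring]; ring
    rw [show α+1+(β+1) = α+β+2 by ring]
    have : poch (n+α+β+1) n = (α+β+n+1) * poch (α+β+2+n) n / (α+β+2*n+1) := by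
      rw [eq_div_iff hs, key]
    rw [this]
    rcases neg_one_pow_eq_or ℝ n with h | h <;> rw [h] <;> push_cast <;> field_simp
  · intro i hi
    rw [Finset.mem_range] at hi
    rw [Iv_zero hi, mul_zero]
  · intro i hi
    rw [Finset.mem_range] at hi
    rw [integral_const_mul, int_pow_lt hα hβ hi, mul_zero]
lemma pim_ae (a b : ℝ) : ∀ᵐ q ∂(pim a b), q.1 ∈ Ioo (0:ℝ) 1 ∧ q.2 ∈ Ioo (0:ℝ) 1 := by
  unfold pim
  have h1 := (Measure.quasiMeasurePreserving_fst (μ := wm b a) (ν := wm (b-1/2) (b-1/2))).ae (wm_ae b a)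
  have h2 := (Measure.quasiMeasurePreserving_snd (μ := wm b a) (ν := wm (b-1/2) (b-1/2))).ae (wm_ae (b-1/2) (b-1/2))
  filter_upwards [h1, h2] with q h3 h4 using ⟨h3, h4⟩
lemma pim_fin {a b : ℝ} (ha : -1 < a) (hb : -(1/2) < b) : IsFiniteMeasure (pim a b) := by
  have := wm_fin (α := b) (β := a) lnn ha
  have := wm_fin (α := b-1/2) (β := b-1/2) lnn lnn
  unfold pim; infer_instance
lemma ph_div {q : ℝ × ℝ} (h : 0 < q.1) : (ph q).1/√(ph q).2 = 1 - 2*q.2 := by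
  have : √q.1 ≠ 0 := (Real.sqrt_pos.2 h).ne'
  show √q.1 * (1-2*q.2)/√q.1 = _
  field_simp
noncomputable def QQ (a b : ℝ) (i : (_ : ℕ) × ℕ) (q : ℝ × ℝ) : ℝ :=
  (JJ (i.1-i.2) (b+i.2) a q.1 * √q.1^i.2) * JJ i.2 (b-1/2) (b-1/2) q.2
lemma QQ_cont (a b : ℝ) (i : (_ : ℕ) × ℕ) : Continuous (QQ a b i) := by
  unfold QQ
  have h1 := JJ_cont (i.1-i.2) (b+i.2) a
  have h2 := JJ_cont i.2 (b-1/2) (b-1/2)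
  fun_prop
lemma QQ_eq (a b : ℝ) (i : (_ : ℕ) × ℕ) {q : ℝ × ℝ} (h : 0 < q.1) : PknU a b i.2 i.1 (ph q) = QQ a b i q := by
  unfold PknU QQ JJ
  rw [ph_div h]; rfl
lemma pim_int_cont {a b : ℝ} (ha : -1 < a) (hb : -(1/2) < b) {f : ℝ × ℝ → ℝ} (hf : Continuous f) : Integrable f (pim a b) := by
  have := pim_fin ha hb
  obtain ⟨C, hC⟩ := ((isCompact_Icc (a := (0:ℝ)) (b := 1)).prod (isCompact_Icc (a := (0:ℝ)) (b := 1))).exists_bound_of_continuousOn hf.continuousOn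
  refine Integrable.of_bound hf.aestronglyMeasurable C ?_
  filter_upwards [pim_ae a b] with x hx
  exact hC x ⟨⟨hx.1.1.le, hx.1.2.le⟩, ⟨hx.2.1.le, hx.2.2.le⟩⟩
lemma wm_shift {a b : ℝ} (k : ℕ) (f : ℝ → ℝ) : ∫ x, f x * √x^(k+k) ∂(wm b a) = ∫ x, f x ∂(wm (b+k) a) := by
  rw [wm_integral, wm_integral]
  apply setIntegral_congr_fun measurableSet_Ioo
  intro x hx
  simp only
  rw [rpow_add hx.1, rpow_natCast, ← two_mul, pow_mul, sq_sqrt hx.1.le]; ring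
lemma QQ_mul {a b : ℝ} (i j : (_ : ℕ) × ℕ) :
    ∫ q, QQ a b i q * QQ a b j q ∂(pim a b) =
      (∫ x, (JJ (i.1-i.2) (b+i.2) a x * √x^i.2) * (JJ (j.1-j.2) (b+j.2) a x * √x^j.2) ∂(wm b a)) *
       ∫ s, JJ i.2 (b-1/2) (b-1/2) s * JJ j.2 (b-1/2) (b-1/2) s ∂(wm (b-1/2) (b-1/2)) := by
  unfold pim
  rw [← integral_prod_mul]
  congr 1; ext q; unfold QQ; ring
lemma QQ_orth {a b : ℝ} (ha : -1 < a) (hb : -(1/2) < b) {i j : (_ : ℕ) × ℕ} (hi : i.2 ≤ i.1) (hj : j.2 ≤ j.1) (h : i ≠ j) :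
    ∫ q, QQ a b i q * QQ a b j q ∂(pim a b) = 0 := by
  rw [QQ_mul]
  by_cases hk : i.2 = j.2
  · have hn : i.1 - i.2 ≠ j.1 - i.2 := by
      intro h'
      apply h
      obtain ⟨i1, i2⟩ := i
      obtain ⟨j1, j2⟩ := j
      simp only at *
      subst hk
      congr 1; omega
    have e : ∀ x, (JJ (i.1-i.2) (b+i.2) a x * √x^i.2) * (JJ (j.1-j.2) (b+j.2) a x * √x^j.2) =
        (JJ (i.1-i.2) (b+i.2) a x * JJ (j.1-i.2) (b+i.2) a x) * √x^(i.2+i.2) := by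
      intro x; rw [← hk]; ring
    simp_rw [e]
    have : (0:ℝ) ≤ i.2 := Nat.cast_nonneg _
    rw [wm_shift, JJ_orth lnn ha hn, zero_mul]
  · rw [JJ_orth lnn lnn hk, mul_zero]
lemma cJ_Bt (α β : ℝ) : cJ α β = (Bt (α+1) (β+1))⁻¹ := by
  unfold cJ Bt; rw [inv_div, show α+1+(β+1) = α+β+2 by ring]
lemma QQ_norm {a b : ℝ} (ha : -1 < a) (hb : -(1/2) < b) {i : (_ : ℕ) × ℕ} (hi : i.2 ≤ i.1) :
    hknU a b i.2 i.1 = 0 ∨ ∫ q, QQ a b i q * QQ a b i q ∂(pim a b) = Bt (b+1) (a+1) * Bt (b+1/2) (b+1/2) * hknU a b i.2 i.1 := by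
  by_cases h : hknU a b i.2 i.1 = 0
  · left; exact h
  right
  have h1 : b + i.2 + a + 2*((i.1 - i.2:ℕ):ℝ) + 1 ≠ 0 := by
    intro h'; apply h; unfold hknU hJ; rw [h']; simp
  have h2 : (b-1/2) + (b-1/2) + 2*(i.2:ℝ) + 1 ≠ 0 := by
    intro h'; apply h; unfold hknU hJ; rw [h']; simp
  rw [QQ_mul]
  have e : ∀ x, (JJ (i.1-i.2) (b+i.2) a x * √x^i.2) * (JJ (i.1-i.2) (b+i.2) a x * √x^i.2) =
        (JJ (i.1-i.2) (b+i.2) a x * JJ (i.1-i.2) (b+i.2) a x) * √x^(i.2+i.2) := by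
      intro x; ring
  simp_rw [e]
  have hk : (0:ℝ) ≤ i.2 := Nat.cast_nonneg _
  rw [wm_shift, JJ_norm lnn ha _ h1, JJ_norm lnn lnn _ h2]
  unfold hknU
  rw [cJ_Bt, cJ_Bt, show b - 1/2+1 = b+1/2 by ring]
  have := (Bt_pos (show 0 < b+1 by linarith) (show 0 < a+1 by linarith)).ne'
  have := (Bt_pos (show 0 < b+i.2+1 by linarith) (show 0 < a+1 by linarith)).ne'
  field_simp
lemma hkn_nonneg {a b : ℝ} (ha : -1 < a) (hb : -(1/2) < b) {i : (_ : ℕ) × ℕ} (hi : i.2 ≤ i.1) : 0 ≤ hknU a b i.2 i.1 := by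
  rcases QQ_norm ha hb hi with h | h
  · rw [h]
  · have h1 : 0 ≤ ∫ q, QQ a b i q * QQ a b i q ∂(pim a b) := integral_nonneg fun q => mul_self_nonneg _
    rw [h] at h1
    have := (Bt_pos (show 0 < b+1 by linarith) (show 0 < a+1 by linarith))
    have := (Bt_pos (show 0 < b+1/2 by linarith) (show 0 < b+1/2 by linarith))
    exact nonneg_of_mul_nonneg_right h1 pvv
lemma l2_real {ι : Type*} {X : Type*} [MeasurableSpace X] (μ : Measure X) (I : Finset ι) (Q : ι → X → ℝ) (c : ι → ℝ)
    (hint : ∀ i j, Integrable (fun q => Q i q * Q j q) μ) (ho : ∀ i ∈ I, ∀ j ∈ I, i ≠ j → ∫ q, Q i q * Q j q ∂μ = 0) :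
    Integrable (fun q => (∑ i ∈ I, c i * Q i q)^2) μ ∧ ∫ q, (∑ i ∈ I, c i * Q i q)^2 ∂μ = ∑ i ∈ I, c i^2 * ∫ q, Q i q * Q i q ∂μ := by
  have e : ∀ q, (∑ i ∈ I, c i * Q i q)^2 = ∑ i ∈ I, ∑ j ∈ I, c i * c j * (Q i q * Q j q) := by
    intro q; rw [sq, Finset.sum_mul_sum]
    exact Finset.sum_congr rfl fun i _ => Finset.sum_congr rfl fun j _ => by ring
  simp_rw [e]
  have hh : ∀ i ∈ I, Integrable (fun q => ∑ j ∈ I, c i * c j * (Q i q * Q j q)) μ := fun i _ =>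
    integrable_finset_sum _ fun j _ => (hint i j).const_mul _
  refine ⟨integrable_finset_sum _ hh, ?_⟩
  rw [integral_finset_sum _ hh]
  refine Finset.sum_congr rfl fun i hi => ?_
  rw [integral_finset_sum _ fun j _ => (hint i j).const_mul _, Finset.sum_eq_single i]
  · rw [integral_const_mul, sq]
  · intro j hj hne
    rw [integral_const_mul, ho i hi j hj hne.symm, mul_zero]
  · exact fun h => absurd hi h
lemma l2_complex {ι : Type*} {X : Type*} [MeasurableSpace X] (μ : Measure X) (I : Finset ι) (Q : ι → X → ℝ) (c : ι → ℂ)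
    (hint : ∀ i j, Integrable (fun q => Q i q * Q j q) μ) (ho : ∀ i ∈ I, ∀ j ∈ I, i ≠ j → ∫ q, Q i q * Q j q ∂μ = 0) :
    ∫⁻ q, eoo (‖∑ i ∈ I, c i * (Q i q : ℂ)‖^2) ∂μ = eoo (∑ i ∈ I, ‖c i‖^2 * ∫ q, Q i q * Q i q ∂μ) := by
  obtain ⟨i1, e1⟩ := l2_real μ I Q (fun i => (c i).re) hint ho
  obtain ⟨i2, e2⟩ := l2_real μ I Q (fun i => (c i).im) hint ho
  have e : ∀ q, ‖∑ i ∈ I, c i * (Q i q : ℂ)‖^2 = (∑ i ∈ I, (c i).re * Q i q)^2 + (∑ i ∈ I, (c i).im * Q i q)^2 := by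
    intro q
    rw [← Complex.normSq_eq_norm_sq, Complex.normSq_apply, Complex.re_sum, Complex.im_sum]
    simp [sq]
  simp_rw [e]
  have i3 : Integrable (fun q => (∑ i ∈ I, (c i).re * Q i q)^2 + (∑ i ∈ I, (c i).im * Q i q)^2) μ := i1.add i2
  rw [← ofReal_integral_eq_lintegral_ofReal i3 (Filter.Eventually.of_forall fun q => by simp only [Pi.zero_apply]; positivity)]
  rw [integral_add i1 i2, e1, e2, ← Finset.sum_add_distrib]
  congr 1
  refine Finset.sum_congr rfl fun i _ => ?_
  rw [← Complex.normSq_eq_norm_sq, Complex.normSq_apply]; ring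
lemma PnU_diag_nonneg {a b : ℝ} (ha : -1 < a) (hb : -(1/2) < b) (n : ℕ) : 0 ≤ PnU a b n (1,1) (1,1) := by
  unfold PnU
  refine Finset.sum_nonneg fun k hk => ?_
  rw [Finset.mem_range] at hk
  have := hkn_nonneg ha hb (i := ⟨n,k⟩) (by simp only; omega)
  exact div_nonneg (mul_self_nonneg _) this
lemma l2_partial {a b : ℝ} (ha : -1 < a) (hb : -(1/2) < b) (r : ℂ) (N : ℕ) :
    ∫⁻ q, eoo (‖∑ n ∈ Finset.range N, (PnU a b n (1,1) (ph q) : ℂ) * r^n‖^2) ∂(pim a b) =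
     eoo (Bt (b+1) (a+1) * Bt (b+1/2) (b+1/2) * ∑ n ∈ Finset.range N, PnU a b n (1,1) (1,1) * (‖r‖^2)^n) := by
  have h := l2_complex (pim a b) ((Finset.range N).sigma fun n => Finset.range (n+1)) (QQ a b)
    (fun i => ((PknU a b i.2 i.1 (1,1) / hknU a b i.2 i.1 : ℝ) : ℂ) * r^i.1)
    (fun i j => by
      have h1 := QQ_cont a b i
      have h2 := QQ_cont a b j
      exact pim_int_cont ha hb fpp)
    (fun i hi j hj hne => by
      simp only [Finset.mem_sigma, Finset.mem_range] at hi hj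
      exact QQ_orth ha hb (by omega) (by omega) hne)
  rw [lintegral_congr_ae (g := fun q => eoo (‖∑ i ∈ (Finset.range N).sigma fun n => Finset.range (n+1), ((PknU a b i.2 i.1 (1,1) / hknU a b i.2 i.1 : ℝ) : ℂ) * r^i.1 * (QQ a b i q : ℂ)‖^2)), h]
  · congr 1
    rw [Finset.sum_sigma, Finset.mul_sum]
    refine Finset.sum_congr rfl fun n _ => ?_
    unfold PnU
    rw [Finset.sum_mul, Finset.mul_sum]
    refine Finset.sum_congr rfl fun k hk => ?_
    rw [Finset.mem_range] at hk
    rw [norm_mul, norm_pow, Complex.norm_real, mul_pow, Real.norm_eq_abs, sq_abs, ← pow_mul, mul_comm n 2, pow_mul]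
    rcases QQ_norm ha hb (i := ⟨n,k⟩) (by simp only; omega) with h | h
    · simp only at h; rw [h]; simp
    · rw [h]
      simp only
      by_cases h0 : hknU a b k n = 0
      · rw [h0]; simp
      · field_simp
  · filter_upwards [pim_ae a b] with q hq
    congr 3
    rw [Finset.sum_sigma]
    refine Finset.sum_congr rfl fun n _ => ?_
    unfold PnU
    push_cast
    rw [Finset.sum_mul]
    refine Finset.sum_congr rfl fun k hk => ?_
    have := QQ_eq a b ⟨n,k⟩ hq.1.1
    simp only at this
    rw [this]; ring
noncomputable def FL (a b : ℝ) (q : ℝ × ℝ) (r : ℂ) : ℂ :=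
  Ft a b (fun k => Zf b k (1-2*q.2)) q.1 r - (e1 b : ℂ) * Ft a b d0 q.1 r - (e2 a b : ℂ)
lemma d0_hasSum (r : ℂ) : HasSum (fun n => (d0 n : ℂ) * r^n) 1 := by
  have := hasSum_single (f := fun n => (d0 n : ℂ) * r^n) 0 (by intro n hn; simp [d0, hn])
  simpa [d0] using this
lemma e1_abs (b : ℝ) : ‖(e1 b : ℂ)‖ ≤ 1 := by unfold e1; split_ifs <;> simp
lemma e2_abs (a b : ℝ) : ‖(e2 a b : ℂ)‖ ≤ 1 := by unfold e2; split_ifs <;> simp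
lemma ker_hasSum {a b : ℝ} (ha : -1 < a) (hb : -(1/2) < b) {X t : ℝ} (h0 : 0 ≤ X) (h1 : X ≤ 1) (ht : t^2 ≤ 1) (y : ℝ × ℝ)
    (hy : y.2 = X) (hyt : y.1/√X = t) {r : ℂ} (hr : ‖r‖ < 1) :
    HasSum (fun n => (PnU a b n (1,1) y : ℂ) * r^n) (Ft a b (fun k => Zf b k t) X r - (e1 b : ℂ) * Ft a b d0 X r - (e2 a b : ℂ)) := by
  have s1 := Ft_hasSum ha hb (SE_Z hb ht) h0 h1 hr
  have s2 := (Ft_hasSum ha hb SE_d0 h0 h1 hr).mul_left (e1 b : ℂ)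
  have s3 := (d0_hasSum r).mul_left (e2 a b : ℂ)
  refine hs_congr ((s1.sub s2).sub s3) (fun n => ?_) (by ring)
  rw [kernel_eq ha hb n y (by rw [hy]; exact h0), hy, hyt]
  push_cast; ring
lemma FL_hasSum {a b : ℝ} (ha : -1 < a) (hb : -(1/2) < b) {q : ℝ × ℝ} (h1 : q.1 ∈ Ioo (0:ℝ) 1) (h2 : q.2 ∈ Ioo (0:ℝ) 1) {r : ℂ} (hr : ‖r‖ < 1) :
    HasSum (fun n => (PnU a b n (1,1) (ph q) : ℂ) * r^n) (FL a b q r) :=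
  ker_hasSum ha hb h1.1.le h1.2.le (by nlinarith [h2.1, h2.2]) (ph q) rfl (ph_div h1.1) hr
lemma diag_bound {a b : ℝ} (ha : -1 < a) (hb : -(1/2) < b) : ∃ C : ℝ, 0 ≤ C ∧ ∀ ρ : ℝ, 0 ≤ ρ → ρ < 1 → ∀ N,
    ∑ n ∈ Finset.range N, PnU a b n (1,1) (1,1) * ρ^n ≤ C * (1-ρ)^(-(2*(a+b+3/2))) := by
  obtain ⟨C, hC, H⟩ := pt_one ha hb
  refine ⟨C + C + 1, by positivity, fun ρ h0 h1 N => ?_⟩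
  have hr : ‖(ρ:ℂ)‖ < 1 := by rw [Complex.norm_real, Real.norm_eq_abs, abs_of_nonneg h0]; exact h1
  obtain ⟨H1, H2⟩ := H ρ h0 h1
  have hs := ker_hasSum ha hb zero_le_one le_rfl (t := 1) nmm (1,1) rfl (by simp) hr
  set S := Ft a b (fun k => Zf b k 1) 1 ρ - (e1 b : ℂ) * Ft a b d0 1 ρ - (e2 a b : ℂ) with hS
  have hs' : HasSum (fun n => PnU a b n (1,1) (1,1) * ρ^n) S.re := by
    refine hs_congr (Complex.hasSum_re hs) (fun n => ?_) rfl
    rw [← Complex.ofReal_pow, ← Complex.ofReal_mul, Complex.ofReal_re]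
  have p : 1 ≤ (1-ρ)^(-(2*(a+b+3/2))) := Real.one_le_rpow_of_pos_of_le_one_of_nonpos lnn lnn lnn
  refine (sum_le_hasSum _ (fun n _ => mul_nonneg (PnU_diag_nonneg ha hb n) pvv) hs').trans ?_
  refine (Complex.re_le_norm _).trans ?_
  have n1 := norm_sub_le (Ft a b (fun k => Zf b k 1) 1 ρ - (e1 b : ℂ) * Ft a b d0 1 ρ) (e2 a b : ℂ)
  have n2 := norm_sub_le (Ft a b (fun k => Zf b k 1) 1 ρ) ((e1 b : ℂ) * Ft a b d0 1 ρ)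
  rw [norm_mul] at n2
  have n3 := mul_le_mul (e1_abs b) le_rfl (norm_nonneg (Ft a b d0 1 ρ)) zero_le_one
  have n4 := e2_abs a b
  rw [add_mul, add_mul]
  linarith
lemma FL_aemeas {a b : ℝ} (ha : -1 < a) (hb : -(1/2) < b) {r : ℂ} (hr : ‖r‖ < 1) : AEMeasurable (fun q => FL a b q r) (pim a b) := by
  refine aemeasurable_of_tendsto_metrizable_ae atTop (f := fun N q => ∑ n ∈ Finset.range N, (PnU a b n (1,1) (ph q) : ℂ) * r^n) (fun N => ?_) ?_
  · have := fun n => Pn_meas a b n (1,1)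
    have := ph_meas
    exact Measurable.aemeasurable fpp
  · filter_upwards [pim_ae a b] with q hq
    exact (FL_hasSum ha hb hq.1 hq.2 hr).tendsto_sum_nat
lemma L2_bound {a b : ℝ} (ha : -1 < a) (hb : -(1/2) < b) : ∃ C : ℝ, 0 ≤ C ∧ ∀ r : ℂ, ‖r‖ < 1 →
    ∫⁻ q, eoo (‖FL a b q r‖^2) ∂(pim a b) ≤ eoo (C * (1-‖r‖)^(-(2*(a+b+3/2)))) := by
  obtain ⟨C, hC, H⟩ := diag_bound ha hb
  have b1 := (Bt_pos (show 0 < b+1 by linarith) (show 0 < a+1 by linarith))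
  have b2 := (Bt_pos (show 0 < b+1/2 by linarith) (show 0 < b+1/2 by linarith))
  refine ⟨Bt (b+1) (a+1) * Bt (b+1/2) (b+1/2) * C, by positivity, fun r hr => ?_⟩
  have h0 := norm_nonneg r
  have hm : ∀ N, Measurable (fun q => eoo (‖∑ n ∈ Finset.range N, (PnU a b n (1,1) (ph q) : ℂ) * r^n‖^2)) := by
    intro N
    have := fun n => Pn_meas a b n (1,1)
    have := ph_meas
    fun_prop
  have hl : ∫⁻ q, eoo (‖FL a b q r‖^2) ∂(pim a b) = ∫⁻ q, liminf (fun N => eoo (‖∑ n ∈ Finset.range N, (PnU a b n (1,1) (ph q) : ℂ) * r^n‖^2)) atTop ∂(pim a b) := by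
    apply lintegral_congr_ae
    filter_upwards [pim_ae a b] with q hq
    have := (FL_hasSum ha hb hq.1 hq.2 hr).tendsto_sum_nat
    exact (ENNReal.tendsto_ofReal (this.norm.pow 2)).liminf_eq.symm
  rw [hl]
  refine (lintegral_liminf_le hm).trans ?_
  refine liminf_le_of_le (by isBoundedDefault) ?_
  intro M hM
  obtain ⟨N, hN⟩ := hM.exists
  refine hN.trans ?_
  rw [l2_partial ha hb]
  apply ENNReal.ofReal_le_ofReal
  rw [mul_assoc _ C]
  refine mul_le_mul_of_nonneg_left ((H (‖r‖^2) pvv (by nlinarith) N).trans ?_) pvv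
  refine mul_le_mul_of_nonneg_left ?_ hC
  exact rpow_le_rpow_of_nonpos lnn (by nlinarith) lnn
lemma li_pow {p c : ℝ} (hp : -1 < p) (hc : 0 ≤ c) : ∫⁻ x in Ioc 0 c, eoo (x^p) = eoo (c^(p+1)/(p+1)) := by
  have h := intervalIntegral.intervalIntegrable_rpow' (a := 0) (b := c) hp
  rw [intervalIntegrable_iff_integrableOn_Ioc_of_le hc] at h
  rw [← ofReal_integral_eq_lintegral_ofReal h, ← intervalIntegral.integral_of_le hc, integral_rpow (Or.inl hp), Real.zero_rpow lnn, sub_zero]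
  filter_upwards [ae_restrict_mem measurableSet_Ioc] with x hx
  exact rpow_nonneg hx.1.le _
lemma li_tail {c : ℝ} (hc : 0 < c) : ∫⁻ x in Ioi c, eoo (x^(-(3/2):ℝ)) = eoo (2 * c^(-(1/2):ℝ)) := by
  have h := integrableOn_Ioi_rpow_of_lt (a := -(3/2)) nmm hc
  rw [← ofReal_integral_eq_lintegral_ofReal h, integral_Ioi_rpow_of_lt nmm hc]
  · congr 1; rw [show (-(3/2)+1:ℝ) = -(1/2) by norm_num]; ring
  filter_upwards [ae_restrict_mem measurableSet_Ioi] with x hx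
  exact rpow_nonneg (hc.trans hx).le _
lemma li_sing (y0 : ℝ) {L : ℝ} (hL : 0 ≤ L) : ∫⁻ x in Icc (y0-L) (y0+L), eoo (|x-y0|^(-(1/2):ℝ)) ≤ eoo (4 * L^(1/2:ℝ)) := by
  rw [← lintegral_indicator measurableSet_Icc]
  set g : ℝ → ℝ≥0∞ := (Ioc 0 L).indicator (fun x => eoo (x^(-(1/2):ℝ))) with hg
  have gm : Measurable g := Measurable.indicator fpp measurableSet_Ioc
  have h1 : ∀ x, (Icc (y0-L) (y0+L)).indicator (fun x => eoo (|x-y0|^(-(1/2):ℝ))) x ≤ g (x - y0) + g (y0 - x) := by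
    intro x
    by_cases hx : x ∈ Icc (y0-L) (y0+L)
    · rw [indicator_of_mem hx]
      rcases lt_trichotomy x y0 with h | h | h
      · have : g (y0 - x) = eoo (|x-y0|^(-(1/2):ℝ)) := by
          rw [hg, indicator_of_mem (show y0 - x ∈ Ioc 0 L from ⟨by linarith, by linarith [hx.1]⟩), abs_of_neg lnn]; ring_nf
        rw [this]; exact le_add_self
      · rw [h]; simp
      · have : g (x - y0) = eoo (|x-y0|^(-(1/2):ℝ)) := by
          rw [hg, indicator_of_mem (show x - y0 ∈ Ioc 0 L from ⟨by linarith, by linarith [hx.2]⟩), abs_of_pos lnn]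
        rw [this]; exact le_self_add
    · rw [indicator_of_notMem hx]; exact zero_le
  refine (lintegral_mono h1).trans ?_
  rw [lintegral_add_left fpp, lintegral_sub_right_eq_self g, lintegral_sub_left_eq_self g, hg, lintegral_indicator measurableSet_Ioc, li_pow nmm hL, ← ENNReal.ofReal_add pvv pvv]
  apply ENNReal.ofReal_le_ofReal
  norm_num; linarith
lemma S2_1 {p : ℂ} {Y : ℝ} (h0 : 0 ≤ Y) (h1 : Y ≤ ‖p‖^2/4) (hp : ‖p‖ < 1/8) : ‖p‖^2/2 ≤ ‖(Y:ℂ) + (1-Y:ℝ) * p^2‖ := by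
  have hp0 := norm_nonneg p
  have hq : ‖p‖^2 ≤ 1/64 := by nlinarith
  have h := norm_sub_norm_le ((1-Y:ℝ) * p^2) (-(Y:ℂ))
  rw [norm_neg, norm_mul, norm_pow, Complex.norm_real, Complex.norm_real, Real.norm_eq_abs, Real.norm_eq_abs, abs_of_nonneg h0, abs_of_nonneg lnn, sub_neg_eq_add, add_comm] at h
  have : Y * ‖p‖^2 ≤ Y * 1 := mul_le_mul_of_nonneg_left lnn h0
  have : Y * ‖p‖^2 ≤ ‖p‖^2/4 * (1/64) := mul_le_mul h1 hq pvv pvv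
  nlinarith
lemma S2_2 {p : ℂ} {Y : ℝ} (h1 : 2*‖p‖^2 ≤ Y) (h2 : Y ≤ 1) : Y/2 ≤ ‖(Y:ℂ) + (1-Y:ℝ) * p^2‖ := by
  have h0 : 0 ≤ Y := le_trans pvv h1
  have h := norm_sub_norm_le (Y:ℂ) (-((1-Y:ℝ) * p^2))
  rw [norm_neg, norm_mul, norm_pow, Complex.norm_real, Complex.norm_real, Real.norm_eq_abs, Real.norm_eq_abs, abs_of_nonneg h0, abs_of_nonneg lnn, sub_neg_eq_add] at h
  nlinarith [mul_nonneg h0 (sq_nonneg ‖p‖)]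
lemma S2_3 {p : ℂ} {Y : ℝ} (hp : 0 < ‖p‖) : (Y + (1-Y)*‖p‖^2) * (p.re/‖p‖) ≤ ‖(Y:ℂ) + (1-Y:ℝ) * p^2‖ := by
  have h := Complex.re_le_norm ((starRingEnd ℂ) p * ((Y:ℂ) + (1-Y:ℝ) * p^2))
  rw [norm_mul, Complex.norm_conj] at h
  have e : ((starRingEnd ℂ) p * ((Y:ℂ) + (1-Y:ℝ) * p^2)).re = (Y + (1-Y)*‖p‖^2) * p.re := by
    rw [← Complex.normSq_eq_norm_sq, Complex.normSq_apply]
    simp [sq]; ring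
  rw [e] at h
  rw [mul_div_assoc', div_le_iff₀ hp]; linarith
lemma S2_4 {p : ℂ} {Y : ℝ} : |Y + (1-Y)*(p^2).re| ≤ ‖(Y:ℂ) + (1-Y:ℝ) * p^2‖ := by
  have h := Complex.abs_re_le_norm ((Y:ℂ) + (1-Y:ℝ) * p^2)
  rwa [Complex.add_re, Complex.re_ofReal_mul, Complex.ofReal_re] at h
lemma rpow_box {y a : ℝ} (h1 : 1/4 ≤ y) (h2 : y ≤ 4) : y^a ≤ 4^|a| := by
  rcases le_total 0 a with h | h
  · rw [abs_of_nonneg h]; exact Real.rpow_le_rpow lnn h2 h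
  · rw [abs_of_nonpos h]
    calc y^a ≤ (1/4:ℝ)^a := rpow_le_rpow_of_nonpos nmm h1 h
      _ = _ := by rw [one_div, inv_rpow nmm, rpow_neg nmm]
lemma wm_refl (α β : ℝ) {f : ℝ → ℝ≥0∞} (hf : Measurable f) : ∫⁻ x, f x ∂(wm α β) = ∫⁻ x, f (1-x) ∂(wm β α) := by
  rw [wm_lint _ _ hf, wm_lint _ _ fpp, ← lintegral_indicator measurableSet_Ioo, ← lintegral_indicator measurableSet_Ioo, ← lintegral_sub_left_eq_self _ (1:ℝ)]
  congr 1; ext x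
  by_cases hx : x ∈ Ioo (0:ℝ) 1
  · rw [indicator_of_mem hx, indicator_of_mem (show 1 - x ∈ Ioo (0:ℝ) 1 from ⟨by linarith [hx.2], by linarith [hx.1]⟩)]
    congr 2; rw [mul_comm]; congr 2; ring
  · rw [indicator_of_notMem hx, indicator_of_notMem]
    intro h; exact hx ⟨by linarith [h.2], by linarith [h.1]⟩
lemma li_cover {A s1 s2 s3 s4 : Set ℝ} (hA : MeasurableSet A) (h1 : MeasurableSet s1) (h2 : MeasurableSet s2) (h3 : MeasurableSet s3) (h4 : MeasurableSet s4)
    {F G1 G2 G3 G4 : ℝ → ℝ≥0∞} (m1 : Measurable G1) (m2 : Measurable G2) (m3 : Measurable G3) (y0 : ℝ)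
    (h : ∀ x ∈ A, x ≠ y0 → (x ∈ s1 ∧ F x ≤ G1 x) ∨ (x ∈ s2 ∧ F x ≤ G2 x) ∨ (x ∈ s3 ∧ F x ≤ G3 x) ∨ (x ∈ s4 ∧ F x ≤ G4 x)) :
    ∫⁻ x in A, F x ≤ (∫⁻ x in s1, G1 x) + ((∫⁻ x in s2, G2 x) + ((∫⁻ x in s3, G3 x) + ∫⁻ x in s4, G4 x)) := by
  rw [← lintegral_indicator hA, ← lintegral_indicator h1, ← lintegral_indicator h2, ← lintegral_indicator h3, ← lintegral_indicator h4,
    ← lintegral_add_left (m3.indicator h3), ← lintegral_add_left (m2.indicator h2), ← lintegral_add_left (m1.indicator h1)]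
  apply lintegral_mono_ae
  have hc : ({y0} : Set ℝ)ᶜ ∈ ae (volume : Measure ℝ) := by
    rw [compl_mem_ae_iff]; exact (Set.toFinite _).measure_zero _
  filter_upwards [hc] with x hx
  by_cases hxA : x ∈ A
  · rw [indicator_of_mem hxA]
    rcases h x hxA hx with ⟨hm, hf⟩ | ⟨hm, hf⟩ | ⟨hm, hf⟩ | ⟨hm, hf⟩
    · rw [indicator_of_mem hm]; exact hf.trans le_self_add
    · rw [indicator_of_mem hm (f := G2)]; exact hf.trans (le_self_add.trans le_add_self)
    · rw [indicator_of_mem hm (f := G3)]; exact hf.trans (le_self_add.trans (le_add_self.trans le_add_self))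
    · rw [indicator_of_mem hm (f := G4)]; exact hf.trans (le_add_self.trans (le_add_self.trans le_add_self))
  · rw [indicator_of_notMem hxA]; exact zero_le
lemma half_pow {b Y : ℝ} (hb : -1 < b) (h0 : 0 ≤ Y) (h1 : Y ≤ 1/2) : (1-Y)^b ≤ 2 := by
  rcases le_total 0 b with h | h
  · exact (Real.rpow_le_one lnn lnn h).trans one_le_two
  · calc (1-Y)^b ≤ (1/2:ℝ)^b := rpow_le_rpow_of_nonpos nmm lnn h
      _ = 2^(-b) := by rw [one_div, inv_rpow nmm, rpow_neg nmm]
      _ ≤ 2^(1:ℝ) := Real.rpow_le_rpow_of_exponent_le one_le_two lnn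
      _ = 2 := by norm_num
lemma li_const {s : Set ℝ} {c B : ℝ} (hc : 0 ≤ c) {g : ℝ → ℝ} (h : ∫⁻ x in s, eoo (g x) ≤ eoo B) :
    ∫⁻ x in s, eoo (c * g x) ≤ eoo (c * B) := by
  simp_rw [ENNReal.ofReal_mul hc]
  rw [lintegral_const_mul' _ _ ENNReal.ofReal_ne_top]
  exact mul_le_mul' le_rfl h
lemma li_beta {u v : ℝ} (hu : -1 < u) (hv : -1 < v) : ∫⁻ x in Ioo (0:ℝ) 1, eoo (x^u * (1-x)^v) = eoo (Bt (u+1) (v+1)) := by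
  have h := beta_int (u := u+1) (v := v+1) lnn lnn
  simp only [add_sub_cancel_right] at h
  rw [← h.2, ofReal_integral_eq_lintegral_ofReal h.1]
  filter_upwards [ae_restrict_mem measurableSet_Ioo] with x hx
  have h1 : 0 ≤ x := hx.1.le
  have h2 : 0 ≤ 1 - x := by linarith [hx.2]
  simp only [Pi.zero_apply]; positivity
lemma far_B {b : ℝ} (hb : -(1/2) < b) : ∃ C : ℝ, 0 ≤ C ∧ ∀ T, 0 < T → T ≤ 2 →
    ∫⁻ s, eoo (T * (T + 2*√s)^(-(2*(b+1)))) ∂(wm (b-1/2) (b-1/2)) ≤ eoo C := by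
  have hB := Bt_pos (show 0 < b-1/2+1 by linarith) (show 0 < b-1/2+1 by linarith)
  have hb' : 0 < b-1/2+1 := by linarith
  refine ⟨2/(b-1/2+1) + (4 + (0 + 2 * Bt (b-1/2+1) (b-1/2+1))), by positivity, fun T hT hT2 => ?_⟩
  rw [wm_lint _ _ fpp, ENNReal.ofReal_add pvv pvv, ENNReal.ofReal_add pvv pvv, ENNReal.ofReal_add le_rfl pvv]
  refine (li_cover (s1 := Ioc 0 (T^2)) (s2 := Ioi (T^2)) (s3 := ∅) (s4 := Ioo 0 1)
    (G1 := fun s => eoo (2*T^(-(2*b+1)) * s^(b-1/2))) (G2 := fun s => eoo (2*T*s^(-(3/2):ℝ))) (G3 := fun _ => 0)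
    (G4 := fun s => eoo (2 * (s^(b-1/2) * (1-s)^(b-1/2))))
    measurableSet_Ioo measurableSet_Ioc measurableSet_Ioi MeasurableSet.empty measurableSet_Ioo fpp fpp fpp 0 ?_).trans ?_
  · intro s hs _
    have hs0 := hs.1.le
    have hs1 : 0 ≤ 1 - s := by linarith [hs.2]
    have hq := sqrt_nonneg s
    rw [← ENNReal.ofReal_mul pvv]
    by_cases h2 : s ≤ 1/2
    · have hw := half_pow (b := b-1/2) lnn hs0 h2
      by_cases h3 : s ≤ T^2
      · left
        refine ⟨⟨hs.1, h3⟩, ENNReal.ofReal_le_ofReal ?_⟩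
        have : (T + 2*√s)^(-(2*(b+1))) ≤ T^(-(2*(b+1))) := rpow_le_rpow_of_nonpos hT lnn lnn
        calc s^(b-1/2) * (1-s)^(b-1/2) * (T * (T+2*√s)^(-(2*(b+1)))) ≤ s^(b-1/2) * 2 * (T * T^(-(2*(b+1)))) := by gcongr
          _ = _ := by
            rw [show -(2*b+1) = 1 + -(2*(b+1)) by ring, rpow_add hT, rpow_one]; ring
      · right; left
        push Not at h3
        refine ⟨h3, ENNReal.ofReal_le_ofReal ?_⟩
        have : (T + 2*√s)^(-(2*(b+1))) ≤ (√s)^(-(2*(b+1))) := rpow_le_rpow_of_nonpos (Real.sqrt_pos.2 hs.1) lnn lnn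
        calc s^(b-1/2) * (1-s)^(b-1/2) * (T * (T+2*√s)^(-(2*(b+1)))) ≤ s^(b-1/2) * 2 * (T * (√s)^(-(2*(b+1)))) := by gcongr
          _ = _ := by
            rw [Real.sqrt_eq_rpow, ← rpow_mul hs0, show (-(3/2):ℝ) = (b-1/2) + 1/2 * (-(2*(b+1))) by ring, rpow_add hs.1]; ring
    · right; right; right
      push Not at h2
      refine ⟨hs, ENNReal.ofReal_le_ofReal ?_⟩
      have h5 : (1:ℝ)/2 ≤ √s := Real.le_sqrt_of_sq_le lnn
      have : (T + 2*√s)^(-(2*(b+1))) ≤ 1 := Real.rpow_le_one_of_one_le_of_nonpos lnn lnn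
      calc s^(b-1/2) * (1-s)^(b-1/2) * (T * (T+2*√s)^(-(2*(b+1)))) ≤ s^(b-1/2) * (1-s)^(b-1/2) * (2 * 1) := by gcongr
        _ = _ := by ring
  · refine add_le_add ?_ (add_le_add ?_ (add_le_add ?_ ?_))
    · refine (li_const pvv (li_pow lnn pvv).le).trans (ENNReal.ofReal_le_ofReal (le_of_eq ?_))
      rw [← rpow_natCast, ← rpow_mul hT.le, mul_div_assoc', mul_assoc, ← rpow_add hT, show (-(2*b+1) + ((2:ℕ):ℝ) * (b-1/2+1)) = 0 by push_cast; ring, Real.rpow_zero, mul_one]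
    · refine (li_const pvv (li_tail pvv).le).trans (ENNReal.ofReal_le_ofReal (le_of_eq ?_))
      rw [← rpow_natCast T 2, ← rpow_mul hT.le, show (((2:ℕ):ℝ) * (-(1/2))) = -1 by push_cast; ring, Real.rpow_neg_one]
      field_simp; norm_num
    · simp
    · exact li_const nmm (li_beta lnn lnn).le
lemma far_mid2 {a τ R η N : ℝ} (ha' : 0 < a+1) (hτ0 : 0 < τ) (hη : 0 < η) (hR : R = (τ/η)^(a+1)) (h : τ^2/4 * (η/τ) ≤ N) :
    N^(-(a+1)) ≤ 4^(a+1) * τ^(-(2*(a+1))) * R := by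
  have t2 : ∀ u : ℝ, (τ^2)^u = τ^(2*u) := fun u => by rw [← rpow_natCast, ← rpow_mul hτ0.le]; norm_num
  have e : (η/τ)^(-(a+1)) = (τ/η)^(a+1) := by
    rw [rpow_neg pvv, ← inv_rpow pvv, inv_div]
  refine (rpow_le_rpow_of_nonpos pvv h lnn).trans (le_of_eq ?_)
  rw [mul_rpow pvv pvv, e, div_rpow pvv nmm, t2, rpow_neg (x := 4) nmm, hR,
    div_inv_eq_mul, mul_neg]; ring
lemma far_mid3 {a τ Y : ℝ} (hτ0 : 0 < τ) (h1 : τ^2/4 ≤ Y) (h2 : Y ≤ 2*τ^2) : Y^a ≤ 4^|a| * τ^(2*a) := by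
  have t2 : ∀ u : ℝ, (τ^2)^u = τ^(2*u) := fun u => by rw [← rpow_natCast, ← rpow_mul hτ0.le]; norm_num
  have hq : 0 < τ^2 := by positivity
  have hy : 0 ≤ Y := by linarith
  have b1 : (Y/τ^2)^a ≤ 4^|a| := rpow_box (by rw [le_div_iff₀ hq]; linarith) (by rw [div_le_iff₀ hq]; linarith)
  rw [div_rpow hy hq.le, div_le_iff₀ pvv, t2] at b1
  exact b1
set_option maxHeartbeats 2000000 in
lemma far_A0 {a b : ℝ} (ha : -1 < a) (hb : -1 < b) : ∃ C : ℝ, 0 ≤ C ∧ ∀ p : ℂ, 0 < p.re → ‖p‖ < 1/8 →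
    ∫⁻ Y in Ioo (0:ℝ) 1, eoo (Y^a * (1-Y)^b * (‖p‖ * ‖(Y:ℂ) + (1-Y:ℝ) * p^2‖^(-(a+3/2)))) ≤
      eoo (C * (‖p‖/p.re)^(a+1)) := by
  have hB := Bt_pos (show 0 < a+1 by linarith) (show 0 < b+1 by linarith)
  have ha' : 0 < a + 1 := by linarith
  set c1 : ℝ := 2 * 2^(a+3/2) / (a+1) with hc1
  set c2 : ℝ := 4^(a+1) * 4^|a| * 32 with hc2
  set c3 : ℝ := 4 * 2^(a+3/2) with hc3
  set c4 : ℝ := 4^(a+3/2) * Bt (a+1) (b+1) with hc4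
  refine ⟨c1 + (c2 + (c3 + c4)), by positivity, fun p hη hp => ?_⟩
  set τ := ‖p‖ with hτ
  have hητ : p.re ≤ τ := (le_abs_self _).trans (Complex.abs_re_le_norm p)
  have hτ0 : 0 < τ := hη.trans_le hητ
  have hq : τ^2 ≤ 1/64 := by nlinarith
  set R := (τ/p.re)^(a+1) with hR
  have hR1 : 1 ≤ R := one_le_rpow ((one_le_div hη).2 hητ) ha'.le
  set κ := (p^2).re with hκ
  have hκ1 : |κ| ≤ τ^2 := by
    have := Complex.abs_re_le_norm (p^2)
    rwa [norm_pow] at this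
  have hκ2 := abs_le.1 hκ1
  set y0 := -κ/(1-κ) with hy0
  have hk : 0 < 1 - κ := by linarith
  have hy0b : |y0| ≤ 2*τ^2 := by
    rw [hy0, abs_div, abs_neg, abs_of_pos hk, div_le_iff₀ hk]
    nlinarith
  have hy0c := abs_le.1 hy0b
  have t2 : ∀ u : ℝ, (τ^2)^u = τ^(2*u) := fun u => by rw [← rpow_natCast, ← rpow_mul hτ0.le]; norm_num
  have d1 : 0 ≤ 2 * (τ * (τ^2/2)^(-(a+3/2))) := by positivity
  have d2 : 0 ≤ 8 * 4^(a+1) * 4^|a| * τ⁻¹ * R / 2 := by positivity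
  have key : ∫⁻ Y in Ioo (0:ℝ) 1, eoo (Y^a * (1-Y)^b * (τ * ‖(Y:ℂ) + (1-Y:ℝ) * p^2‖^(-(a+3/2)))) ≤
      eoo c1 + (eoo (c2 * R) + (eoo c3 + eoo c4)) := by
    refine (li_cover (s1 := Ioc 0 (τ^2/4)) (s2 := Icc (y0-4*τ^2) (y0+4*τ^2)) (s3 := Ioi (τ^2)) (s4 := Ioo 0 1)
      (G1 := fun Y => eoo (2 * (τ * (τ^2/2)^(-(a+3/2))) * Y^a))
      (G2 := fun Y => eoo (8 * 4^(a+1) * 4^|a| * τ⁻¹ * R / 2 * |Y-y0|^(-(1/2):ℝ)))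
      (G3 := fun Y => eoo (2 * 2^(a+3/2) * τ * Y^(-(3/2):ℝ)))
      (G4 := fun Y => eoo (4^(a+3/2) * (Y^a * (1-Y)^b)))
      measurableSet_Ioo measurableSet_Ioc measurableSet_Icc measurableSet_Ioi measurableSet_Ioo fpp fpp fpp y0 ?_).trans ?_
    · intro Y hY hYy
      have hY0 := hY.1
      have hY1 : 0 ≤ 1 - Y := by linarith [hY.2]
      set N := ‖(Y:ℂ) + (1-Y:ℝ) * p^2‖ with hN
      have n3 : (Y + (1-Y)*τ^2) * (p.re/τ) ≤ N := S2_3 hτ0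
      have hN0 : 0 < N := lt_of_lt_of_le pvv n3
      by_cases r4 : 1/2 ≤ Y
      · right; right; right
        refine ⟨hY, ENNReal.ofReal_le_ofReal ?_⟩
        have n2 : Y/2 ≤ N := S2_2 lnn hY.2.le
        have : N^(-(a+3/2)) ≤ (1/4:ℝ)^(-(a+3/2)) := rpow_le_rpow_of_nonpos nmm lnn lnn
        rw [one_div, inv_rpow nmm, ← rpow_neg nmm, neg_neg] at this
        calc Y^a * (1-Y)^b * (τ * N^(-(a+3/2))) ≤ Y^a * (1-Y)^b * (1 * 4^(a+3/2)) := by gcongr; linarith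
          _ = _ := by ring
      · push Not at r4
        have hw := half_pow hb hY0.le r4.le
        by_cases r3 : 2*τ^2 ≤ Y
        · right; right; left
          refine ⟨show τ^2 < Y by nlinarith, ENNReal.ofReal_le_ofReal ?_⟩
          have n2 : Y/2 ≤ N := S2_2 r3 hY.2.le
          have : N^(-(a+3/2)) ≤ (Y/2)^(-(a+3/2)) := rpow_le_rpow_of_nonpos lnn n2 lnn
          rw [div_rpow hY0.le nmm, rpow_neg (x := 2) nmm, div_inv_eq_mul] at this
          calc Y^a * (1-Y)^b * (τ * N^(-(a+3/2))) ≤ Y^a * 2 * (τ * (Y^(-(a+3/2)) * 2^(a+3/2))) := by gcongr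
            _ = _ := by
              rw [show (-(3/2):ℝ) = a + -(a+3/2) by ring, rpow_add hY0]; ring
        · push Not at r3
          by_cases r1 : Y ≤ τ^2/4
          · left
            refine ⟨⟨hY0, r1⟩, ENNReal.ofReal_le_ofReal ?_⟩
            have n1 : τ^2/2 ≤ N := S2_1 hY0.le r1 hp
            have : N^(-(a+3/2)) ≤ (τ^2/2)^(-(a+3/2)) := rpow_le_rpow_of_nonpos pvv n1 lnn
            calc Y^a * (1-Y)^b * (τ * N^(-(a+3/2))) ≤ Y^a * 2 * (τ * (τ^2/2)^(-(a+3/2))) := by gcongr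
              _ = _ := by ring
          · push Not at r1
            right; left
            refine ⟨⟨by linarith, by linarith⟩, ENNReal.ofReal_le_ofReal ?_⟩
            have n4 : |Y-y0|/2 ≤ N := by
              refine le_trans ?_ (S2_4 (p := p) (Y := Y))
              have e : Y + (1-Y)*(p^2).re = (1-κ)*(Y-y0) := by
                rw [hy0, ← hκ]; field_simp; ring
              rw [e, abs_mul, abs_of_pos hk]
              nlinarith [abs_nonneg (Y-y0)]
            have hyp : 0 < |Y-y0| := abs_pos.2 (sub_ne_zero.2 hYy)
            have m1 : N^(-(1/2):ℝ) ≤ 2 * |Y-y0|^(-(1/2):ℝ) := by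
              refine (rpow_le_rpow_of_nonpos pvv n4 nmm).trans ?_
              rw [div_rpow hyp.le nmm, rpow_neg (x := 2) nmm, div_inv_eq_mul, mul_comm]
              have : (2:ℝ)^(1/2:ℝ) ≤ 2^(1:ℝ) := Real.rpow_le_rpow_of_exponent_le one_le_two nmm
              rw [rpow_one] at this
              gcongr
            have m2 : N^(-(a+1)) ≤ 4^(a+1) * τ^(-(2*(a+1))) * R :=
              far_mid2 ha' hτ0 hη hR (le_trans (mul_le_mul_of_nonneg_right (by linarith [mul_nonneg hY1 (sq_nonneg τ)]) pvv) n3)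
            have m3 : Y^a ≤ 4^|a| * τ^(2*a) := far_mid3 hτ0 r1.le r3.le
            calc Y^a * (1-Y)^b * (τ * N^(-(a+3/2))) = Y^a * (1-Y)^b * (τ * (N^(-(a+1)) * N^(-(1/2):ℝ))) := by
                  rw [← rpow_add hN0]; ring_nf
              _ ≤ (4^|a| * τ^(2*a)) * 2 * (τ * ((4^(a+1) * τ^(-(2*(a+1))) * R) * (2 * |Y-y0|^(-(1/2):ℝ)))) := by gcongr
              _ = 8 * 4^(a+1) * 4^|a| * (τ^(2*a) * τ^(-(2*(a+1))) * τ) * R / 2 * |Y-y0|^(-(1/2):ℝ) := by ring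
              _ = _ := by
                  have : τ^(2*a) * τ^(-(2*(a+1))) * τ = τ⁻¹ := by
                    rw [← rpow_add hτ0, show 2*a + -(2*(a+1)) = -2 by ring, ← Real.rpow_neg_one τ]
                    nth_rewrite 2 [← rpow_one τ]
                    rw [← rpow_add hτ0]; norm_num
                  rw [this]
    · refine add_le_add ?_ (add_le_add ?_ (add_le_add ?_ ?_))
      · refine (li_const d1 (li_pow ha pvv).le).trans (ENNReal.ofReal_le_ofReal ?_)
        rw [div_rpow pvv nmm, div_rpow pvv nmm, t2, t2, rpow_neg (x := 2) nmm, hc1]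
        have e : τ * τ^(2*(-(a+3/2))) * τ^(2*(a+1)) = 1 := by
          nth_rewrite 1 [← rpow_one τ]
          rw [← rpow_add hτ0, ← rpow_add hτ0]
          ring_nf; exact Real.rpow_zero _
        have e4 : 1 ≤ (4:ℝ)^(a+1) := one_le_rpow nmm ha'.le
        calc _ = (τ * τ^(2*(-(a+3/2))) * τ^(2*(a+1))) * (2 * 2^(a+3/2) / (a+1)) / 4^(a+1) := by
              field_simp
          _ ≤ _ := by rw [e, one_mul]; exact div_le_self pvv e4
      · refine (li_const d2 (li_sing y0 pvv)).trans (ENNReal.ofReal_le_ofReal (le_of_eq ?_))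
        rw [mul_rpow nmm pvv, t2, show (4:ℝ)^(1/2:ℝ) = 2 by
          rw [show (4:ℝ) = 2^(2:ℝ) by norm_num, ← rpow_mul nmm]; norm_num, hc2]
        rw [show 2*(1/2:ℝ) = 1 by norm_num, rpow_one]
        field_simp; ring
      · refine (li_const pvv (li_tail pvv).le).trans (ENNReal.ofReal_le_ofReal (le_of_eq ?_))
        rw [t2, show 2*(-(1/2):ℝ) = -1 by norm_num, Real.rpow_neg_one, hc3]
        field_simp; ring
      · exact li_const pvv (li_beta ha hb).le
  refine key.trans ?_
  have hc1p : 0 ≤ c1 := by positivity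
  have hc2p : 0 ≤ c2 := by positivity
  have hc3p : 0 ≤ c3 := by positivity
  have hc4p : 0 ≤ c4 := by positivity
  rw [← ENNReal.ofReal_add hc3p hc4p, ← ENNReal.ofReal_add pvv pvv, ← ENNReal.ofReal_add hc1p pvv]
  apply ENNReal.ofReal_le_ofReal
  nlinarith [mul_le_mul_of_nonneg_left hR1 hc1p, mul_le_mul_of_nonneg_left hR1 hc3p, mul_le_mul_of_nonneg_left hR1 hc4p]
lemma SS_meas (r : ℂ) : Measurable (fun x => SS x r) := by unfold SS; fun_prop
lemma far_A {a b : ℝ} (ha : -1 < a) (hb : -1 < b) : ∃ C : ℝ, 0 ≤ C ∧ ∀ r : ℂ, ‖r‖ < 1 → ‖pp r‖ < 1/8 →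
    ∫⁻ x, eoo (‖pp r‖ * ‖SS x r‖^(-(2*a+3))) ∂(wm b a) ≤ eoo (C * (‖pp r‖/(pp r).re)^(a+1)) := by
  obtain ⟨C, hC, H⟩ := far_A0 ha hb
  refine ⟨C, hC, fun r hr hp => ?_⟩
  have hm := SS_meas r
  rw [wm_refl _ _ fpp, wm_lint _ _ fpp]
  refine le_trans (le_of_eq ?_) (H (pp r) (pp_re hr) hp)
  apply setLIntegral_congr_fun measurableSet_Ioo
  intro Y hY
  have h1 : 0 ≤ Y := hY.1.le
  have h2 : 0 ≤ 1 - Y := by linarith [hY.2]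
  simp only
  rw [← ENNReal.ofReal_mul pvv]
  congr 3
  have e : ‖(Y:ℂ) + (1-Y:ℝ) * (pp r)^2‖ = ‖SS (1-Y) r‖^2 := by
    rw [← norm_pow, SS_sq]; congr 2; push_cast; ring
  rw [e, ← rpow_natCast, ← rpow_mul (norm_nonneg _)]
  congr 1; push_cast; ring
lemma geo_ne {r : ℂ} (hr : ‖r‖ < 1) : 1 + r ≠ 0 := by
  intro h
  have : r = -1 := by linear_combination h
  rw [this] at hr; simp at hr
lemma geo2 (r : ℂ) : 1 - ‖r‖ ≤ ‖1 - r‖ := by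
  have := norm_sub_norm_le (1:ℂ) r
  rwa [norm_one] at this
lemma geo1 {r : ℂ} (hr : ‖r‖ < 1) : ‖pp r‖/(pp r).re ≤ 2*(‖1-r‖/(1-‖r‖)) := by
  have h1 : 0 < 1 - ‖r‖ := by linarith
  have h2 : 0 < ‖1+r‖ := norm_pos_iff.2 (geo_ne hr)
  have e : (pp r).re = (1-‖r‖^2)/‖1+r‖^2 := by
    rw [← Complex.normSq_eq_norm_sq (1+r), ← Complex.normSq_eq_norm_sq]
    unfold pp
    rw [Complex.div_re, ← add_div]
    congr 1
    rw [Complex.normSq_apply]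
    simp; ring
  have e2 : ‖pp r‖ = ‖1-r‖/‖1+r‖ := by unfold pp; rw [norm_div]
  have h3 : ‖1+r‖ ≤ 2 := by
    refine (norm_add_le _ _).trans ?_
    rw [norm_one]; linarith
  have h4 := norm_nonneg r
  have h5 : 1-‖r‖^2 = (1-‖r‖)*(1+‖r‖) := by ring
  have e3 : ‖pp r‖/(pp r).re = ‖1+r‖ * (‖1-r‖/(1-‖r‖)) / (1+‖r‖) := by
    rw [e, e2, h5]; field_simp
  rw [e3, div_le_iff₀ lnn]
  have h6 : 0 ≤ ‖1-r‖/(1-‖r‖) := by positivity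
  calc ‖1+r‖ * (‖1-r‖/(1-‖r‖)) ≤ 2 * (‖1-r‖/(1-‖r‖)) := by gcongr
    _ ≤ _ := le_mul_of_one_le_right pvv lnn
lemma geo3 {r : ℂ} (h : 1/8 ≤ ‖pp r‖) : 2/9 ≤ ‖1-r‖ := by
  by_contra h1
  push Not at h1
  have h2 := norm_sub_norm_le (2:ℂ) (1-r)
  rw [show (2:ℂ) - (1-r) = 1+r by ring] at h2
  have : ‖(2:ℂ)‖ = 2 := by simp
  rw [this] at h2
  have h3 : 0 < ‖1+r‖ := by linarith
  unfold pp at h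
  rw [norm_div, le_div_iff₀ h3] at h
  linarith
lemma geo4 {r : ℂ} (hr : ‖r‖ < 1) (h : ‖pp r‖ < 1/8) : ‖pp r‖ ≤ ‖1-r‖ := by
  have h3 : 0 < ‖1+r‖ := norm_pos_iff.2 (geo_ne hr)
  have e2 : ‖1-r‖ = ‖pp r‖*‖1+r‖ := by unfold pp; rw [norm_div]; field_simp
  have h2 := norm_sub_norm_le (2:ℂ) (1-r)
  rw [show (2:ℂ) - (1-r) = 1+r by ring] at h2
  have : ‖(2:ℂ)‖ = 2 := by simp
  rw [this] at h2
  rw [e2] at h2 ⊢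
  have h4 : ‖pp r‖*‖1+r‖ ≤ 1/8*‖1+r‖ := by gcongr
  exact le_mul_of_one_le_right (norm_nonneg _) lnn
lemma theta_eq {s : ℝ} (h0 : 0 ≤ s) (h1 : s ≤ 1) : ‖1 - wt1 (1-2*s)‖ = 2*√s := by
  rw [← sq_eq_sq₀ (norm_nonneg _) pvv, ← Complex.normSq_eq_norm_sq, Complex.normSq_apply, mul_pow, sq_sqrt h0]
  simp only [wt1, Complex.sub_re, Complex.sub_im, Complex.one_re, Complex.one_im, zero_sub, neg_mul_neg]
  rw [mul_self_sqrt (by nlinarith)]; ring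
lemma CSet {α : Type*} [MeasurableSpace α] {μ : Measure α} {f : α → ℝ≥0∞} (hf : AEMeasurable f μ) (s : Set α) {A B : ℝ} (hA : 0 ≤ A) (hB : 0 ≤ B)
    (h1 : ∫⁻ x, f x^2 ∂μ ≤ eoo (A^2)) (h2 : μ s ≤ eoo (B^2)) : ∫⁻ x in s, f x ∂μ ≤ eoo (A*B) := by
  have h := ENNReal.lintegral_mul_le_Lp_mul_Lq (μ.restrict s) (p := 2) (q := 2) (by constructor <;> norm_num) hf.restrict (aemeasurable_const (b := (1:ℝ≥0∞)))
  simp only [Pi.mul_apply, mul_one, ENNReal.one_rpow, lintegral_const, one_mul, Measure.restrict_apply_univ, ENNReal.rpow_two] at h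
  refine h.trans ?_
  rw [ENNReal.ofReal_mul hA]
  have key : ∀ {X : ℝ≥0∞} {A : ℝ}, 0 ≤ A → X ≤ eoo (A^2) → X^(1/2:ℝ) ≤ eoo A := by
    intro X A hA hX
    refine (ENNReal.rpow_le_rpow hX nmm).trans ?_
    rw [ENNReal.ofReal_rpow_of_nonneg pvv nmm, ← Real.sqrt_eq_rpow, Real.sqrt_sq hA]
  refine mul_le_mul' (key hA ((lintegral_mono' Measure.restrict_le_self le_rfl).trans h1)) ?_
  rw [one_pow, one_mul]
  exact key hB h2
lemma wm_Iio {α β : ℝ} (hα : -1 < α) (hβ : -1 < β) : ∃ C : ℝ, 0 ≤ C ∧ ∀ c : ℝ, 0 < c → wm α β (Iio c) ≤ eoo (C * c^(α+1)) := by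
  have := wm_fin hα hβ
  have hα' : 0 < α+1 := by linarith
  set M := (wm α β univ).toReal with hM
  have hM0 : 0 ≤ M := ENNReal.toReal_nonneg
  have e1 : 0 ≤ 2/(α+1) := by positivity
  have e2 : 0 ≤ M*2^(α+1) := by positivity
  refine ⟨2/(α+1) + M*2^(α+1), by positivity, fun c hc => ?_⟩
  have hcp : 0 ≤ c^(α+1) := by positivity
  by_cases h : c ≤ 1/2
  · rw [← lintegral_indicator_one measurableSet_Iio, wm_lint _ _ (measurable_one.indicator measurableSet_Iio), ← lintegral_indicator measurableSet_Ioo]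
    calc _ ≤ ∫⁻ x, (Ioc 0 c).indicator (fun x => eoo (2 * x^α)) x := by
          apply lintegral_mono
          intro x
          by_cases hx : x ∈ Ioo (0:ℝ) 1
          · by_cases hx2 : x < c
            · have h0 := hx.1
              simp only [indicator_of_mem hx, indicator_of_mem (show x ∈ Iio c from hx2), indicator_of_mem (show x ∈ Ioc 0 c from ⟨hx.1, hx2.le⟩), Pi.one_apply, mul_one]
              apply ENNReal.ofReal_le_ofReal
              rw [mul_comm]
              exact mul_le_mul_of_nonneg_right (half_pow hβ h0.le lnn) pvv
            · simp only [indicator_of_mem hx, indicator_of_notMem (show x ∉ Iio c from hx2), mul_zero]; exact zero_le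
          · simp only [indicator_of_notMem hx]; exact zero_le
      _ ≤ eoo (2 * (c^(α+1)/(α+1))) := by
          rw [lintegral_indicator measurableSet_Ioc]
          exact li_const nmm (li_pow hα hc.le).le
      _ ≤ _ := by
          apply ENNReal.ofReal_le_ofReal
          have : 2 * (c^(α+1)/(α+1)) = 2/(α+1)*c^(α+1) := by ring
          rw [this]
          gcongr; linarith
  · push Not at h
    refine (measure_mono (subset_univ _)).trans ?_
    rw [← ENNReal.ofReal_toReal (measure_ne_top (wm α β) univ)]
    apply ENNReal.ofReal_le_ofReal
    have h2 : 1 ≤ (2*c)^(α+1) := one_le_rpow lnn hα'.le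
    rw [mul_rpow nmm hc.le] at h2
    calc M ≤ M * (2^(α+1)*c^(α+1)) := le_mul_of_one_le_right hM0 h2
      _ = (M*2^(α+1))*c^(α+1) := by ring
      _ ≤ _ := by gcongr; linarith
lemma near_meas {a b : ℝ} (ha : -1 < a) (hb : -(1/2) < b) : ∃ C : ℝ, 0 ≤ C ∧ ∀ τ : ℝ, 0 < τ →
    pim a b ((Ioi (1-16*τ^2)) ×ˢ (Iio (100*τ^2))) ≤ eoo ((C * τ^(a+b+3/2))^2) := by
  obtain ⟨C1, hC1, H1⟩ := wm_Iio (α := a) (β := b) ha lnn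
  obtain ⟨C2, hC2, H2⟩ := wm_Iio (α := b-1/2) (β := b-1/2) lnn lnn
  refine ⟨√(C1*16^(a+1)*(C2*100^(b-1/2+1))), by positivity, fun τ hτ => ?_⟩
  unfold pim
  rw [Measure.prod_prod]
  have t2 : ∀ u : ℝ, (τ^2)^u = τ^(2*u) := fun u => by rw [← rpow_natCast, ← rpow_mul hτ.le]; norm_num
  have e : wm b a (Ioi (1-16*τ^2)) = wm a b (Iio (16*τ^2)) := by
    rw [← lintegral_indicator_one measurableSet_Ioi, ← lintegral_indicator_one measurableSet_Iio,
      wm_refl _ _ (measurable_one.indicator measurableSet_Ioi)]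
    congr 1; ext x
    by_cases hx : x < 16*τ^2
    · rw [indicator_of_mem (show x ∈ Iio (16*τ^2) from hx), indicator_of_mem (show 1 - x ∈ Ioi (1-16*τ^2) from by simpa using hx)]; rfl
    · rw [indicator_of_notMem (show x ∉ Iio (16*τ^2) from hx), indicator_of_notMem (show 1 - x ∉ Ioi (1-16*τ^2) from by simpa using hx)]
  rw [e]
  refine (mul_le_mul' (H1 _ pvv) (H2 _ pvv)).trans (le_of_eq ?_)
  rw [← ENNReal.ofReal_mul pvv]
  congr 1
  rw [mul_pow, sq_sqrt pvv, mul_rpow nmm pvv, mul_rpow nmm pvv, t2, t2,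
    ← rpow_natCast (τ^(a+b+3/2)), ← rpow_mul hτ.le, show (a+b+3/2)*((2:ℕ):ℝ) = 2*(a+1) + 2*(b-1/2+1) by push_cast; ring, rpow_add hτ]
  ring
lemma far_int1 {a b : ℝ} (ha : -1 < a) (hb : -(1/2) < b) : ∃ C : ℝ, 0 ≤ C ∧ ∀ r : ℂ, ‖r‖ < 1 → ‖pp r‖ < 1/8 →
    ∫⁻ q, eoo (‖pp r‖ * ‖SS q.1 r‖^(-(2*a+3)) *
      ((√(1-q.1) + ‖pp r‖) * (√(1-q.1) + ‖pp r‖ + 2*√q.2)^(-(2*(b+1))))) ∂(pim a b) ≤ eoo (C * (‖pp r‖/(pp r).re)^(a+1)) := by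
  obtain ⟨CA, hA, HA⟩ := far_A (a := a) (b := b) ha lnn
  obtain ⟨CB, hB, HB⟩ := far_B hb
  refine ⟨CA * CB, by positivity, fun r hr hp => ?_⟩
  have hm := SS_meas r
  have hp0 : 0 < ‖pp r‖ := norm_pos_iff.2 (fun h => by have := pp_re hr; rw [h] at this; simp at this)
  unfold pim
  have hm1 : Measurable (fun q : ℝ × ℝ => SS q.1 r) := hm.comp measurable_fst
  rw [lintegral_prod _ fpp]
  calc _ ≤ ∫⁻ x, eoo (‖pp r‖ * ‖SS x r‖^(-(2*a+3))) * eoo CB ∂(wm b a) := by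
        apply lintegral_mono_ae
        filter_upwards [wm_ae b a] with x hx
        have h1 : √(1-x) ≤ 1 := Real.sqrt_le_one.2 (by linarith [hx.1])
        have h0 : 0 ≤ ‖pp r‖ * ‖SS x r‖^(-(2*a+3)) := by positivity
        simp_rw [ENNReal.ofReal_mul h0]
        rw [lintegral_const_mul' _ _ ENNReal.ofReal_ne_top]
        refine mul_le_mul' le_rfl (HB (√(1-x) + ‖pp r‖) pvv lnn)
    _ ≤ _ := by
        rw [lintegral_mul_const' _ _ ENNReal.ofReal_ne_top]
        refine (mul_le_mul' (HA r hr hp) le_rfl).trans (le_of_eq ?_)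
        have : 0 ≤ (‖pp r‖/(pp r).re)^(a+1) := rpow_nonneg (div_nonneg hp0.le (pp_re hr).le) _
        rw [← ENNReal.ofReal_mul pvv]
        congr 1; ring
lemma far_int2 {a b : ℝ} (ha : -1 < a) (hb : -(1/2) < b) : ∃ C : ℝ, 0 ≤ C ∧ ∀ r : ℂ, ‖r‖ < 1 → ‖pp r‖ < 1/8 →
    ∫⁻ q, eoo (‖pp r‖ * ‖SS q.1 r‖^(-(2*a+3))) ∂(pim a b) ≤ eoo (C * (‖pp r‖/(pp r).re)^(a+1)) := by
  obtain ⟨CA, hA, HA⟩ := far_A (a := a) (b := b) ha lnn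
  have hfin := wm_fin (α := b-1/2) (β := b-1/2) lnn lnn
  set M := (wm (b-1/2) (b-1/2) univ).toReal with hM
  have hM0 : 0 ≤ M := ENNReal.toReal_nonneg
  refine ⟨CA * M, by positivity, fun r hr hp => ?_⟩
  have hm := SS_meas r
  have hp0 : 0 ≤ ‖pp r‖ := norm_nonneg _
  unfold pim
  have hm1 : Measurable (fun q : ℝ × ℝ => SS q.1 r) := hm.comp measurable_fst
  rw [lintegral_prod _ fpp]
  simp only [lintegral_const]
  rw [lintegral_mul_const' _ _ (measure_ne_top _ _)]
  refine (mul_le_mul' (HA r hr hp) le_rfl).trans (le_of_eq ?_)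
  have : 0 ≤ (‖pp r‖/(pp r).re)^(a+1) := rpow_nonneg (div_nonneg hp0 (pp_re hr).le) _
  rw [← ENNReal.ofReal_toReal (measure_ne_top (wm (b-1/2) (b-1/2)) univ), ← ENNReal.ofReal_mul pvv]
  congr 1; ring
lemma FL_far {a b : ℝ} (ha : -1 < a) (hb : -(1/2) < b) : ∃ C : ℝ, 0 ≤ C ∧ ∀ r : ℂ, ‖r‖ < 1 → ‖pp r‖ < 1/8 →
    ∀ q : ℝ × ℝ, q.1 ∈ Ioo (0:ℝ) 1 → q.2 ∈ Ioo (0:ℝ) 1 → q ∉ (Ioi (1-16*‖pp r‖^2)) ×ˢ (Iio (100*‖pp r‖^2)) →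
    ‖FL a b q r‖ ≤ C * (‖pp r‖ * ‖SS q.1 r‖^(-(2*a+3)) *
      ((√(1-q.1) + ‖pp r‖) * (√(1-q.1) + ‖pp r‖ + 2*√q.2)^(-(2*(b+1))))) + (C * (‖pp r‖ * ‖SS q.1 r‖^(-(2*a+3))) + 1) := by
  obtain ⟨C1, hC1, H1⟩ := pt_Z ha hb
  obtain ⟨C2, hC2, H2⟩ := pt_d0 ha hb
  refine ⟨C1 + C2, by positivity, fun r hr hp q hx hs hq => ?_⟩
  have hp0 := norm_nonneg (pp r)
  have hth := theta_eq hs.1.le hs.2.le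
  have g1 := H1 r q.1 (1-2*q.2) hr hp hx.1.le hx.2.le (by nlinarith [hs.1, hs.2]) (by
    by_contra hcon
    push Not at hcon
    apply hq
    rw [hth] at hcon
    obtain ⟨c1, c2⟩ := hcon
    have i1 := sq_sqrt (show 0 ≤ 1 - q.1 by linarith [hx.2])
    have i2 := sq_sqrt hs.1.le
    have i3 : √(1-q.1)^2 < (4*‖pp r‖)^2 := pow_lt_pow_left₀ c1 (sqrt_nonneg _) nmm
    have i4 : √q.2^2 < (10*‖pp r‖)^2 := pow_lt_pow_left₀ lnn (sqrt_nonneg _) nmm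
    refine ⟨?_, ?_⟩
    · show 1-16*‖pp r‖^2 < q.1
      rw [i1, mul_pow] at i3; linarith
    · show q.2 < 100*‖pp r‖^2
      rw [i2, mul_pow] at i4; linarith)
  rw [hth] at g1
  have g2 := H2 r q.1 hr hp hx.1.le hx.2.le
  have h0 : 0 ≤ ‖pp r‖ * ‖SS q.1 r‖^(-(2*a+3)) := by positivity
  have h3 : 0 ≤ ‖pp r‖ * ‖SS q.1 r‖^(-(2*a+3)) *
      ((√(1-q.1) + ‖pp r‖) * (√(1-q.1) + ‖pp r‖ + 2*√q.2)^(-(2*(b+1)))) := by positivity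
  unfold FL
  refine (norm_sub_le _ _).trans ?_
  rw [← add_assoc]
  refine add_le_add ((norm_sub_le _ _).trans (add_le_add (g1.trans ?_) ?_)) (e2_abs a b)
  · gcongr; linarith
  · rw [norm_mul]
    calc _ ≤ 1 * ‖Ft a b d0 q.1 r‖ := by gcongr; exact e1_abs b
      _ ≤ _ := by rw [one_mul]; refine g2.trans ?_; gcongr; linarith
lemma L1_big {a b : ℝ} (ha : -1 < a) (hb : -(1/2) < b) : ∃ C : ℝ, 0 ≤ C ∧ ∀ r : ℂ, ‖r‖ < 1 → ∀ (s : Set (ℝ×ℝ)) (B : ℝ), 0 ≤ B → pim a b s ≤ eoo (B^2) →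
    ∫⁻ q in s, eoo ‖FL a b q r‖ ∂(pim a b) ≤ eoo (C * (1-‖r‖)^(-(a+b+3/2)) * B) := by
  obtain ⟨C, hC, H⟩ := L2_bound ha hb
  refine ⟨√C, by positivity, fun r hr s B hB hs => ?_⟩
  have h1 : 0 ≤ 1 - ‖r‖ := by linarith
  refine CSet (FL_aemeas ha hb hr).norm.ennreal_ofReal s pvv hB ?_ hs
  simp_rw [← ENNReal.ofReal_pow (norm_nonneg _)]
  refine (H r hr).trans (le_of_eq ?_)
  congr 1
  rw [mul_pow, sq_sqrt hC, ← rpow_natCast _ 2, ← rpow_mul h1]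
  congr 2; push_cast; ring
lemma L1_bound {a b : ℝ} (ha : -1 < a) (hb : -(1/2) < b) : ∃ C : ℝ, 0 ≤ C ∧ ∀ r : ℂ, ‖r‖ < 1 →
    ∫⁻ q, eoo ‖FL a b q r‖ ∂(pim a b) ≤ eoo (C * (‖1-r‖/(1-‖r‖))^(a+b+3/2)) := by
  obtain ⟨D0, hD0, H0⟩ := L1_big ha hb
  obtain ⟨D1, hD1, H1⟩ := near_meas ha hb
  obtain ⟨D2, hD2, H2⟩ := FL_far ha hb
  obtain ⟨D3, hD3, H3⟩ := far_int1 ha hb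
  obtain ⟨D4, hD4, H4⟩ := far_int2 ha hb
  have hfin := pim_fin ha hb
  set M := (pim a b univ).toReal with hM
  have hM0 : 0 ≤ M := ENNReal.toReal_nonneg
  have hMe : pim a b univ = eoo M := (ENNReal.ofReal_toReal (measure_ne_top (pim a b) univ)).symm
  set γ := a+b+3/2 with hγ
  have hγ0 : 0 < γ := by linarith
  set E1 := D0 * √M * (9/2)^γ with hE1
  set E2 := D0 * D1 with hE2
  set E3 := (D2 * D3 + D2 * D4)*2^γ with hE3
  have p1 : 0 ≤ E1 := by positivity
  have p2 : 0 ≤ E2 := by positivity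
  have p3 : 0 ≤ E3 := by positivity
  refine ⟨E1 + E2 + E3 + M, by positivity, fun r hr => ?_⟩
  have hd : 0 < 1 - ‖r‖ := by linarith
  have hr2 := geo2 r
  set Q := ‖1-r‖/(1-‖r‖) with hQ
  have hQ1 : 1 ≤ Q := (one_le_div hd).2 hr2
  have hQg : 1 ≤ Q^γ := one_le_rpow hQ1 hγ0.le
  have hdneg : (1-‖r‖)^(-γ) = ((1-‖r‖)^γ)⁻¹ := rpow_neg hd.le _
  have hQe : Q^γ = ‖1-r‖^γ * (1-‖r‖)^(-γ) := by rw [hQ, div_rpow (norm_nonneg _) hd.le, hdneg, div_eq_mul_inv]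
  by_cases hp : ‖pp r‖ < 1/8
  · have hre := pp_re hr
    have hre2 : (pp r).re ≤ ‖pp r‖ := Complex.re_le_norm _
    have hτ : 0 < ‖pp r‖ := hre.trans_le hre2
    set S : Set (ℝ × ℝ) := (Ioi (1-16*‖pp r‖^2)) ×ˢ (Iio (100*‖pp r‖^2)) with hS
    have hSm : MeasurableSet S := measurableSet_Ioi.prod measurableSet_Iio
    rw [← lintegral_add_compl _ hSm]
    have near : ∫⁻ q in S, eoo ‖FL a b q r‖ ∂(pim a b) ≤ eoo (E2 * Q^γ) := by
      refine (H0 r hr S (D1 * ‖pp r‖^γ) pvv (H1 _ hτ)).trans (ENNReal.ofReal_le_ofReal ?_)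
      rw [hQe]
      calc _ = E2 * (‖pp r‖^γ * (1-‖r‖)^(-γ)) := by rw [hE2]; ring
        _ ≤ _ := by
          gcongr
          exact geo4 hr hp
    have hQR : (‖pp r‖/(pp r).re)^(a+1) ≤ 2^γ * Q^γ := by
      calc _ ≤ (‖pp r‖/(pp r).re)^γ := Real.rpow_le_rpow_of_exponent_le ((one_le_div hre).2 hre2) lnn
        _ ≤ (2*Q)^γ := Real.rpow_le_rpow pvv (geo1 hr) hγ0.le
        _ = _ := mul_rpow nmm lnn
    have far : ∫⁻ q in Sᶜ, eoo ‖FL a b q r‖ ∂(pim a b) ≤ eoo (E3 * Q^γ + M) := by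
      have hm1 : Measurable (fun q : ℝ × ℝ => SS q.1 r) := (SS_meas r).comp measurable_fst
      set R := (‖pp r‖/(pp r).re)^(a+1) with hR
      have hR0 : 0 ≤ R := by positivity
      set F1 : ℝ × ℝ → ℝ := fun q => (‖pp r‖ * ‖SS q.1 r‖^(-(2*a+3)) *
          ((√(1-q.1) + ‖pp r‖) * (√(1-q.1) + ‖pp r‖ + 2*√q.2)^(-(2*(b+1))))) with hF1
      set F2 : ℝ × ℝ → ℝ := fun q => (‖pp r‖ * ‖SS q.1 r‖^(-(2*a+3))) with hF2
      have mF1 : Measurable F1 := by rw [hF1]; fun_prop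
      have mF2 : Measurable F2 := by rw [hF2]; fun_prop
      have n1 : ∀ q, 0 ≤ F1 q := fun q => by simp only [hF1]; positivity
      have n2 : ∀ q, 0 ≤ F2 q := fun q => by simp only [hF2]; positivity
      calc _ ≤ ∫⁻ q in Sᶜ, (eoo (D2 * F1 q) + (eoo (D2 * F2 q) + eoo 1)) ∂(pim a b) := by
            apply lintegral_mono_ae
            filter_upwards [ae_restrict_mem hSm.compl, ae_restrict_of_ae (pim_ae a b)] with q hq hq2
            rw [← ENNReal.ofReal_add (mul_nonneg hD2 (n2 q)) zero_le_one, ← ENNReal.ofReal_add (mul_nonneg hD2 (n1 q)) (add_nonneg (mul_nonneg hD2 (n2 q)) zero_le_one)]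
            exact ENNReal.ofReal_le_ofReal (H2 r hr hp q hq2.1 hq2.2 hq)
        _ ≤ ∫⁻ q, (eoo (D2 * F1 q) + (eoo (D2 * F2 q) + eoo 1)) ∂(pim a b) :=
            lintegral_mono' Measure.restrict_le_self le_rfl
        _ ≤ eoo (D2 * (D3 * R)) + (eoo (D2 * (D4 * R)) + eoo M) := by
            rw [lintegral_add_left fpp, lintegral_add_left fpp]
            simp_rw [ENNReal.ofReal_mul hD2]
            rw [lintegral_const_mul' _ _ ENNReal.ofReal_ne_top, lintegral_const_mul' _ _ ENNReal.ofReal_ne_top, lintegral_const, ENNReal.ofReal_one, one_mul, hMe]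
            exact add_le_add (mul_le_mul' le_rfl (H3 r hr hp)) (add_le_add (mul_le_mul' le_rfl (H4 r hr hp)) le_rfl)
        _ ≤ _ := by
            rw [← ENNReal.ofReal_add pvv hM0, ← ENNReal.ofReal_add pvv pvv]
            apply ENNReal.ofReal_le_ofReal
            have : (D2*D3+D2*D4)*R ≤ (D2*D3+D2*D4)*(2^γ*Q^γ) := by gcongr
            rw [hE3]; linarith
    refine (add_le_add near far).trans ?_
    rw [← ENNReal.ofReal_add pvv pvv]
    apply ENNReal.ofReal_le_ofReal
    have i1 : M * 1 ≤ M * Q^γ := by gcongr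
    have i2 : 0 ≤ E1 * Q^γ := by positivity
    linarith
  · push Not at hp
    have h3 := geo3 hp
    rw [← Measure.restrict_univ (μ := pim a b)]
    refine (H0 r hr univ (√M) pvv (by rw [sq_sqrt hM0, hMe])).trans (ENNReal.ofReal_le_ofReal ?_)
    have i0 : (2/9:ℝ)^γ ≤ ‖1-r‖^γ := Real.rpow_le_rpow nmm h3 hγ0.le
    have i1 : 1 ≤ (9/2:ℝ)^γ * ‖1-r‖^γ := by
      rw [← mul_rpow nmm (norm_nonneg _)]
      exact one_le_rpow lnn hγ0.le
    have i4 : 0 ≤ D0 * (1-‖r‖)^(-γ) * √M := by positivity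
    calc D0 * (1-‖r‖)^(-γ) * √M ≤ (D0 * (1-‖r‖)^(-γ) * √M) * ((9/2:ℝ)^γ * ‖1-r‖^γ) := le_mul_of_one_le_right i4 i1
      _ = E1 * Q^γ := by rw [hQe, hE1]; ring
      _ ≤ _ := by gcongr; linarith
lemma cauchy_hs {f g : ℕ → ℂ} {F G : ℂ} (hf : HasSum f F) (hg : HasSum g G) :
    HasSum (fun n => ∑ k ∈ Finset.range (n+1), f k * g (n-k)) (F*G) := by
  have h1 := hf.summable.norm
  have h2 := hg.summable.norm
  have := (summable_norm_sum_mul_range_of_summable_norm h1 h2).of_norm.hasSum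
  rwa [← tsum_mul_tsum_eq_tsum_sum_range_of_summable_norm h1 h2, hf.tsum_eq, hg.tsum_eq] at this
noncomputable def cC (a b δ : ℝ) (n : ℕ) (q : ℝ × ℝ) : ℝ :=
  ∑ m ∈ Finset.range (n+1), binomC (δ-1) (n-m) * KnU a b m (1,1) (ph q)
lemma cC_hasSum {a b δ : ℝ} (ha : -1 < a) (hb : -(1/2) < b) {q : ℝ × ℝ} (h1 : q.1 ∈ Ioo (0:ℝ) 1) (h2 : q.2 ∈ Ioo (0:ℝ) 1) {r : ℂ} (hr : ‖r‖ < 1) :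
    HasSum (fun n => (cC a b δ n q : ℂ) * r^n) (FL a b q r * (1-r)⁻¹ * (1-r)^(-(δ:ℂ))) := by
  have e1 := cauchy_hs (FL_hasSum ha hb h1 h2 hr) (hasSum_geometric_of_norm_lt_one hr)
  have e2 : HasSum (fun n => (KnU a b n (1,1) (ph q) : ℂ) * r^n) (FL a b q r * (1-r)⁻¹) := by
    refine hs_congr e1 (fun n => ?_) rfl
    unfold KnU
    push_cast
    rw [Finset.sum_mul]
    apply Finset.sum_congr rfl
    intro k hk
    rw [mul_assoc, ← pow_add]; congr 2
    have := Finset.mem_range.1 hk; omega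
  refine hs_congr (cauchy_hs e2 (hasSum_bn δ hr)) (fun n => ?_) rfl
  unfold cC
  push_cast
  rw [Finset.sum_mul]
  apply Finset.sum_congr rfl
  intro k hk
  have e : n = k + (n-k) := by have := Finset.mem_range.1 hk; omega
  have e3 : r^n = r^k * r^(n-k) := by rw [← pow_add, ← e]
  have e4 : binomC (δ-1) (n-k) = bn δ (n-k) := by unfold binomC bn; rw [sub_add_cancel]
  rw [e3, e4]; ring
lemma exp_int (m : ℤ) : ∫ χ in Ioc (-π) π, Complex.exp (m * χ * Complex.I) = if m = 0 then (2*π:ℂ) else 0 := by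
  rw [← intervalIntegral.integral_of_le (by linarith [Real.pi_pos])]
  split_ifs with h
  · subst h; simp; ring
  · have e : ∀ χ : ℝ, Complex.exp (m * χ * Complex.I) = Complex.exp ((m * Complex.I) * χ) := fun χ => by ring_nf
    simp_rw [e]
    have h0 : (m * Complex.I : ℂ) ≠ 0 := mul_ne_zero (by exact_mod_cast h) Complex.I_ne_zero
    rw [integral_exp_mul_complex h0]
    have : Complex.exp (m * Complex.I * (π:ℝ)) = Complex.exp (m * Complex.I * ((-π:ℝ):ℂ)) := by
      rw [Complex.exp_eq_exp_iff_exists_int]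
      exact ⟨m, by push_cast; ring⟩
    rw [this, sub_self, zero_div]
noncomputable def rr (ρ χ : ℝ) : ℂ := ρ * Complex.exp (χ * Complex.I)
lemma rr_norm {ρ χ : ℝ} (h : 0 ≤ ρ) : ‖rr ρ χ‖ = ρ := by
  unfold rr
  rw [norm_mul, Complex.norm_exp_ofReal_mul_I, mul_one, Complex.norm_real, Real.norm_eq_abs, abs_of_nonneg h]
lemma rr_meas (ρ : ℝ) : Measurable (rr ρ) := by unfold rr; fun_prop
lemma coef_le {c : ℕ → ℂ} {G : ℂ → ℂ} (h : ∀ r : ℂ, ‖r‖ < 1 → HasSum (fun n => c n * r^n) (G r)) {ρ : ℝ} (h0 : 0 ≤ ρ) (h1 : ρ < 1) (n : ℕ) :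
    eoo (2*π*(‖c n‖*ρ^n)) ≤ ∫⁻ χ in Ioc (-π) π, eoo ‖G (rr ρ χ)‖ := by
  have hsum : Summable (fun k => ‖c k‖*ρ^k) := by
    have := (h (ρ:ℂ) (by rw [Complex.norm_real, Real.norm_eq_abs, abs_of_nonneg h0]; exact h1)).summable.norm
    simpa [abs_of_nonneg h0] using this
  set F : ℕ → ℝ → ℂ := fun k χ => c k * ρ^k * Complex.exp (((k-n:ℤ):ℂ) * χ * Complex.I) with hF
  have nF : ∀ k χ, ‖F k χ‖ = ‖c k‖*ρ^k := by
    intro k χ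
    have e : (((k-n:ℤ):ℂ) * χ * Complex.I) = (((k-n:ℤ):ℝ)*χ:ℝ) * Complex.I := by push_cast; ring
    simp only [hF]
    rw [e, norm_mul, Complex.norm_exp_ofReal_mul_I, mul_one, norm_mul, norm_pow, Complex.norm_real, Real.norm_eq_abs, abs_of_nonneg h0]
  have hi : ∀ k, Integrable (F k) (volume.restrict (Ioc (-π) π)) := by
    intro k
    have : Continuous (F k) := by simp only [hF]; fun_prop
    exact (this.integrableOn_Icc (a := -π) (b := π)).mono_set Ioc_subset_Icc_self
  have hS := hasSum_integral_of_summable_integral_norm hi (by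
    simp_rw [nF]
    simp only [integral_const]
    exact hsum.const_smul _)
  have ts : ∀ χ : ℝ, ∑' k, F k χ = G (rr ρ χ) * Complex.exp (-(n * χ * Complex.I)) := by
    intro χ
    have := (h (rr ρ χ) (by rw [rr_norm h0]; exact h1)).mul_right (Complex.exp (-(n * χ * Complex.I)))
    rw [← this.tsum_eq]
    congr 1; ext k
    simp only [hF, rr]
    rw [mul_pow, ← Complex.exp_nat_mul, mul_assoc (c k), mul_assoc (c k), mul_assoc ((ρ:ℂ)^k), ← Complex.exp_add]
    congr 3; push_cast; ring
  simp_rw [ts] at hS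
  have hS2 : HasSum (fun k => ∫ χ in Ioc (-π) π, F k χ) (c n * ρ^n * (2*π)) := by
    have e : ∀ k, ∫ χ in Ioc (-π) π, F k χ = if k = n then c n * ρ^n * (2*π) else 0 := by
      intro k
      simp only [hF]
      rw [integral_const_mul, exp_int]
      by_cases hk : k = n
      · subst hk; simp
      · rw [if_neg hk, if_neg (by omega), mul_zero]
    simp_rw [e]
    exact hasSum_ite_eq n _
  have e := hS.unique hS2
  have : 2*π*(‖c n‖*ρ^n) = ‖∫ χ in Ioc (-π) π, G (rr ρ χ) * Complex.exp (-(n * χ * Complex.I))‖ := by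
    rw [e, norm_mul, norm_mul, norm_pow, Complex.norm_real, Real.norm_eq_abs, abs_of_nonneg h0, norm_mul, Complex.norm_real, Real.norm_eq_abs, abs_of_pos Real.pi_pos]
    simp; ring
  rw [this]
  rw [ofReal_norm]
  refine (enorm_integral_le_lintegral_enorm _).trans (le_of_eq ?_)
  congr 1; ext χ
  rw [← ofReal_norm, norm_mul, show (-(n * χ * Complex.I) : ℂ) = ((-(n*χ):ℝ):ℂ) * Complex.I by push_cast; ring, Complex.norm_exp_ofReal_mul_I, mul_one]
lemma ang_lower {ρ χ : ℝ} (h0 : 1/2 ≤ ρ) (h1 : ρ < 1) (hχ : |χ| ≤ π) : ((1-ρ) + |χ|)/5 ≤ ‖1 - rr ρ χ‖ := by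
  have i1 : 1 - ρ ≤ ‖1 - rr ρ χ‖ := by
    have := geo2 (rr ρ χ); rwa [rr_norm lnn] at this
  have i2 : |χ|/4 ≤ ‖1 - rr ρ χ‖ := by
    rw [← sq_le_sq₀ pvv (norm_nonneg _), ← Complex.normSq_eq_norm_sq, Complex.normSq_apply]
    have hc := Real.cos_le_one_sub_mul_cos_sq hχ
    have e : (1 - rr ρ χ).re * (1 - rr ρ χ).re + (1 - rr ρ χ).im * (1 - rr ρ χ).im = (1-ρ)^2 + 2*ρ*(1-Real.cos χ) := by
      unfold rr
      rw [Complex.exp_mul_I, ← Complex.ofReal_cos, ← Complex.ofReal_sin]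
      simp only [Complex.sub_re, Complex.one_re, Complex.sub_im, Complex.one_im, Complex.re_ofReal_mul, Complex.im_ofReal_mul, Complex.add_re, Complex.add_im, Complex.ofReal_re, Complex.ofReal_im, Complex.mul_re, Complex.mul_im, Complex.I_re, Complex.I_im]
      have := Real.sin_sq_add_cos_sq χ
      linear_combination ρ^2 * this
    rw [e]
    have hpi : 1/8 ≤ 2/π^2 := by
      rw [div_le_div_iff₀ nmm pvv]
      nlinarith [Real.pi_lt_four, Real.pi_pos]
    have h3 : 1/8*χ^2 ≤ 2/π^2*χ^2 := by gcongr
    have h4 : 1/8*χ^2 ≤ 1 - Real.cos χ := by linarith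
    have h5 : 0 ≤ 1 - Real.cos χ := by linarith [Real.cos_le_one χ]
    have h6 : 1*(1 - Real.cos χ) ≤ 2*ρ*(1 - Real.cos χ) := by gcongr; linarith
    rw [div_pow, sq_abs]
    nlinarith [sq_nonneg (1-ρ), sq_nonneg χ]
  linarith
lemma ang_int {ε : ℝ} (hε : 0 < ε) : ∃ C : ℝ, 0 ≤ C ∧ ∀ ρ : ℝ, 1/2 ≤ ρ → ρ < 1 →
    ∫⁻ χ in Ioc (-π) π, eoo (‖1 - rr ρ χ‖^(-(1+ε))) ≤ eoo (C * (1-ρ)^(-ε)) := by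
  refine ⟨5^(1+ε) * (2/ε), by positivity, fun ρ h0 h1 => ?_⟩
  set h := 1 - ρ with hh
  have hp : 0 < h := by linarith
  set v : ℝ → ℝ≥0∞ := (Ici h).indicator (fun x => eoo (x^(-(1+ε)))) with hv
  have vm : Measurable v := Measurable.indicator fpp measurableSet_Ici
  have vi : ∫⁻ x, v x = eoo (h^(-ε)/ε) := by
    rw [hv, lintegral_indicator measurableSet_Ici, setLIntegral_congr Ioi_ae_eq_Ici.symm]
    have hi := integrableOn_Ioi_rpow_of_lt (a := -(1+ε)) lnn hp
    rw [← ofReal_integral_eq_lintegral_ofReal hi, integral_Ioi_rpow_of_lt lnn hp]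
    · congr 1; rw [show -(1+ε)+1 = -ε by ring]; field_simp
    · filter_upwards [ae_restrict_mem measurableSet_Ioi] with x hx
      exact rpow_nonneg (hp.trans hx).le _
  calc _ ≤ ∫⁻ χ in Ioc (-π) π, eoo (5^(1+ε)) * (v (χ + h) + v (h - χ)) := by
        apply lintegral_mono_ae
        filter_upwards [ae_restrict_mem measurableSet_Ioc] with χ hχ
        have hl := ang_lower h0 h1 (abs_le.2 ⟨hχ.1.le, hχ.2⟩)
        rw [← hh] at hl
        have b1 : ‖1 - rr ρ χ‖^(-(1+ε)) ≤ 5^(1+ε) * (h+|χ|)^(-(1+ε)) := by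
          refine (rpow_le_rpow_of_nonpos pvv hl lnn).trans (le_of_eq ?_)
          rw [div_rpow pvv nmm, rpow_neg (x := 5) nmm, div_inv_eq_mul, mul_comm]
        refine (ENNReal.ofReal_le_ofReal b1).trans ?_
        rw [ENNReal.ofReal_mul pvv]
        refine mul_le_mul' le_rfl ?_
        rcases le_total 0 χ with hc | hc
        · refine le_trans (le_of_eq ?_) le_self_add
          rw [hv, indicator_of_mem (show χ + h ∈ Ici h from by simpa using hc), abs_of_nonneg hc, add_comm]
        · refine le_trans (le_of_eq ?_) le_add_self
          rw [hv, indicator_of_mem (show h - χ ∈ Ici h from by simpa using hc), abs_of_nonpos hc, sub_eq_add_neg]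
    _ ≤ ∫⁻ χ, eoo (5^(1+ε)) * (v (χ + h) + v (h - χ)) := lintegral_mono' Measure.restrict_le_self le_rfl
    _ = eoo (5^(1+ε)) * (eoo (h^(-ε)/ε) + eoo (h^(-ε)/ε)) := by
        rw [lintegral_const_mul' _ _ ENNReal.ofReal_ne_top, lintegral_add_left fpp, lintegral_add_right_eq_self v h, lintegral_sub_left_eq_self v h, vi]
    _ = _ := by
        rw [← ENNReal.ofReal_add pvv pvv, ← ENNReal.ofReal_mul pvv]
        congr 1; ring
lemma binom_lower {δ : ℝ} (hδ : 0 < δ) : ∃ C : ℝ, 0 ≤ C ∧ ∀ n : ℕ, ((n:ℝ)+2)^δ ≤ C * binomC δ n := by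
  have ht := Real.GammaSeq_tendsto_Gamma (δ+1)
  obtain ⟨B, hB⟩ := ht.bddAbove_range
  have hB0 : ∀ n, Real.GammaSeq (δ+1) n ≤ B := fun n => hB ⟨n, rfl⟩
  have bp : ∀ n, 0 < binomC δ n := fun n => by
    unfold binomC
    have := poch_pos (show 0 < δ+1 by linarith) n
    positivity
  refine ⟨2^δ + 3^δ * (|B| * (δ+2)), by positivity, fun n => ?_⟩
  rcases Nat.eq_zero_or_pos n with rfl | hn
  · have e : binomC δ 0 = 1 := by simp [binomC, poch_zero]
    rw [e, mul_one]; simp only [Nat.cast_zero, zero_add]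
    have : 0 ≤ (3:ℝ)^δ * (|B| * (δ+2)) := by positivity
    linarith
  · have hn1 : (1:ℝ) ≤ n := by exact_mod_cast hn
    have hn0 : (0:ℝ) < n := by linarith
    have h1 := (hB0 n).trans (le_abs_self B)
    unfold Real.GammaSeq at h1
    have e : ∏ j ∈ Finset.range (n+1), (δ+1+(j:ℝ)) = poch (δ+1) n * (δ+1+n) := by
      rw [← poch_succ]; rfl
    have pp := poch_pos (show 0 < δ+1 by linarith) n
    have fp : (0:ℝ) < n.factorial := by positivity
    rw [e, div_le_iff₀ pvv, rpow_add hn0, rpow_one] at h1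
    have h2 : (n:ℝ)^δ * n ≤ |B| * (δ+2) * binomC δ n * n := by
      have : binomC δ n * n.factorial = poch (δ+1) n := by unfold binomC; field_simp
      rw [← this] at h1
      have h3 : (n:ℝ)^δ * n * n.factorial ≤ (|B| * binomC δ n * (δ+1+n)) * n.factorial := by linarith
      have h4 := le_of_mul_le_mul_right h3 fp
      refine h4.trans ?_
      have b0 := (bp n).le
      have : |B| * binomC δ n * (δ+1+n) ≤ |B| * binomC δ n * ((δ+2)*n) := by
        gcongr; nlinarith
      linarith
    have h3 := le_of_mul_le_mul_right h2 hn0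
    have b0 := bp n
    calc ((n:ℝ)+2)^δ ≤ (3*n)^δ := Real.rpow_le_rpow pvv lnn hδ.le
      _ = 3^δ * n^δ := mul_rpow nmm hn0.le
      _ ≤ 3^δ * (|B| * (δ+2) * binomC δ n) := by gcongr
      _ ≤ (2^δ + 3^δ * (|B| * (δ+2))) * binomC δ n := by
        have : 0 ≤ (2:ℝ)^δ * binomC δ n := by positivity
        linarith
lemma FL_joint {a b : ℝ} (ha : -1 < a) (hb : -(1/2) < b) {ρ : ℝ} (h0 : 0 ≤ ρ) (h1 : ρ < 1) (ν : Measure ℝ) [SFinite ν] :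
    AEMeasurable (fun z : (ℝ × ℝ) × ℝ => FL a b z.1 (rr ρ z.2)) ((pim a b).prod ν) := by
  refine aemeasurable_of_tendsto_metrizable_ae atTop (f := fun N z => ∑ n ∈ Finset.range N, (PnU a b n (1,1) (ph z.1) : ℂ) * (rr ρ z.2)^n) (fun N => ?_) ?_
  · have := fun n => Pn_meas a b n (1,1)
    have := ph_meas
    have := rr_meas ρ
    exact Measurable.aemeasurable fpp
  · filter_upwards [(Measure.quasiMeasurePreserving_fst (μ := pim a b) (ν := ν)).ae (pim_ae a b)] with z hz
    exact (FL_hasSum ha hb hz.1 hz.2 (by rw [rr_norm h0]; exact h1)).tendsto_sum_nat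
lemma rho_pow (n : ℕ) : 1 ≤ 3 * (1 - 1/((n:ℝ)+2))^n := by
  have e : (1 - 1/((n:ℝ)+2)) = (1 + 1/((n:ℝ)+1))⁻¹ := by field_simp; ring
  have h : (1 + 1/((n:ℝ)+1))^n ≤ 3 := by
    have h1 : 1 + 1/((n:ℝ)+1) ≤ Real.exp (1/((n:ℝ)+1)) := by linarith [Real.add_one_le_exp (1/((n:ℝ)+1))]
    calc (1 + 1/((n:ℝ)+1))^n ≤ (Real.exp (1/((n:ℝ)+1)))^n := by gcongr
      _ = Real.exp (n * (1/((n:ℝ)+1))) := by rw [← Real.exp_nat_mul]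
      _ ≤ Real.exp 1 := by
        apply Real.exp_le_exp.2
        rw [mul_one_div, div_le_one pvv]; linarith
      _ ≤ 3 := by linarith [Real.exp_one_lt_d9]
  rw [e, inv_pow, ← div_eq_mul_inv, le_div_iff₀ pvv, one_mul]
  exact h
lemma final_bound {a b δ : ℝ} (ha : -1 < a) (hb : -(1/2) < b) (hδ : a + b + 3/2 < δ) : ∃ C : ℝ, 0 ≤ C ∧ ∀ n : ℕ,
    ∫⁻ q, eoo |KnUCes a b δ n (1,1) (ph q)| ∂(pim a b) ≤ eoo C := by
  obtain ⟨C1, hC1, H1⟩ := L1_bound ha hb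
  set γ := a+b+3/2 with hγ
  obtain ⟨C2, hC2, H2⟩ := ang_int (show 0 < δ - γ by linarith)
  obtain ⟨C3, hC3, H3⟩ := binom_lower (show 0 < δ by linarith)
  refine ⟨C3 * 3 * (C1 * C2), by positivity, fun n => ?_⟩
  have hfin := pim_fin ha hb
  set h : ℝ := 1/((n:ℝ)+2) with hh
  have hp : 0 < h := by positivity
  have hp2 : h ≤ 1/2 := by
    rw [hh]; apply one_div_le_one_div_of_le nmm; linarith [show (0:ℝ) ≤ n from Nat.cast_nonneg n]
  set ρ := 1 - h with hρ
  have hρ0 : 0 ≤ ρ := by linarith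
  have hρ1 : ρ < 1 := by linarith
  have hρh : 1 - ρ = h := by rw [hρ]; ring
  have hrp : 1 ≤ 3 * ρ^n := rho_pow n
  have bp : 0 < binomC δ n := by
    unfold binomC
    have := poch_pos (show 0 < δ+1 by linarith) n
    positivity
  have hpi := Real.pi_pos
  set ν : Measure ℝ := volume.restrict (Ioc (-π) π) with hν
  -- main double integral
  have main : ∫⁻ q, eoo (2*π*(|cC a b δ n q| * ρ^n)) ∂(pim a b) ≤ eoo (C1 * C2 * ((n:ℝ)+2)^δ) := by
    calc _ ≤ ∫⁻ q, ∫⁻ χ, eoo (‖1 - rr ρ χ‖^(-(1+δ)) * ‖FL a b q (rr ρ χ)‖) ∂ν ∂(pim a b) := by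
          apply lintegral_mono_ae
          filter_upwards [pim_ae a b] with q hq
          have := coef_le (c := fun n => (cC a b δ n q : ℂ)) (G := fun r => FL a b q r * (1-r)⁻¹ * (1-r)^(-(δ:ℂ)))
            (fun r hr => cC_hasSum ha hb hq.1 hq.2 hr) hρ0 hρ1 n
          rw [Complex.norm_real, Real.norm_eq_abs] at this
          refine this.trans (le_of_eq ?_)
          apply lintegral_congr
          intro χ
          congr 1
          have hr : ‖rr ρ χ‖ < 1 := by rw [rr_norm hρ0]; exact hρ1
          have hne : 0 < ‖1 - rr ρ χ‖ := lt_of_lt_of_le lnn (geo2 _)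
          rw [norm_mul, norm_mul, norm_inv, ← Complex.ofReal_neg, Complex.norm_cpow_real, show -(1+δ) = -1 + -δ by ring, rpow_add hne, Real.rpow_neg_one]
          ring
      _ = ∫⁻ χ, ∫⁻ q, eoo (‖1 - rr ρ χ‖^(-(1+δ)) * ‖FL a b q (rr ρ χ)‖) ∂(pim a b) ∂ν := by
          apply lintegral_lintegral_swap
          have m1 : Measurable (fun z : (ℝ × ℝ) × ℝ => ‖1 - rr ρ z.2‖^(-(1+δ))) := by
            have := rr_meas ρ; fun_prop
          exact (m1.aemeasurable.mul (FL_joint ha hb hρ0 hρ1 ν).norm).ennreal_ofReal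
      _ ≤ ∫⁻ χ, eoo (C1 * h^(-γ)) * eoo (‖1 - rr ρ χ‖^(-(1+(δ-γ)))) ∂ν := by
          apply lintegral_mono
          intro χ
          have hr : ‖rr ρ χ‖ < 1 := by rw [rr_norm hρ0]; exact hρ1
          have hne : 0 < ‖1 - rr ρ χ‖ := lt_of_lt_of_le lnn (geo2 _)
          have hn0 : 0 ≤ ‖1 - rr ρ χ‖^(-(1+δ)) := by positivity
          simp_rw [ENNReal.ofReal_mul hn0]
          rw [lintegral_const_mul' _ _ ENNReal.ofReal_ne_top]
          refine (mul_le_mul' le_rfl (H1 _ hr)).trans (le_of_eq ?_)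
          rw [← ENNReal.ofReal_mul hn0, ← ENNReal.ofReal_mul pvv, rr_norm hρ0, hρh, div_rpow hne.le hp.le,
            show -(1+(δ-γ)) = -(1+δ) + γ by ring, rpow_add hne (-(1+δ)) γ, rpow_neg hp.le]
          congr 1; ring
      _ ≤ eoo (C1 * h^(-γ)) * eoo (C2 * h^(-(δ-γ))) := by
          rw [lintegral_const_mul' _ _ ENNReal.ofReal_ne_top]
          refine mul_le_mul' le_rfl ?_
          rw [← hρh]
          exact H2 ρ lnn hρ1
      _ = _ := by
          rw [← ENNReal.ofReal_mul pvv]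
          congr 1
          have : h^(-γ) * h^(-(δ-γ)) = ((n:ℝ)+2)^δ := by
            rw [← rpow_add hp, hh, one_div, show -γ + -(δ-γ) = -δ by ring, inv_rpow pvv, rpow_neg pvv, inv_inv]
          rw [← this]; ring
  have hle : ∀ q, |KnUCes a b δ n (1,1) (ph q)| ≤ ((binomC δ n)⁻¹ * 3) * (2*π*(|cC a b δ n q| * ρ^n)) := by
    intro q
    have e : KnUCes a b δ n (1,1) (ph q) = (binomC δ n)⁻¹ * cC a b δ n q := rfl
    rw [e, abs_mul, abs_of_pos (inv_pos.2 bp)]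
    have i1 : (1:ℝ) ≤ 2*π := by linarith [Real.pi_gt_three]
    have i2 : 1 ≤ (3*ρ^n)*(2*π) := one_le_mul_of_one_le_of_one_le hrp i1
    calc (binomC δ n)⁻¹ * |cC a b δ n q| ≤ ((binomC δ n)⁻¹ * |cC a b δ n q|) * ((3*ρ^n)*(2*π)) := le_mul_of_one_le_right pvv i2
      _ = _ := by ring
  calc _ ≤ ∫⁻ q, eoo (((binomC δ n)⁻¹ * 3) * (2*π*(|cC a b δ n q| * ρ^n))) ∂(pim a b) :=
        lintegral_mono (fun q => ENNReal.ofReal_le_ofReal (hle q))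
    _ ≤ eoo ((binomC δ n)⁻¹ * 3) * eoo (C1 * C2 * ((n:ℝ)+2)^δ) := by
        simp_rw [ENNReal.ofReal_mul (show 0 ≤ (binomC δ n)⁻¹ * 3 by positivity)]
        rw [lintegral_const_mul' _ _ ENNReal.ofReal_ne_top]
        exact mul_le_mul' le_rfl main
    _ ≤ _ := by
        rw [← ENNReal.ofReal_mul pvv]
        apply ENNReal.ofReal_le_ofReal
        calc (binomC δ n)⁻¹ * 3 * (C1 * C2 * ((n:ℝ)+2)^δ) ≤ (binomC δ n)⁻¹ * 3 * (C1 * C2 * (C3 * binomC δ n)) := by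
              gcongr; exact H3 n
          _ = _ := by field_simp
/-- uniform boundedness in `n` of the `L¹(𝕌; U_{a,b})` norms of the
Cesàro `(C,δ)` kernels with one argument at the corner `𝟏 = (1,1)`, for `δ > a+b+3/2`. -/
theorem stmt1 (a b δ : ℝ) (ha : -1 < a) (hb : -(1/2) < b) (hδ : a + b + 3/2 < δ) :
    ∃ C : ℝ, ∀ n : ℕ,
      dU a b * ∫ y in Udom, |KnUCes a b δ n (1, 1) y| * Uw a b y ≤ C := by
  
  obtain ⟨C, hC, H⟩ := final_bound ha hb hδ
  exact reduce a b δ C hC H
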